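/- arXiv:0904.2094 — 2 statements merged into one kernel-verified Lean document; each statement's English description precedes it below -/
import Mathlib

section
/- Let q ≥ 2 be an integer, let H = 1 − 1/(2q), and let (B_k)_{k∈ℕ} be a discrete fractional Brownian motion with Hurst index H. Set V_n = Σ_{k=0}^{n−1} H_q(B_{k+1} − B_k). Then E[V_n²]/(n log n) → 2 q! (1 − 1/(2q))^q (1 − 1/q)^q as n → ∞. -/
open MeasureTheory ProbabilityTheory Filter Topology

lemma integrable_poly_gauss (v : NNReal) (p : Polynomial ℝ) :
    Integrable (fun x => p.eval x) (gaussianReal 0 v) := by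
  induction p using Polynomial.induction_on' with
  | add p q hp hq =>
    simp only [Polynomial.eval_add]
    exact hp.add hq
  | monomial n a =>
    simp only [Polynomial.eval_monomial]
    refine Integrable.const_mul ?_ a
    have h : MemLp (id : ℝ → ℝ) (n : NNReal) (gaussianReal 0 v) := memLp_id_gaussianReal n
    have := h.integrable_norm_pow' (p := n)
    refine (integrable_norm_iff (by fun_prop)).1 ?_
    simpa using this

lemma integrable_poly_pdf (p : Polynomial ℝ) :
    Integrable (fun x => gaussianPDFReal 0 1 x * p.eval x) := by
  have h := integrable_poly_gauss 1 p
  rw [gaussianReal_of_var_ne_zero _ one_ne_zero,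
    integrable_withDensity_iff_integrable_smul' (measurable_gaussianPDF _ _)
      (ae_of_all _ fun _ ↦ gaussianPDF_lt_top)] at h
  simpa using h

lemma gauss_stein (p : Polynomial ℝ) :
    ∫ x, (Polynomial.X * p - Polynomial.derivative p).eval x ∂(gaussianReal 0 1) = 0 := by
  rw [integral_gaussianReal_eq_integral_smul one_ne_zero]
  simp only [smul_eq_mul]
  have h1 : ∀ x, HasDerivAt (fun x => gaussianPDFReal 0 1 x * p.eval x)
      (-(gaussianPDFReal 0 1 x * (Polynomial.X * p - Polynomial.derivative p).eval x)) x := by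
    intro x
    have h2 : HasDerivAt (fun x => gaussianPDFReal 0 1 x) (gaussianPDFReal 0 1 x * (-x)) x := by
      simp only [gaussianPDFReal]
      have h3 : HasDerivAt (fun x : ℝ => -(x - 0)^2/(2*((1:NNReal):ℝ))) (-x) x := by
        have := (((hasDerivAt_id x).sub_const 0).pow 2).neg.div_const (2*((1:NNReal):ℝ))
        refine HasDerivAt.congr_deriv this ?_
        simp
        ring
      refine HasDerivAt.congr_deriv (h3.exp.const_mul _) ?_
      ring
    refine HasDerivAt.congr_deriv (h2.mul (p.hasDerivAt x)) ?_
    simp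
    ring
  have := integral_eq_zero_of_hasDerivAt_of_integrable h1 (integrable_poly_pdf _).neg
    (integrable_poly_pdf p)
  rw [integral_neg] at this
  linarith

lemma hermite_ibp (n : ℕ) (p : Polynomial ℝ) :
    ∫ x, (((Polynomial.hermite n).map (Int.castRingHom ℝ)) * p).eval x ∂(gaussianReal 0 1)
     = ∫ x, (Polynomial.derivative^[n] p).eval x ∂(gaussianReal 0 1) := by
  induction n generalizing p with
  | zero => simp
  | succ n ih =>
    rw [Function.iterate_succ_apply, ← ih]
    have h := gauss_stein (((Polynomial.hermite n).map (Int.castRingHom ℝ)) * p)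
    rw [← sub_eq_zero, ← integral_sub (integrable_poly_gauss _ _) (integrable_poly_gauss _ _)]
    refine Eq.trans ?_ h
    refine integral_congr_ae (ae_of_all _ fun x => ?_)
    beta_reduce
    rw [← Polynomial.eval_sub]
    congr 1
    rw [Polynomial.hermite_succ, Polynomial.derivative_mul]
    simp only [Polynomial.map_sub, Polynomial.map_mul, Polynomial.map_X, Polynomial.derivative_map]
    ring

lemma iter_deriv_comp (r z : ℝ) (p : Polynomial ℝ) (n : ℕ) :
    Polynomial.derivative^[n] (p.comp (Polynomial.C r * Polynomial.X + Polynomial.C z)) =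
     Polynomial.C (r^n) * (Polynomial.derivative^[n] p).comp (Polynomial.C r * Polynomial.X + Polynomial.C z) := by
  induction n with
  | zero => simp
  | succ n ih =>
    rw [Function.iterate_succ_apply', ih, Function.iterate_succ_apply']
    rw [Polynomial.derivative_C_mul, Polynomial.derivative_comp]
    simp [pow_succ]
    ring

lemma hermite_iter (n : ℕ) : Polynomial.derivative^[n] ((Polynomial.hermite n).map (Int.castRingHom ℝ))
    = Polynomial.C (n.factorial : ℝ) := by
  have hm : ((Polynomial.hermite n).map (Int.castRingHom ℝ)).natDegree = n := by
    rw [(Polynomial.hermite_monic n).natDegree_map, Polynomial.natDegree_hermite]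
  ext k
  rw [Polynomial.coeff_iterate_derivative, Polynomial.coeff_C]
  split_ifs with h
  · subst h
    simp [Nat.descFactorial_self]
  · rw [Polynomial.coeff_eq_zero_of_natDegree_lt (by omega)]
    simp

lemma inner_integral (q : ℕ) (r z : ℝ) :
    ∫ x, (((Polynomial.hermite q).map (Int.castRingHom ℝ)).eval x *
      ((Polynomial.hermite q).map (Int.castRingHom ℝ)).eval (r * x + z)) ∂(gaussianReal 0 1)
     = q.factorial * r ^ q := by
  have h := hermite_ibp q (((Polynomial.hermite q).map (Int.castRingHom ℝ)).comp
    (Polynomial.C r * Polynomial.X + Polynomial.C z))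
  rw [iter_deriv_comp, hermite_iter] at h
  simp only [Polynomial.eval_mul, Polynomial.eval_comp, Polynomial.eval_add, Polynomial.eval_C,
    Polynomial.eval_X, Polynomial.C_comp] at h
  rw [h, integral_const]
  simp [mul_comm]

lemma hermite_cov {Ω : Type*} {mΩ : MeasurableSpace Ω} (μ : Measure Ω) [IsProbabilityMeasure μ]
    (q : ℕ) (X Y : Ω → ℝ) (hX : Measurable X) (hY : Measurable Y)
    (hG : ∀ a b : ℝ, ∃ v : NNReal, Measure.map (fun ω => a * X ω + b * Y ω) μ = gaussianReal 0 v)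
    (hXX : ∫ ω, X ω * X ω ∂μ = 1) (r : ℝ) (hXY : ∫ ω, X ω * Y ω ∂μ = r) :
    Integrable (fun ω => (Polynomial.aeval (X ω) (Polynomial.hermite q) : ℝ) *
        (Polynomial.aeval (Y ω) (Polynomial.hermite q) : ℝ)) μ ∧
    ∫ ω, (Polynomial.aeval (X ω) (Polynomial.hermite q) : ℝ) *
        (Polynomial.aeval (Y ω) (Polynomial.hermite q) : ℝ) ∂μ = q.factorial * r ^ q := by
  set P := (Polynomial.hermite q).map (Int.castRingHom ℝ) with hP
  have hae : ∀ x : ℝ, (Polynomial.aeval x (Polynomial.hermite q) : ℝ) = P.eval x := by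
    intro x
    rw [hP, Polynomial.eval_map, Polynomial.aeval_def]
    rfl
  simp only [hae]
  -- memLp
  have hmem : ∀ W : Ω → ℝ, Measurable W → (∃ v : NNReal, Measure.map W μ = gaussianReal 0 v) →
      ∀ p : Polynomial ℝ, MemLp (fun ω => p.eval (W ω)) 2 μ := by
    rintro W hW ⟨v, hv⟩ p
    have hmeas : Measurable (fun ω => p.eval (W ω)) := p.continuous.measurable.comp hW
    rw [memLp_two_iff_integrable_sq hmeas.aestronglyMeasurable]
    have := integrable_poly_gauss v (p ^ 2)
    rw [← hv, integrable_map_measure (by fun_prop) hW.aemeasurable] at this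
    simpa [Function.comp_def] using this
  have hXg : ∃ v : NNReal, Measure.map X μ = gaussianReal 0 v := by simpa using hG 1 0
  have hYg : ∃ v : NNReal, Measure.map Y μ = gaussianReal 0 v := by simpa using hG 0 1
  have hint : Integrable (fun ω => P.eval (X ω) * P.eval (Y ω)) μ :=
    (hmem X hX hXg P).integrable_mul (hmem Y hY hYg P)
  refine ⟨hint, ?_⟩
  have hX2 : MemLp X 2 μ := by simpa using hmem X hX hXg Polynomial.X
  have hY2 : MemLp Y 2 μ := by simpa using hmem Y hY hYg Polynomial.X
  have hX0 : ∫ ω, X ω ∂μ = 0 := by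
    obtain ⟨v, hv⟩ := hXg
    have : ∫ x, x ∂(Measure.map X μ) = 0 := by rw [hv]; simp
    rwa [integral_map hX.aemeasurable (by fun_prop)] at this
  have hX1 : Measure.map X μ = gaussianReal 0 1 := by
    obtain ⟨v, hv⟩ := hXg
    rw [hv]
    have h1 : Var[X; μ] = 1 := by
      rw [variance_of_integral_eq_zero hX.aemeasurable hX0, ← hXX]
      simp [pow_two]
    have h2 : Var[id; Measure.map X μ] = v := by rw [hv]; simp
    rw [variance_map (by fun_prop) hX.aemeasurable] at h2
    simp only [Function.id_comp] at h2
    congr 1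
    apply NNReal.coe_injective
    rw [← h2, h1]; simp
  set Z : Ω → ℝ := fun ω => Y ω - r * X ω with hZdef
  have hZ : Measurable Z := by fun_prop
  have hZ2 : MemLp Z 2 μ := hY2.sub (hX2.const_mul r)
  have hlaw : HasGaussianLaw (fun ω => (X ω, Z ω)) μ := by
    constructor
    refine ⟨fun L => ?_⟩
    have hL : ∀ x z, L (x, z) = x * L (1, 0) + z * L (0, 1) := by
      intro x z
      have : ((x, z) : ℝ × ℝ) = x • (1, 0) + z • (0, 1) := by
        ext <;> simp
      rw [this, map_add, map_smul, map_smul]; simp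
    obtain ⟨v, hv⟩ := hG (L (1, 0) - r * L (0,1)) (L (0, 1))
    have hm : (Measure.map (fun ω => (X ω, Z ω)) μ).map L = gaussianReal 0 v := by
      rw [Measure.map_map (by fun_prop) (by fun_prop), ← hv]
      congr 1
      ext ω
      rw [Function.comp_apply, hL]
      simp only [hZdef]
      ring
    have e1 : ∫ x, L x ∂(Measure.map (fun ω => (X ω, Z ω)) μ) = 0 := by
      have : ∫ x, x ∂((Measure.map (fun ω => (X ω, Z ω)) μ).map L) = 0 := by rw [hm]; simp
      rwa [integral_map (by fun_prop) (by fun_prop)] at this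
    have e2 : Var[L; Measure.map (fun ω => (X ω, Z ω)) μ] = v := by
      have : Var[id; (Measure.map (fun ω => (X ω, Z ω)) μ).map L] = v := by rw [hm]; simp
      rwa [variance_map (by fun_prop) (by fun_prop)] at this
    rw [hm, e1, e2]
    simp
  have hcov : cov[X, Z; μ] = 0 := by
    rw [covariance_eq_sub hX2 hZ2]
    simp only [Pi.mul_apply, hX0, zero_mul, sub_zero, hZdef]
    have : ∀ ω, X ω * (Y ω - r * X ω) = X ω * Y ω - r * (X ω * X ω) := fun ω => by ring
    simp only [this]
    have i1 : Integrable (fun ω => X ω * Y ω) μ := hX2.integrable_mul hY2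
    have i2 : Integrable (fun ω => X ω * X ω) μ := hX2.integrable_mul hX2
    rw [integral_sub i1 (i2.const_mul r), integral_const_mul, hXX, hXY]
    ring
  have hind := hlaw.indepFun_of_covariance_eq_zero hcov
  rw [indepFun_iff_map_prod_eq_prod_map_map hX.aemeasurable hZ.aemeasurable, hX1] at hind
  have hF : Measurable (fun w : ℝ × ℝ => P.eval w.1 * P.eval (r * w.1 + w.2)) :=
    (P.continuous.measurable.comp measurable_fst).mul (P.continuous.measurable.comp (by fun_prop))
  have hcomp : (fun ω => P.eval (X ω) * P.eval (Y ω)) =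
      fun ω => (fun w : ℝ × ℝ => P.eval w.1 * P.eval (r * w.1 + w.2)) (X ω, Z ω) := by
    ext ω; simp [hZdef]
  have hpair : Measurable (fun ω => (X ω, Z ω)) := by fun_prop
  rw [hcomp] at hint ⊢
  have hint2 := (integrable_map_measure hF.aestronglyMeasurable hpair.aemeasurable).2 hint
  rw [← integral_map hpair.aemeasurable hF.aestronglyMeasurable]
  have : IsProbabilityMeasure (Measure.map Z μ) := Measure.isProbabilityMeasure_map hZ.aemeasurable
  rw [hind] at hint2 ⊢
  rw [integral_prod_symm _ hint2]
  simp only [hP, inner_integral]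
  simp

lemma stolz (a b : ℕ → ℝ) (L : ℝ) (hb : ∀ n, b n < b (n+1)) (hbt : Tendsto b atTop atTop)
    (h : Tendsto (fun n => (a (n+1) - a n) / (b (n+1) - b n)) atTop (𝓝 L)) :
    Tendsto (fun n => a n / b n) atTop (𝓝 L) := by
  have hpos : ∀ n, 0 < b (n+1) - b n := fun n => sub_pos.2 (hb n)
  have h1 : (fun n => (a (n+1) - L * b (n+1)) - (a n - L * b n)) =o[atTop]
      (fun n => b (n+1) - b n) := by
    rw [Asymptotics.isLittleO_iff_tendsto' (Eventually.of_forall fun n h => absurd h (hpos n).ne')]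
    have := h.sub_const L
    rw [sub_self] at this
    refine this.congr fun n => ?_
    have := (hpos n).ne'
    field_simp
    ring
  have h2 := h1.sum_range (fun n => (hpos n).le) (by
    simp only [Finset.sum_range_sub]
    exact tendsto_atTop_add_const_right _ _ hbt)
  simp only [Finset.sum_range_sub (f := b), Finset.sum_range_sub (f := fun n => a n - L * b n)] at h2
  have h3 : (fun n => b n - b 0) =O[atTop] b := by
    refine (Asymptotics.isBigO_refl _ _).sub ?_
    exact ((Asymptotics.isLittleO_const_left (c := b 0)).2
      (Or.inr (tendsto_norm_atTop_atTop.comp hbt))).isBigO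
  have h4 := h2.trans_isBigO h3
  have h5 : (fun _ : ℕ => a 0 - L * b 0) =o[atTop] b :=
    Asymptotics.isLittleO_const_left.2 (Or.inr (tendsto_norm_atTop_atTop.comp hbt))
  have h6 := (h4.add h5).tendsto_div_nhds_zero
  have h7 := h6.add_const L
  rw [zero_add] at h7
  refine h7.congr' ?_
  filter_upwards [hbt.eventually_gt_atTop 0] with n hn
  field_simp
  ring

lemma second_diff (α : ℝ) :
    Tendsto (fun h : ℝ => ((1+h)^α + (1-h)^α - 2) / h^2) (𝓝[>] 0) (𝓝 (α * (α-1))) := by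
  have hev : ∀ᶠ h : ℝ in 𝓝[>] 0, 0 < h ∧ h < 1 := by
    filter_upwards [Ioo_mem_nhdsGT (zero_lt_one' ℝ)] with h hh using hh
  refine HasDerivAt.lhopital_zero_nhdsGT (f' := fun h => α * ((1+h)^(α-1) - (1-h)^(α-1)))
    (g' := fun h => 2 * h) ?_ ?_ ?_ ?_ ?_ ?_
  · filter_upwards [hev] with h hh
    have h1 := ((hasDerivAt_id h).const_add 1).rpow_const (p := α) (Or.inl (by simp; linarith))
    have h2 := ((hasDerivAt_id h).const_sub 1).rpow_const (p := α) (Or.inl (by simp; linarith))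
    refine HasDerivAt.congr_deriv ((h1.add h2).sub_const 2) ?_
    simp; ring
  · refine Eventually.of_forall fun h => ?_
    simpa using hasDerivAt_pow 2 h
  · filter_upwards [hev] with h hh
    linarith [hh.1]
  · have : ContinuousAt (fun h : ℝ => (1+h)^α + (1-h)^α - 2) 0 := by
      refine ContinuousAt.sub (ContinuousAt.add ?_ ?_) continuousAt_const <;>
      exact ContinuousAt.rpow_const (by fun_prop) (Or.inl (by norm_num))
    have h0 := this.tendsto
    norm_num at h0
    exact h0.mono_left nhdsWithin_le_nhds
  · have : ContinuousAt (fun h : ℝ => h^2) 0 := by fun_prop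
    have h0 := this.tendsto
    norm_num at h0
    exact h0.mono_left nhdsWithin_le_nhds
  · have hd : HasDerivAt (fun h : ℝ => α * ((1+h)^(α-1) - (1-h)^(α-1)) / 2) (α * (α-1)) 0 := by
      have h1 := ((hasDerivAt_id (0:ℝ)).const_add 1).rpow_const (p := α-1) (Or.inl (by simp))
      have h2 := ((hasDerivAt_id (0:ℝ)).const_sub 1).rpow_const (p := α-1) (Or.inl (by simp))
      refine HasDerivAt.congr_deriv (((h1.sub h2).const_mul α).div_const 2) ?_
      simp; ring
    have := (hasDerivAt_iff_tendsto_slope.1 hd).mono_left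
      (nhdsWithin_mono 0 (fun x (hx : 0 < x) => hx.ne'))
    refine this.congr' ?_
    filter_upwards [hev] with h hh
    have := hh.1.ne'
    simp [slope_def_field]
    field_simp

lemma rho_asymp (q : ℕ) (hq : 2 ≤ q) (H : ℝ) (hH : H = 1 - 1 / (2 * (q : ℝ))) :
    Tendsto (fun n : ℕ => (n : ℝ) * ((1/2:ℝ) * (((n:ℝ)+1)^(2*H) + |(n:ℝ)-1|^(2*H) - 2 * (n:ℝ)^(2*H)))^q)
      atTop (𝓝 ((1 - 1 / (2 * (q : ℝ))) ^ q * (1 - 1 / (q : ℝ)) ^ q)) := by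
  have hq0 : (q:ℝ) ≠ 0 := by positivity
  have h0 : Tendsto (fun n : ℕ => ((n:ℝ))⁻¹) atTop (𝓝[>] 0) :=
    tendsto_inv_atTop_nhdsGT_zero.comp tendsto_natCast_atTop_atTop
  have h1 := (((second_diff (2*H)).comp h0).const_mul (1/2)).pow q
  have e : (1/2 * (2*H*(2*H-1)))^q = (1 - 1 / (2 * (q : ℝ))) ^ q * (1 - 1 / (q : ℝ)) ^ q := by
    rw [← mul_pow, hH]
    congr 1
    field_simp
    ring
  rw [e] at h1
  refine h1.congr' ?_
  filter_upwards [eventually_gt_atTop 0] with n hn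
  have hn' : (0:ℝ) < n := by exact_mod_cast hn
  have hn1 : (1:ℝ) ≤ n := by exact_mod_cast hn
  have ha : (n:ℝ) = ((n:ℝ)^(2-2*H))^q := by
    rw [← Real.rpow_natCast, ← Real.rpow_mul hn'.le]
    have : (2-2*H) * q = 1 := by rw [hH]; field_simp; ring
    rw [this, Real.rpow_one]
  have hb : (n:ℝ)^(2-2*H) = n^2 * ((n:ℝ)^(2*H))⁻¹ := by
    rw [Real.rpow_sub hn', div_eq_mul_inv]; norm_num
  have hc : (1 + (n:ℝ)⁻¹)^(2*H) = ((n:ℝ)+1)^(2*H) * ((n:ℝ)^(2*H))⁻¹ := by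
    rw [← Real.inv_rpow hn'.le, ← Real.mul_rpow (by positivity) (by positivity)]
    congr 1; field_simp
  have hd : (1 - (n:ℝ)⁻¹)^(2*H) = |(n:ℝ)-1|^(2*H) * ((n:ℝ)^(2*H))⁻¹ := by
    rw [← Real.inv_rpow hn'.le, ← Real.mul_rpow (by positivity) (by positivity),
      abs_of_nonneg (by linarith)]
    congr 1; field_simp
  have hpos : 0 < (n:ℝ)^(2*H) := by positivity
  conv_rhs => rw [ha, ← mul_pow]
  rw [← ha]
  simp only [Function.comp]
  rw [hb, hc, hd]
  congr 1
  field_simp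

lemma log_diff : Tendsto (fun n : ℕ => (n:ℝ) * (Real.log (n+1) - Real.log n)) atTop (𝓝 1) := by
  have h := (Real.tendsto_mul_log_one_add_div_atTop 1).comp
    (tendsto_natCast_atTop_atTop (R := ℝ))
  refine h.congr' ?_
  filter_upwards [eventually_gt_atTop 0] with n hn
  have hn' : (0:ℝ) < n := by exact_mod_cast hn
  simp only [Function.comp]
  rw [← Real.log_div (by positivity) (by positivity)]
  congr 2
  field_simp

lemma sum_asymp (g : ℕ → ℝ) (c : ℝ) (hg : Tendsto (fun n : ℕ => (n:ℝ) * g n) atTop (𝓝 c))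
    (S : ℕ → ℝ) (hS : ∀ n, S (n+1) = S n + (g 0 + 2 * ∑ r ∈ Finset.range n, g (r+1))) :
    Tendsto (fun n : ℕ => S n / ((n:ℝ) * Real.log n)) atTop (𝓝 (2 * c)) := by
  have hlogt : Tendsto (fun n : ℕ => Real.log ((n:ℝ)+1)) atTop atTop :=
    Real.tendsto_log_atTop.comp (tendsto_atTop_add_const_right _ _ tendsto_natCast_atTop_atTop)
  have hT : Tendsto (fun n : ℕ => (g 0 + 2 * ∑ r ∈ Finset.range n, g (r+1)) / Real.log ((n:ℝ)+1))
      atTop (𝓝 (2*c)) := by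
    refine stolz _ (fun n : ℕ => Real.log ((n:ℝ)+1)) _ ?_ hlogt ?_
    · intro n
      exact Real.log_lt_log (by positivity) (by push_cast; linarith)
    · have h1 := (hg.comp (tendsto_add_atTop_nat 1)).const_mul 2
      have h2 := log_diff.comp (tendsto_add_atTop_nat 1)
      have h3 := h1.div h2 one_ne_zero
      rw [div_one] at h3
      refine h3.congr fun n => ?_
      simp only [Function.comp, Finset.sum_range_succ]
      have : (((n+1:ℕ):ℝ)) ≠ 0 := by positivity
      rw [show ∀ x y z : ℝ, (x + 2 * (y + z) - (x + 2 * y)) = 2 * z from fun x y z => by ring,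
        ]
      simp only [Pi.div_apply, Function.comp]
      rw [mul_left_comm, mul_div_mul_left _ _ this]
      push_cast
      rfl
  -- second: shift by one
  have key : Tendsto (fun n : ℕ => S (n+1) / (((n+1:ℕ):ℝ) * Real.log ((n+1:ℕ):ℝ))) atTop (𝓝 (2*c)) := by
    refine stolz (fun n => S (n+1)) (fun n : ℕ => ((n+1:ℕ):ℝ) * Real.log ((n+1:ℕ):ℝ)) _ ?_ ?_ ?_
    · intro n
      have h1 : 0 ≤ Real.log ((n+1:ℕ):ℝ) := Real.log_natCast_nonneg _
      have h2 : Real.log ((n+1:ℕ):ℝ) < Real.log ((n+1+1:ℕ):ℝ) :=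
        Real.log_lt_log (by positivity) (by push_cast; linarith)
      have h3 : (((n+1+1:ℕ):ℝ)) = ((n+1:ℕ):ℝ) + 1 := by push_cast; ring
      have h4 : (0:ℝ) < ((n+1:ℕ):ℝ) := by positivity
      show ((n+1:ℕ):ℝ) * Real.log ((n+1:ℕ):ℝ) < ((n+1+1:ℕ):ℝ) * Real.log ((n+1+1:ℕ):ℝ)
      rw [h3] at h2 ⊢
      nlinarith
    · refine Tendsto.atTop_mul_atTop₀ (tendsto_natCast_atTop_atTop.comp (tendsto_add_atTop_nat 1)) ?_
      simpa using hlogt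
    · -- denominators: log(n+2) + (n+1)(log(n+2) - log(n+1))
      have h2 := log_diff.comp (tendsto_add_atTop_nat 1)
      have hT1 := hT.comp (tendsto_add_atTop_nat 1)
      have h3 : Tendsto (fun n : ℕ => Real.log (((n+1:ℕ):ℝ)+1)) atTop atTop :=
        hlogt.comp (tendsto_add_atTop_nat 1)
      have h4 := (h2.div_atTop h3).const_add 1
      have h5 := hT1.div h4 (by norm_num)
      rw [add_zero, div_one] at h5
      refine h5.congr fun n => ?_
      simp only [Function.comp, Pi.div_apply]
      rw [hS (n+1)]
      have hl : 0 < Real.log (((n+1:ℕ):ℝ)+1) := Real.log_pos (by push_cast; linarith [(Nat.cast_nonneg n : (0:ℝ) ≤ n)])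
      have h6 : (((n+1+1:ℕ):ℝ)) = ((n+1:ℕ):ℝ) + 1 := by push_cast; ring
      rw [h6, div_div, add_sub_cancel_left]
      congr 1
      field_simp
      ring
  exact (tendsto_add_atTop_iff_nat (f := fun n : ℕ => S n / ((n:ℝ) * Real.log n)) 1).1 key

lemma double_sum (g : ℕ → ℝ) (n : ℕ) (f : ℕ → ℕ → ℝ) (hsymm : ∀ k l, f k l = f l k)
    (hf : ∀ k r, f (k + r) k = g r) :
    ∑ k ∈ Finset.range (n+1), ∑ l ∈ Finset.range (n+1), f k l =
    (∑ k ∈ Finset.range n, ∑ l ∈ Finset.range n, f k l) +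
      (g 0 + 2 * ∑ r ∈ Finset.range n, g (r+1)) := by
  have h1 : ∑ l ∈ Finset.range n, f n l = ∑ r ∈ Finset.range n, g (r+1) := by
    rw [← Finset.sum_range_reflect]
    refine Finset.sum_congr rfl fun r hr => ?_
    have := Finset.mem_range.1 hr
    rw [← hf (n - 1 - r) (r+1)]
    congr 1
    omega
  have h2 : ∑ k ∈ Finset.range n, f k n = ∑ r ∈ Finset.range n, g (r+1) := by
    rw [← h1]
    exact Finset.sum_congr rfl fun k _ => hsymm _ _
  have h3 : f n n = g 0 := hf n 0
  rw [Finset.sum_range_succ]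
  simp only [Finset.sum_range_succ (n := n)]
  rw [Finset.sum_add_distrib, h1, h2, h3]
  ring



/-- For `q ≥ 2`, `H = 1 − 1/(2q)` and a discrete fBm `(B_k)` with Hurst index `H`,
setting `V_n = Σ_{k=0}^{n−1} H_q(B_{k+1} − B_k)`, one has
`E[V_n²]/(n log n) → 2 q! (1 − 1/(2q))^q (1 − 1/q)^q`. -/
theorem stmt12
    {Ω : Type*} {mΩ : MeasurableSpace Ω} (μ : Measure Ω) [IsProbabilityMeasure μ]
    (q : ℕ) (hq : 2 ≤ q)
    (H : ℝ) (hH : H = 1 - 1 / (2 * (q : ℝ)))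
    (B : ℕ → Ω → ℝ) (hBmeas : ∀ k, Measurable (B k))
    -- every finite real-linear combination of the `B_k` is centered Gaussian
    (hGauss : ∀ (s : Finset ℕ) (a : ℕ → ℝ), ∃ v : NNReal,
      Measure.map (fun ω => ∑ i ∈ s, a i * B i ω) μ = gaussianReal 0 v)
    -- fBm covariance structure
    (hcov : ∀ k l : ℕ, ∫ ω, B k ω * B l ω ∂μ =
      (1 / 2 : ℝ) * ((k : ℝ) ^ (2 * H) + (l : ℝ) ^ (2 * H) - |(k : ℝ) - (l : ℝ)| ^ (2 * H)))
    -- Hermite power variation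
    (V : ℕ → Ω → ℝ)
    (hV : ∀ n ω, V n ω =
      ∑ k ∈ Finset.range n, (Polynomial.aeval (B (k + 1) ω - B k ω) (Polynomial.hermite q) : ℝ)) :
    Tendsto (fun n : ℕ => (∫ ω, (V n ω) ^ 2 ∂μ) / ((n : ℝ) * Real.log n)) atTop
      (𝓝 (2 * (q.factorial : ℝ) * (1 - 1 / (2 * (q : ℝ))) ^ q * (1 - 1 / (q : ℝ)) ^ q)) := by

  have hq0 : (q:ℝ) ≠ 0 := by positivity
  have hH0 : 0 < 2 * H := by
    have : 1 / (2 * (q:ℝ)) < 1 := by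
      have : (2:ℝ) ≤ q := by exact_mod_cast hq
      rw [div_lt_one (by linarith)]; linarith
    linarith
  have hBg : ∀ k, ∃ v : NNReal, Measure.map (B k) μ = gaussianReal 0 v := by
    intro k
    simpa using hGauss {k} (fun _ => 1)
  have hB2 : ∀ k, MemLp (B k) 2 μ := by
    intro k
    obtain ⟨v, hv⟩ := hBg k
    have : MemLp id 2 (Measure.map (B k) μ) := by
      rw [hv]; exact memLp_id_gaussianReal' 2 (by simp)
    simpa using this.comp_of_map (hBmeas k).aemeasurable
  have hBi : ∀ k l, Integrable (fun ω => B k ω * B l ω) μ := fun k l =>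
    (hB2 k).integrable_mul (hB2 l)
  set X : ℕ → Ω → ℝ := fun k ω => B (k+1) ω - B k ω with hXdef
  have hXm : ∀ k, Measurable (X k) := fun k => (hBmeas (k+1)).sub (hBmeas k)
  have hXcov : ∀ k l, ∫ ω, X k ω * X l ω ∂μ = (1/2:ℝ) *
      (|(k:ℝ) - l + 1|^(2*H) + |(k:ℝ)-l-1|^(2*H) - 2 * |(k:ℝ)-l|^(2*H)) := by
    intro k l
    have : ∀ ω, X k ω * X l ω = (B (k+1) ω * B (l+1) ω - B (k+1) ω * B l ω)
        - (B k ω * B (l+1) ω - B k ω * B l ω) := fun ω => by simp only [hXdef]; ring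
    simp only [this]
    have hs : ∀ i j m, Integrable (fun ω => B i ω * B j ω - B i ω * B m ω) μ :=
      fun i j m => (hBi i j).sub (hBi i m)
    rw [integral_sub (hs _ _ _) (hs _ _ _),
      integral_sub (hBi _ _) (hBi _ _), integral_sub (hBi _ _) (hBi _ _)]
    simp only [hcov]
    push_cast
    rw [show (k:ℝ) + 1 - (l + 1) = k - l by ring, show (k:ℝ) + 1 - l = k - l + 1 by ring,
      show (k:ℝ) - (l + 1) = k - l - 1 by ring]
    ring
  set ρ : ℕ → ℝ := fun n => (1/2:ℝ) * (((n:ℝ)+1)^(2*H) + |(n:ℝ)-1|^(2*H) - 2 * (n:ℝ)^(2*H)) with hρ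
  have hXρ : ∀ k r, ∫ ω, X (k + r) ω * X k ω ∂μ = ρ r := by
    intro k r
    rw [hXcov]
    push_cast
    rw [show (k:ℝ) + r - k = r by ring, abs_of_nonneg (by positivity : (0:ℝ) ≤ (r:ℝ) + 1),
      abs_of_nonneg (by positivity : (0:ℝ) ≤ (r:ℝ))]
  have hX1 : ∀ k, ∫ ω, X k ω * X k ω ∂μ = 1 := by
    intro k
    have := hXρ k 0
    rw [add_zero] at this
    rw [this, hρ]
    simp [Real.zero_rpow hH0.ne']
    norm_num
  have hXG : ∀ k l, ∀ a b : ℝ, ∃ v : NNReal,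
      Measure.map (fun ω => a * X k ω + b * X l ω) μ = gaussianReal 0 v := by
    intro k l a b
    obtain ⟨v, hv⟩ := hGauss (Finset.range (k + l + 2)) (fun i =>
      a * ((if i = k + 1 then 1 else 0) - (if i = k then 1 else 0))
      + b * ((if i = l + 1 then 1 else 0) - (if i = l then 1 else 0)))
    refine ⟨v, ?_⟩
    rw [← hv]
    congr 1
    ext ω
    simp only [add_mul, sub_mul, mul_assoc, ite_mul, one_mul, zero_mul, Finset.sum_add_distrib,
      ← Finset.mul_sum, Finset.sum_sub_distrib, Finset.sum_ite_eq', Finset.mem_range, hXdef]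
    rw [if_pos (by omega), if_pos (by omega), if_pos (by omega), if_pos (by omega)]
  have hherm := fun k l => hermite_cov μ q (X k) (X l) (hXm k) (hXm l) (hXG k l) (hX1 k) _ rfl
  have hVar : ∀ n, ∫ ω, (V n ω)^2 ∂μ = ∑ k ∈ Finset.range n, ∑ l ∈ Finset.range n,
      (q.factorial : ℝ) * (∫ ω, X k ω * X l ω ∂μ)^q := by
    intro n
    have : ∀ ω, (V n ω)^2 = ∑ k ∈ Finset.range n, ∑ l ∈ Finset.range n,
        (Polynomial.aeval (X k ω) (Polynomial.hermite q) : ℝ) *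
        (Polynomial.aeval (X l ω) (Polynomial.hermite q) : ℝ) := by
      intro ω
      rw [hV, pow_two, Finset.sum_mul_sum]
    simp only [this]
    rw [integral_finsetSum _ fun k _ => integrable_finsetSum _ fun l _ => (hherm k l).1]
    refine Finset.sum_congr rfl fun k _ => ?_
    rw [integral_finsetSum _ fun l _ => (hherm k l).1]
    exact Finset.sum_congr rfl fun l _ => (hherm k l).2
  have hg := (rho_asymp q hq H hH).const_mul (q.factorial : ℝ)
  have hmain := sum_asymp (fun n => (q.factorial : ℝ) * ρ n ^ q) _
    (hg.congr fun n => by simp only [hρ]; ring) (fun n => ∫ ω, (V n ω)^2 ∂μ) (by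
      intro n
      rw [hVar, hVar]
      refine double_sum (fun n => (q.factorial : ℝ) * ρ n ^ q) n _ ?_ ?_
      · intro k l
        simp only [mul_comm (X k _)]
      · intro k r
        simp only [hXρ])
  convert hmain using 2
  ring
end

section
/- Let q ≥ 2 be an integer, let H ∈ (0, 1 − 1/(2q)), and let (B_k)_{k∈ℕ} be a discrete fractional Brownian motion with Hurst index H. Set V_n = Σ_{k=0}^{n−1} H_q(B_{k+1} − B_k) and let σ_n > 0 be defined (for n large enough that E[V_n²] > 0) by σ_n² = E[V_n²]/n, so that G_n = V_n/(σ_n √n) has variance one. Then (G_n) satisfies the ASCLT: almost surely, for every bounded continuous φ : ℝ → ℝ, (1/log n) Σ_{k=1}^n (1/k) φ(G_k) → E[φ(N)] as n → ∞, where N is a standard Gaussian random variable. -/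
open MeasureTheory ProbabilityTheory Filter Topology

namespace ASCLT

set_option linter.unusedSectionVars false

/-- The probabilistic Hermite polynomial as a real function. -/
noncomputable def he (n : ℕ) (x : ℝ) : ℝ := Polynomial.aeval x (Polynomial.hermite n)

theorem derivative_hermite (n : ℕ) :
    Polynomial.derivative (Polynomial.hermite n) = (n : Polynomial ℤ) * Polynomial.hermite (n - 1) := by
  induction n with
  | zero => simp
  | succ n ih =>
    rw [Polynomial.hermite_succ, Polynomial.derivative_sub, Polynomial.derivative_mul, ih]
    rcases n with _ | n
    · simp
    · simp only [Nat.add_sub_cancel] at *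
      rw [Polynomial.derivative_mul]
      simp only [Polynomial.derivative_natCast]
      rw [Polynomial.hermite_succ n, Polynomial.derivative_X]
      push_cast
      ring

theorem he_zero (x : ℝ) : he 0 x = 1 := by simp [he]

theorem he_succ (n : ℕ) (x : ℝ) : he (n + 1) x = x * he n x - n * he (n - 1) x := by
  unfold he
  rw [Polynomial.hermite_succ, derivative_hermite]
  simp

theorem hasDerivAt_he (n : ℕ) (x : ℝ) : HasDerivAt (he n) (n * he (n - 1) x) x := by
  have h := (Polynomial.hermite n).hasDerivAt_aeval x
  rw [derivative_hermite] at h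
  simp only [map_mul, map_natCast] at h
  exact h

theorem continuous_he (n : ℕ) : Continuous (he n) :=
  continuous_iff_continuousAt.2 fun x => (hasDerivAt_he n x).continuousAt

@[fun_prop]
theorem measurable_he (n : ℕ) : Measurable (he n) := (continuous_he n).measurable

section stein
variable {E : Type*} [NormedAddCommGroup E] [NormedSpace ℝ E]

theorem stein (h h' : ℝ → E) (hd : ∀ x, HasDerivAt h (h' x) x)
    (i0 : Integrable h (gaussianReal 0 1)) (i1 : Integrable (fun x => x • h x) (gaussianReal 0 1))
    (i2 : Integrable h' (gaussianReal 0 1)) :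
    ∫ x, x • h x ∂(gaussianReal 0 1) = ∫ x, h' x ∂(gaussianReal 0 1) := by
  have key : ∀ f : ℝ → E, Integrable f (gaussianReal 0 1) ↔
      Integrable (fun x => gaussianPDFReal 0 1 x • f x) := by
    intro f
    rw [gaussianReal_of_var_ne_zero _ one_ne_zero]
    unfold gaussianPDF
    exact integrable_withDensity_iff_integrable_smul₀' (by fun_prop) (by simp) |>.trans
      (by simp [ENNReal.toReal_ofReal (gaussianPDFReal_nonneg _ _ _)])
  rw [key] at i0 i1 i2
  have hp : ∀ x, HasDerivAt (gaussianPDFReal 0 1) (-x * gaussianPDFReal 0 1 x) x := by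
    intro x
    unfold gaussianPDFReal
    have h1 : HasDerivAt (fun x : ℝ => -(x - 0) ^ 2 / (2 * ((1 : NNReal) : ℝ))) (-x) x := by
      have := (((hasDerivAt_id x).sub_const 0).pow 2).neg.div_const (2 * ((1 : NNReal) : ℝ))
      convert! this using 1
      simp; ring
    have := h1.exp.const_mul (√(2 * Real.pi * ((1 : NNReal) : ℝ)))⁻¹
    convert! this using 1
    ring
  have hz := integral_eq_zero_of_hasDerivAt_of_integrable
    (f := fun x => gaussianPDFReal 0 1 x • h x)
    (f' := fun x => gaussianPDFReal 0 1 x • h' x - gaussianPDFReal 0 1 x • (x • h x))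
    (fun x => by
      have := (hp x).smul (hd x)
      convert! this using 1
      rw [smul_smul, neg_mul, neg_smul, sub_eq_add_neg, mul_comm]) (i2.sub i1) i0
  rw [integral_sub i2 i1, sub_eq_zero] at hz
  rw [integral_gaussianReal_eq_integral_smul one_ne_zero,
    integral_gaussianReal_eq_integral_smul one_ne_zero, hz]

end stein

/-- Standing assumptions: a centered Gaussian sequence with unit variances, covariance `ρ`. -/
structure StdGP {Ω : Type*} {mΩ : MeasurableSpace Ω} (X : ℕ → Ω → ℝ) (ρ : ℕ → ℕ → ℝ)
    (μ : Measure Ω) : Prop where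
  meas : ∀ k, Measurable (X k)
  gauss : IsGaussianProcess X μ
  mean : ∀ k, ∫ ω, X k ω ∂μ = 0
  cov : ∀ i j, ∫ ω, X i ω * X j ω ∂μ = ρ i j
  diag : ∀ i, ρ i i = 1

section ibp
variable {Ω : Type*} {mΩ : MeasurableSpace Ω} {μ : Measure Ω} [IsProbabilityMeasure μ]
  {X : ℕ → Ω → ℝ} {ρ : ℕ → ℕ → ℝ}

theorem StdGP.memLp (hX : StdGP X ρ μ) (k : ℕ) (p : ENNReal) (hp : p ≠ ⊤) : MemLp (X k) p μ :=
  (hX.gauss.hasGaussianLaw_eval k).memLp hp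

theorem StdGP.law (hX : StdGP X ρ μ) (k : ℕ) : μ.map (X k) = gaussianReal 0 1 := by
  rw [(hX.gauss.hasGaussianLaw_eval k).map_eq_gaussianReal, hX.mean k]
  congr
  rw [variance_of_integral_eq_zero (hX.meas k).aemeasurable (hX.mean k)]
  have := hX.cov k k
  rw [hX.diag] at this
  simp only [pow_two]
  rw [this]; simp

theorem StdGP.indep (hX : StdGP X ρ μ) (k : ℕ) :
    IndepFun (X k) (fun ω j => X j ω - ρ k j * X k ω) μ := by
  have h1 : IndepFun (fun ω (_ : Unit) => X k ω) (fun ω j => X j ω - ρ k j * X k ω) μ := by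
    refine IsGaussianProcess.indepFun_of_covariance_eq_zero (X := fun _ : Unit => X k)
      (Y := fun j ω => X j ω - ρ k j * X k ω) ?_ (fun _ => (hX.meas k).aemeasurable)
      (fun j => ((hX.meas j).sub ((hX.meas k).const_mul _)).aemeasurable) ?_
    · refine hX.gauss.of_isGaussianProcess fun s => ?_
      rcases s with s | j
      · exact ⟨{k}, ContinuousLinearMap.proj ⟨k, by simp⟩, fun ω => by simp⟩
      · exact ⟨{k, j}, ContinuousLinearMap.proj ⟨j, by simp⟩ -
          (ρ k j) • ContinuousLinearMap.proj ⟨k, by simp⟩, fun ω => by simp⟩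
    · intro _ j
      have m := fun i => hX.memLp i 2 (by simp)
      have hc : ∀ i j, cov[X i, X j; μ] = ρ i j := by
        intro i j
        rw [covariance_eq_sub (m i) (m j), hX.mean, hX.mean]
        simp [hX.cov]
      rw [covariance_fun_sub_right (m k) (m j) ((m k).const_mul _), covariance_const_mul_right]
      rw [hc, hc, hX.diag]; ring
  exact h1.comp (φ := fun f : Unit → ℝ => f ()) (ψ := id) (measurable_pi_apply ()) measurable_id

variable {E : Type*} [NormedAddCommGroup E] [NormedSpace ℝ E] [MeasurableSpace E] [BorelSpace E]
  [SecondCountableTopology E]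

/-- Gaussian integration by parts. -/
theorem StdGP.ibp (hX : StdGP X ρ μ) (k : ℕ) (Φ Φ' : (ℕ → ℝ) → E) (mΦ : Measurable Φ)
    (mΦ' : Measurable Φ')
    (hd : ∀ (y : ℕ → ℝ) (s : ℝ), HasDerivAt (fun s : ℝ => Φ (fun j => y j + ρ k j * s))
      (Φ' (fun j => y j + ρ k j * s)) s)
    (i0 : Integrable (fun ω => Φ (fun j => X j ω)) μ)
    (i1 : Integrable (fun ω => X k ω • Φ (fun j => X j ω)) μ)
    (i2 : Integrable (fun ω => Φ' (fun j => X j ω)) μ) :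
    ∫ ω, X k ω • Φ (fun j => X j ω) ∂μ = ∫ ω, Φ' (fun j => X j ω) ∂μ := by
  set Y : Ω → (ℕ → ℝ) := fun ω j => X j ω - ρ k j * X k ω with hY
  have mX := hX.meas
  have mY : Measurable Y := by
    refine measurable_pi_iff.2 fun j => ?_
    exact (mX j).sub ((mX k).const_mul _)
  have hlaw : μ.map (fun ω => (Y ω, X k ω)) = (μ.map Y).prod (gaussianReal 0 1) := by
    rw [← hX.law k]
    exact (indepFun_iff_map_prod_eq_prod_map_map mY.aemeasurable (mX k).aemeasurable).1
      (hX.indep k).symm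
  have : IsProbabilityMeasure (μ.map Y) := Measure.isProbabilityMeasure_map mY.aemeasurable
  have mYX : Measurable (fun ω => (Y ω, X k ω)) := mY.prodMk (mX k)
  have e : ∀ ω, (fun j => X j ω) = (fun j => Y ω j + ρ k j * X k ω) := by
    intro ω; ext j; simp [hY]
  have ms : Measurable (fun p : (ℕ → ℝ) × ℝ => fun j => p.1 j + ρ k j * p.2) := by fun_prop
  -- transfer
  have T : ∀ f : (ℕ → ℝ) × ℝ → E, Measurable f →
      (Integrable (fun ω => f (Y ω, X k ω)) μ ↔
        Integrable f ((μ.map Y).prod (gaussianReal 0 1))) := by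
    intro f hf
    rw [← hlaw, integrable_map_measure hf.aestronglyMeasurable mYX.aemeasurable]; rfl
  have T2 : ∀ f : (ℕ → ℝ) × ℝ → E, Measurable f →
      ∫ ω, f (Y ω, X k ω) ∂μ = ∫ p, f p ∂((μ.map Y).prod (gaussianReal 0 1)) := by
    intro f hf
    rw [← hlaw, integral_map mYX.aemeasurable hf.aestronglyMeasurable]
  simp only [e] at i0 i1 i2 ⊢
  have m0 := mΦ.comp ms
  have m1 : Measurable (fun p : (ℕ → ℝ) × ℝ => p.2 • Φ (fun j => p.1 j + ρ k j * p.2)) :=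
    measurable_snd.smul m0
  have m2 := mΦ'.comp ms
  have j0 := (T _ m0).1 i0
  have j1 := (T _ m1).1 i1
  have j2 := (T _ m2).1 i2
  refine (T2 _ m1).trans (Eq.trans ?_ (T2 _ m2).symm)
  rw [integral_prod _ j1, integral_prod _ j2]
  refine integral_congr_ae ?_
  filter_upwards [j0.prod_right_ae, j1.prod_right_ae, j2.prod_right_ae] with y h0 h1 h2
  exact stein _ _ (hd y) h0 h1 h2

end ibp
end ASCLT

namespace ASCLT
set_option linter.unusedSectionVars false

section allLp
variable {Ω : Type*} {mΩ : MeasurableSpace Ω} {μ : Measure Ω} [IsProbabilityMeasure μ]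
variable {E : Type*} [NormedAddCommGroup E] [NormedSpace ℝ E]

/-- All moments finite. -/
def AllLp (f : Ω → E) (μ : Measure Ω) : Prop := ∀ p : ℕ, MemLp f (p : ENNReal) μ

theorem AllLp.integrable {f : Ω → E} (hf : AllLp f μ) : Integrable f μ := by
  have := hf 1
  rwa [Nat.cast_one, memLp_one_iff_integrable] at this

theorem AllLp.memLp_two {f : Ω → E} (hf : AllLp f μ) : MemLp f 2 μ := by
  simpa using hf 2

theorem AllLp.smul {f : Ω → ℝ} {g : Ω → E} (hf : AllLp f μ) (hg : AllLp g μ) :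
    AllLp (fun ω => f ω • g ω) μ := by
  intro p
  have h1 := hf (2 * p)
  have h2 := hg (2 * p)
  have : ENNReal.HolderTriple ((2 * p : ℕ) : ENNReal) ((2 * p : ℕ) : ENNReal) (p : ENNReal) := by
    constructor
    push_cast
    rw [ENNReal.mul_inv (by simp) (by simp), ← add_mul, ENNReal.inv_two_add_inv_two, one_mul]
  exact MemLp.smul h2 h1

theorem AllLp.mul {f g : Ω → ℝ} (hf : AllLp f μ) (hg : AllLp g μ) :
    AllLp (fun ω => f ω * g ω) μ := hf.smul hg

theorem AllLp.add {f g : Ω → E} (hf : AllLp f μ) (hg : AllLp g μ) :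
    AllLp (fun ω => f ω + g ω) μ := fun p => (hf p).add (hg p)

theorem AllLp.sub {f g : Ω → E} (hf : AllLp f μ) (hg : AllLp g μ) :
    AllLp (fun ω => f ω - g ω) μ := fun p => (hf p).sub (hg p)

theorem AllLp.const (c : E) : AllLp (fun _ => c) μ := fun _ => memLp_const c

theorem AllLp.const_mul {f : Ω → ℝ} (hf : AllLp f μ) (c : ℝ) : AllLp (fun ω => c * f ω) μ :=
  (AllLp.const c).mul hf

theorem AllLp.sum {ι : Type*} (s : Finset ι) {f : ι → Ω → E} (hf : ∀ i ∈ s, AllLp (f i) μ) :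
    AllLp (fun ω => ∑ i ∈ s, f i ω) μ := fun p => memLp_finsetSum s fun i hi => hf i hi p

theorem AllLp.ofBound {f : Ω → E} (hm : AEStronglyMeasurable f μ) (C : ℝ) (h : ∀ ω, ‖f ω‖ ≤ C) :
    AllLp f μ := fun _ => MemLp.of_bound hm C (ae_of_all _ h)

theorem AllLp.he {f : Ω → ℝ} (hf : AllLp f μ) (n : ℕ) : AllLp (fun ω => he n (f ω)) μ := by
  induction n using Nat.strong_induction_on with
  | _ n ih =>
    rcases n with _ | n
    · simp only [he_zero]; exact AllLp.const _
    · simp only [he_succ]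
      refine (hf.mul (ih n (by omega))).sub (AllLp.const_mul (ih (n - 1) (by omega)) _)

end allLp

section ibp
variable {Ω : Type*} {mΩ : MeasurableSpace Ω} {μ : Measure Ω} [IsProbabilityMeasure μ]
  {X : ℕ → Ω → ℝ} {ρ : ℕ → ℕ → ℝ}

theorem StdGP.allLp (hX : StdGP X ρ μ) (k : ℕ) : AllLp (X k) μ :=
  fun p => hX.memLp k p (by simp)

variable {E : Type*} [NormedAddCommGroup E] [NormedSpace ℝ E] [MeasurableSpace E] [BorelSpace E]
  [SecondCountableTopology E]

theorem StdGP.hermite_ibp (hX : StdGP X ρ μ) (k p : ℕ) (g g' : (ℕ → ℝ) → E) (mg : Measurable g)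
    (mg' : Measurable g')
    (hd : ∀ (y : ℕ → ℝ) (s : ℝ), HasDerivAt (fun s : ℝ => g (fun j => y j + ρ k j * s))
      (g' (fun j => y j + ρ k j * s)) s)
    (i0 : AllLp (fun ω => g (fun j => X j ω)) μ)
    (i2 : AllLp (fun ω => g' (fun j => X j ω)) μ) :
    ∫ ω, he (p + 1) (X k ω) • g (fun j => X j ω) ∂μ
      = ∫ ω, he p (X k ω) • g' (fun j => X j ω) ∂μ := by
  have hh := fun n => (hX.allLp k).he n
  have a1 : AllLp (fun ω => (p * he (p - 1) (X k ω)) • g (fun j => X j ω)) μ :=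
    ((hh (p-1)).const_mul p).smul i0
  have a2 := (hh p).smul i2
  have a3 := (hX.allLp k).smul ((hh p).smul i0)
  have key := hX.ibp k (fun x => he p (x k) • g x)
    (fun x => (p * he (p - 1) (x k)) • g x + he p (x k) • g' x)
    (by fun_prop) (by fun_prop)
    (fun y s => by
      have h1 : HasDerivAt (fun s : ℝ => y k + ρ k k * s) 1 s := by
        rw [hX.diag]; simpa using (hasDerivAt_id s).const_add (y k)
      have h2 : HasDerivAt (fun s : ℝ => he p (y k + ρ k k * s)) (p * he (p-1) (y k + ρ k k * s)) s := by
        have := (hasDerivAt_he p (y k + ρ k k * s)).comp s h1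
        rw [mul_one] at this
        exact this
      have := h2.smul (hd y s)
      rw [add_comm] at this
      exact this)
    ((hh p).smul i0).integrable a3.integrable (a1.add a2).integrable
  rw [integral_add a1.integrable a2.integrable] at key
  simp only [he_succ, sub_smul]
  simp only [← smul_smul (X k _) (he p (X k _))]
  rw [integral_sub a3.integrable a1.integrable, key]
  abel

/-- Joint Hermite moments. -/
noncomputable def mom (X : ℕ → Ω → ℝ) (μ : Measure Ω) (i j k l a b c d : ℕ) : ℝ :=
  ∫ ω, he a (X i ω) * (he b (X j ω) * (he c (X k ω) * he d (X l ω))) ∂μ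

theorem StdGP.mom_succ (hX : StdGP X ρ μ) (i j k l a b c d : ℕ) :
    mom X μ i j k l (a + 1) b c d = ρ i j * b * mom X μ i j k l a (b - 1) c d
      + ρ i k * c * mom X μ i j k l a b (c - 1) d + ρ i l * d * mom X μ i j k l a b c (d - 1) := by
  have hh := fun k n => (hX.allLp k).he n
  have key := hX.hermite_ibp i a (fun x => he b (x j) * (he c (x k) * he d (x l)))
    (fun x => ρ i j * b * (he (b - 1) (x j) * (he c (x k) * he d (x l)))
      + ρ i k * c * (he b (x j) * (he (c - 1) (x k) * he d (x l)))
      + ρ i l * d * (he b (x j) * (he c (x k) * he (d - 1) (x l))))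
    (by fun_prop) (by fun_prop)
    (fun y s => by
      have h1 : ∀ m, HasDerivAt (fun s : ℝ => y m + ρ i m * s) (ρ i m) s := by
        intro m; simpa using ((hasDerivAt_id s).const_mul (ρ i m)).const_add (y m)
      have h2 : ∀ m n, HasDerivAt (fun s : ℝ => he n (y m + ρ i m * s))
          (n * he (n-1) (y m + ρ i m * s) * ρ i m) s := by
        intro m n
        exact (hasDerivAt_he n (y m + ρ i m * s)).comp s (h1 m)
      have := (h2 j b).mul ((h2 k c).mul (h2 l d))
      refine this.congr_deriv ?_
      simp only [Pi.mul_apply]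
      ring)
    ((hh _ _).mul ((hh _ _).mul (hh _ _)))
    (((((hh _ _).mul ((hh _ _).mul (hh _ _))).const_mul _).add
      (((hh _ _).mul ((hh _ _).mul (hh _ _))).const_mul _)).add
      (((hh _ _).mul ((hh _ _).mul (hh _ _))).const_mul _))
  unfold mom
  simp only [smul_eq_mul] at key
  rw [key]
  have q := fun a b c d : ℕ =>
    ((hh i a).mul ((hh j b).mul ((hh k c).mul (hh l d)))).integrable
  rw [← integral_const_mul, ← integral_const_mul, ← integral_const_mul, ← integral_add,
    ← integral_add]
  · congr 1; ext ω; ring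
  · exact ((q _ _ _ _).const_mul _).add ((q _ _ _ _).const_mul _)
  · exact (q _ _ _ _).const_mul _
  · exact (q _ _ _ _).const_mul _
  · exact (q _ _ _ _).const_mul _

/-- The recursion satisfied by joint Hermite moments. -/
structure Rec (m : ℕ → ℕ → ℕ → ℕ → ℝ) (r12 r34 r13 r24 r14 r23 : ℝ) : Prop where
  ra : ∀ a b c d, m (a+1) b c d = r12 * b * m a (b-1) c d + r13 * c * m a b (c-1) d
    + r14 * d * m a b c (d-1)
  rb : ∀ b c d, m 0 (b+1) c d = r23 * c * m 0 b (c-1) d + r24 * d * m 0 b c (d-1)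
  rc : ∀ c d, m 0 0 (c+1) d = r34 * d * m 0 0 c (d-1)
  r0 : ∀ d, m 0 0 0 (d+1) = 0
  r00 : m 0 0 0 0 = 1

theorem StdGP.momRec (hX : StdGP X ρ μ) (i j k l : ℕ) :
    Rec (mom X μ i j k l) (ρ i j) (ρ k l) (ρ i k) (ρ j l) (ρ i l) (ρ j k) where
  ra := hX.mom_succ i j k l
  rb b c d := by
    have e : ∀ b c d, mom X μ i j k l 0 b c d = mom X μ j i k l b 0 c d := by
      intro b c d; unfold mom; congr 1; ext ω; ring
    rw [e, e, e, hX.mom_succ]; simp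
  rc c d := by
    have e : ∀ c d, mom X μ i j k l 0 0 c d = mom X μ k i j l c 0 0 d := by
      intro c d; unfold mom; congr 1; ext ω; ring
    rw [e, e, hX.mom_succ]; simp
  r0 d := by
    have e : ∀ d, mom X μ i j k l 0 0 0 d = mom X μ l i j k d 0 0 0 := by
      intro d; unfold mom; congr 1; ext ω; ring
    rw [e, hX.mom_succ]; simp
  r00 := by simp [mom, he_zero]

end ibp
end ASCLT

namespace ASCLT
set_option linter.unusedVariables false

/-- Diagram constraints. -/
def Cons (a b c d e1 e2 e3 e4 e5 e6 : ℕ) : Prop :=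
  e1 + e3 + e5 = a ∧ e1 + e6 + e4 = b ∧ e2 + e3 + e6 = c ∧ e2 + e5 + e4 = d

/-- Diagram monomial. -/
noncomputable def mono (x y u v w z : ℝ) (e1 e2 e3 e4 e5 e6 : ℕ) : ℝ :=
  |x| ^ e1 * |y| ^ e2 * |u| ^ e3 * |v| ^ e4 * |w| ^ e5 * |z| ^ e6

/-- All diagram monomials with at least `n0` cross edges are at most `K` (with prefactor `c0`). -/
def Dom (n0 : ℕ) (x y u v w z c0 K : ℝ) (a b c d : ℕ) : Prop :=
  ∀ e1 e2 e3 e4 e5 e6, Cons a b c d e1 e2 e3 e4 e5 e6 → n0 ≤ e3 + e4 + e5 + e6 →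
    c0 * mono x y u v w z e1 e2 e3 e4 e5 e6 ≤ K

section
variable {x y u v w z c0 K : ℝ} {a b c d n0 : ℕ}

theorem Dom.s1 (h : Dom n0 x y u v w z c0 K (a+1) (b+1) c d) :
    Dom n0 x y u v w z (c0 * |x|) K a b c d := by
  intro e1 e2 e3 e4 e5 e6 he hn
  refine le_of_eq_of_le ?_ (h (e1+1) e2 e3 e4 e5 e6 (by unfold Cons at *; omega) (by omega))
  unfold mono; ring

theorem Dom.s2 (h : Dom n0 x y u v w z c0 K a b (c+1) (d+1)) :
    Dom n0 x y u v w z (c0 * |y|) K a b c d := by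
  intro e1 e2 e3 e4 e5 e6 he hn
  refine le_of_eq_of_le ?_ (h e1 (e2+1) e3 e4 e5 e6 (by unfold Cons at *; omega) (by omega))
  unfold mono; ring

theorem Dom.s3 (h : Dom (n0) x y u v w z c0 K (a+1) b (c+1) d) :
    Dom (n0 - 1) x y u v w z (c0 * |u|) K a b c d := by
  intro e1 e2 e3 e4 e5 e6 he hn
  refine le_of_eq_of_le ?_ (h e1 e2 (e3+1) e4 e5 e6 (by unfold Cons at *; omega) (by omega))
  unfold mono; ring

theorem Dom.s4 (h : Dom (n0) x y u v w z c0 K a (b+1) c (d+1)) :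
    Dom (n0 - 1) x y u v w z (c0 * |v|) K a b c d := by
  intro e1 e2 e3 e4 e5 e6 he hn
  refine le_of_eq_of_le ?_ (h e1 e2 e3 (e4+1) e5 e6 (by unfold Cons at *; omega) (by omega))
  unfold mono; ring

theorem Dom.s5 (h : Dom (n0) x y u v w z c0 K (a+1) b c (d+1)) :
    Dom (n0 - 1) x y u v w z (c0 * |w|) K a b c d := by
  intro e1 e2 e3 e4 e5 e6 he hn
  refine le_of_eq_of_le ?_ (h e1 e2 e3 e4 (e5+1) e6 (by unfold Cons at *; omega) (by omega))
  unfold mono; ring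

theorem Dom.s6 (h : Dom (n0) x y u v w z c0 K a (b+1) (c+1) d) :
    Dom (n0 - 1) x y u v w z (c0 * |z|) K a b c d := by
  intro e1 e2 e3 e4 e5 e6 he hn
  refine le_of_eq_of_le ?_ (h e1 e2 e3 e4 e5 (e6+1) (by unfold Cons at *; omega) (by omega))
  unfold mono; ring

end

/-- Boundedness predicate (`n0 = 0`: the moment; `n0 = 1`: the moment minus its disconnected part) -/
def corr (n0 : ℕ) (x y : ℝ) (a b c d : ℕ) : ℝ :=
  if n0 = 0 then 0 else if a = b ∧ c = d then (a.factorial * x ^ a) * (c.factorial * y ^ c) else 0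

/-- Uniform moment bound. -/
def MB (n0 a b c d : ℕ) : Prop := ∃ C : ℝ, 0 ≤ C ∧ ∀ m x y u v w z, Rec m x y u v w z →
  ∀ c0 K, 0 ≤ c0 → 0 ≤ K → Dom n0 x y u v w z c0 K a b c d →
    c0 * |m a b c d - corr n0 x y a b c d| ≤ C * K

theorem corr_zero (x y : ℝ) (a b c d : ℕ) : corr 0 x y a b c d = 0 := by simp [corr]

theorem corr_a (n0 : ℕ) (x y : ℝ) (a b c d : ℕ) :
    corr n0 x y (a+1) b c d = x * b * corr n0 x y a (b-1) c d := by
  unfold corr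
  rcases b with _ | b
  · simp
  · simp only [Nat.add_sub_cancel, Nat.add_right_cancel_iff]
    split_ifs with h1 h2
    · simp
    · rw [h2.1, Nat.factorial_succ]; push_cast; ring
    · simp

theorem corr_b (n0 : ℕ) (x y : ℝ) (b c d : ℕ) : corr n0 x y 0 (b+1) c d = 0 := by simp [corr]

theorem corr_c (n0 : ℕ) (x y : ℝ) (c d : ℕ) :
    corr n0 x y 0 0 (c+1) d = y * d * corr n0 x y 0 0 c (d-1) := by
  unfold corr
  rcases d with _ | d
  · simp
  · simp only [Nat.add_sub_cancel, Nat.add_right_cancel_iff]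
    split_ifs with h1 h2
    · simp
    · rw [Nat.factorial_succ, h2.2]; push_cast; ring
    · simp

/-- combine a single step -/
theorem step_bd {c0 r M C K : ℝ} (n : ℕ) (hc0 : 0 ≤ c0)
    (h : n = 0 ∨ (c0 * |r|) * |M| ≤ C * K) (hC : 0 ≤ C) (hK : 0 ≤ K) :
    c0 * |r * n * M| ≤ n * C * K := by
  rcases h with h | h
  · subst h; simp
  · rw [abs_mul, abs_mul, Nat.abs_cast]
    calc c0 * (|r| * n * |M|) = n * ((c0 * |r|) * |M|) := by ring
      _ ≤ n * (C * K) := by gcongr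
      _ = _ := by ring

theorem mb (a : ℕ) : ∀ n0, n0 ≤ 1 → ∀ b c d, MB n0 a b c d := by
  induction a with
  | zero =>
    intro n0 hn0 b
    induction b generalizing n0 with
    | zero =>
      intro c
      induction c with
      | zero =>
        intro d
        rcases d with _ | d
        · refine ⟨1, zero_le_one, fun m x y u v w z hm c0 K hc0 hK hD => ?_⟩
          rw [hm.r00]
          rcases Nat.eq_zero_or_pos n0 with h | h
          · subst h
            have := hD 0 0 0 0 0 0 (by simp [Cons]) (by simp)
            simpa [mono, corr] using this
          · simp [corr, h.ne', hK]
        · refine ⟨0, le_rfl, fun m x y u v w z hm c0 K hc0 hK hD => ?_⟩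
          rw [hm.r0]; simp [corr]
      | succ c ih =>
        intro d
        obtain ⟨C, hC, h⟩ := ih (d - 1)
        refine ⟨d * C, by positivity, fun m x y u v w z hm c0 K hc0 hK hD => ?_⟩
        rw [hm.rc, corr_c, ← mul_sub]
        refine step_bd d hc0 ?_ hC hK
        rcases d with _ | d
        · simp
        · exact Or.inr (h m x y u v w z hm _ K (by positivity) hK hD.s2)
    | succ b ih =>
      intro c d
      obtain ⟨C1, hC1, h1⟩ := ih (n0-1) (by omega) (c - 1) d
      obtain ⟨C2, hC2, h2⟩ := ih (n0-1) (by omega) c (d - 1)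
      refine ⟨c * C1 + d * C2, by positivity, fun m x y u v w z hm c0 K hc0 hK hD => ?_⟩
      rw [hm.rb, corr_b, sub_zero]
      have e : n0 - 1 = 0 := by omega
      rw [e] at h1 h2
      simp only [corr_zero, sub_zero] at h1 h2
      have b1 : c0 * |z * c * m 0 b (c-1) d| ≤ c * C1 * K := by
        refine step_bd c hc0 ?_ hC1 hK
        rcases c with _ | c
        · simp
        · exact Or.inr (h1 m x y u v w z hm _ K (by positivity) hK (e ▸ hD.s6))
      have b2 : c0 * |v * d * m 0 b c (d-1)| ≤ d * C2 * K := by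
        refine step_bd d hc0 ?_ hC2 hK
        rcases d with _ | d
        · simp
        · exact Or.inr (h2 m x y u v w z hm _ K (by positivity) hK (e ▸ hD.s4))
      calc _ ≤ c0 * (|z * c * m 0 b (c-1) d| + |v * d * m 0 b c (d-1)|) := by
            gcongr; exact abs_add_le _ _
        _ ≤ _ := by linarith
  | succ a ih =>
    intro n0 hn0 b c d
    obtain ⟨C0, hC0, h0⟩ := ih n0 hn0 (b - 1) c d
    obtain ⟨C1, hC1, h1⟩ := ih (n0-1) (by omega) b (c - 1) d
    obtain ⟨C2, hC2, h2⟩ := ih (n0-1) (by omega) b c (d - 1)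
    refine ⟨b * C0 + c * C1 + d * C2, by positivity, fun m x y u v w z hm c0 K hc0 hK hD => ?_⟩
    have e : n0 - 1 = 0 := by omega
    rw [e] at h1 h2
    simp only [corr_zero, sub_zero] at h1 h2
    have b0 : c0 * |x * b * (m a (b-1) c d - corr n0 x y a (b-1) c d)| ≤ b * C0 * K := by
      refine step_bd b hc0 ?_ hC0 hK
      rcases b with _ | b
      · simp
      · exact Or.inr (h0 m x y u v w z hm _ K (by positivity) hK hD.s1)
    have b1 : c0 * |u * c * m a b (c-1) d| ≤ c * C1 * K := by
      refine step_bd c hc0 ?_ hC1 hK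
      rcases c with _ | c
      · simp
      · exact Or.inr (h1 m x y u v w z hm _ K (by positivity) hK (e ▸ hD.s3))
    have b2 : c0 * |w * d * m a b c (d-1)| ≤ d * C2 * K := by
      refine step_bd d hc0 ?_ hC2 hK
      rcases d with _ | d
      · simp
      · exact Or.inr (h2 m x y u v w z hm _ K (by positivity) hK (e ▸ hD.s5))
    have e2 : m (a+1) b c d - corr n0 x y (a+1) b c d =
        x * b * (m a (b-1) c d - corr n0 x y a (b-1) c d) + u * c * m a b (c-1) d
          + w * d * m a b c (d-1) := by
      rw [hm.ra, corr_a]; ring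
    rw [e2]
    calc _ ≤ c0 * (|x * b * (m a (b-1) c d - corr n0 x y a (b-1) c d)| + |u * c * m a b (c-1) d|
          + |w * d * m a b c (d-1)|) := by
            gcongr; exact abs_add_three _ _ _
      _ ≤ _ := by linarith

/-- The cycle weights. -/
noncomputable def cyc (p : ℕ) (x y u v w z : ℝ) : ℝ :=
  ∑ s ∈ Finset.Icc 1 p, (|x| ^ s * |y| ^ s * (|u| ^ (p+1-s) * |v| ^ (p+1-s))
    + |x| ^ s * |y| ^ s * (|w| ^ (p+1-s) * |z| ^ (p+1-s)))

theorem young (s t : ℕ) (A B : ℝ) (hA : 0 ≤ A) (hB : 0 ≤ B) :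
    A ^ s * B ^ t ≤ A ^ (s+t) + B ^ (s+t) := by
  rcases le_total A B with h | h
  · have : A ^ s * B ^ t ≤ B ^ s * B ^ t := by gcongr
    rw [← pow_add] at this
    have : 0 ≤ A ^ (s+t) := by positivity
    linarith
  · have : A ^ s * B ^ t ≤ A ^ s * A ^ t := by gcongr
    rw [← pow_add] at this
    have : 0 ≤ B ^ (s+t) := by positivity
    linarith

theorem dom_cyc (p : ℕ) (x y u v w z : ℝ) :
    Dom 1 x y u v w z (|x| * |y|) (cyc p x y u v w z) p p p p := by
  intro e1 e2 e3 e4 e5 e6 hc hn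
  obtain ⟨k1, k2, k3, k4⟩ := hc
  have q2 : e2 = e1 := by omega
  have q4 : e4 = e3 := by omega
  have q6 : e6 = e5 := by omega
  subst q2 q4 q6
  have hs : e2 + 1 ∈ Finset.Icc 1 p := by simp; omega
  refine le_trans ?_ (Finset.single_le_sum (f := fun s => (|x| ^ s * |y| ^ s * (|u| ^ (p+1-s) * |v| ^ (p+1-s))
    + |x| ^ s * |y| ^ s * (|w| ^ (p+1-s) * |z| ^ (p+1-s)))) (fun i _ => by positivity) hs)
  have hp : p + 1 - (e2 + 1) = e4 + e6 := by omega
  simp only [hp]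
  have Y := young e4 e6 (|u| * |v|) (|w| * |z|) (by positivity) (by positivity)
  calc |x| * |y| * mono x y u v w z e2 e2 e4 e4 e6 e6
      = |x| ^ (e2+1) * |y| ^ (e2+1) * ((|u| * |v|) ^ e4 * (|w| * |z|) ^ e6) := by
        unfold mono; ring
    _ ≤ |x| ^ (e2+1) * |y| ^ (e2+1) * ((|u| * |v|) ^ (e4+e6) + (|w| * |z|) ^ (e4+e6)) := by gcongr
    _ = _ := by rw [mul_pow, mul_pow]; ring

section
variable {Ω : Type*} {mΩ : MeasurableSpace Ω} {μ : Measure Ω} [IsProbabilityMeasure μ]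
  {X : ℕ → Ω → ℝ} {ρ : ℕ → ℕ → ℝ}

theorem StdGP.mom_two (hX : StdGP X ρ μ) (i j p : ℕ) :
    ∫ ω, he p (X i ω) * he p (X j ω) ∂μ = p.factorial * ρ i j ^ p := by
  have : ∀ p, mom X μ i j i i p p 0 0 = p.factorial * ρ i j ^ p := by
    intro p
    induction p with
    | zero => simp [mom, he_zero]
    | succ p ih =>
      rw [hX.mom_succ, Nat.add_sub_cancel, ih, Nat.factorial_succ]; push_cast; ring
  rw [← this p]; simp [mom, he_zero]

theorem cov_bound (p : ℕ) : ∃ C : ℝ, 0 ≤ C ∧ ∀ {Ω : Type*} {mΩ : MeasurableSpace Ω}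
    {μ : Measure Ω} [IsProbabilityMeasure μ] {X : ℕ → Ω → ℝ} {ρ : ℕ → ℕ → ℝ}
    (_ : StdGP X ρ μ) (i j k l : ℕ),
    |ρ i j| * |ρ k l| * |∫ ω, (he p (X i ω) * he p (X j ω) - p.factorial * ρ i j ^ p) *
      (he p (X k ω) * he p (X l ω) - p.factorial * ρ k l ^ p) ∂μ| ≤
      C * cyc p (ρ i j) (ρ k l) (ρ i k) (ρ j l) (ρ i l) (ρ j k) := by
  obtain ⟨C, hC, h⟩ := mb p 1 le_rfl p p p
  refine ⟨C, hC, fun {Ω mΩ μ _ X ρ} hX i j k l => ?_⟩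
  have := h _ _ _ _ _ _ _ (hX.momRec i j k l) _ _ (by positivity)
    (by unfold cyc; exact Finset.sum_nonneg fun _ _ => by positivity) (dom_cyc p _ _ _ _ _ _)
  convert! this using 3
  have hh := fun k => (hX.allLp k).he p
  have i1 := ((hh i).mul (hh j)).mul ((hh k).mul (hh l))
  have i2 := ((hh i).mul (hh j)).const_mul (p.factorial * ρ k l ^ p)
  have i3 := ((hh k).mul (hh l)).const_mul (p.factorial * ρ i j ^ p)
  have e : ∀ ω, (he p (X i ω) * he p (X j ω) - p.factorial * ρ i j ^ p) *
      (he p (X k ω) * he p (X l ω) - p.factorial * ρ k l ^ p) =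
      (he p (X i ω) * he p (X j ω)) * (he p (X k ω) * he p (X l ω))
      - (p.factorial * ρ k l ^ p) * (he p (X i ω) * he p (X j ω))
      - (p.factorial * ρ i j ^ p) * (he p (X k ω) * he p (X l ω))
      + (p.factorial * ρ i j ^ p) * (p.factorial * ρ k l ^ p) := by intro ω; ring
  simp only [e]
  rw [integral_add ((i1.sub i2).sub i3).integrable (integrable_const _),
    integral_sub (i1.sub i2).integrable i3.integrable,
    integral_sub i1.integrable i2.integrable, integral_const_mul, integral_const_mul, hX.mom_two, hX.mom_two]
  simp only [mom, corr, mul_assoc]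
  simp
  left; ring
end
end ASCLT

namespace ASCLT
section
variable {Ω : Type*} {mΩ : MeasurableSpace Ω} {μ : Measure Ω} [IsProbabilityMeasure μ]
  {X : ℕ → Ω → ℝ} {ρ : ℕ → ℕ → ℝ}

/-- Weighted Hermite sum. -/
noncomputable def FF (p n : ℕ) (a : ℕ → ℝ) (x : ℕ → ℝ) : ℝ :=
  ∑ j ∈ Finset.range n, a j * he (p + 1) (x j)

@[fun_prop]
theorem measurable_FF (p n : ℕ) (a : ℕ → ℝ) : Measurable (FF p n a) := by
  unfold FF; fun_prop

/-- directional derivative of `FF` -/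
noncomputable def FD (ρ : ℕ → ℕ → ℝ) (p n : ℕ) (a : ℕ → ℝ) (k : ℕ) (x : ℕ → ℝ) : ℝ :=
  ∑ j ∈ Finset.range n, a j * ((p + 1) * he p (x j) * ρ k j)

@[fun_prop]
theorem measurable_FD (p n k : ℕ) (a : ℕ → ℝ) : Measurable (FD ρ p n a k) := by
  unfold FD; fun_prop

theorem hasDerivAt_FF (p n k : ℕ) (a : ℕ → ℝ) (y : ℕ → ℝ) (s : ℝ) :
    HasDerivAt (fun s : ℝ => FF p n a (fun j => y j + ρ k j * s))
      (FD ρ p n a k (fun j => y j + ρ k j * s)) s := by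
  unfold FF FD
  refine HasDerivAt.fun_sum fun j _ => HasDerivAt.const_mul _ ?_
  have h1 : HasDerivAt (fun s : ℝ => y j + ρ k j * s) (ρ k j) s := by
    simpa using ((hasDerivAt_id s).const_mul (ρ k j)).const_add (y j)
  have := (hasDerivAt_he (p+1) (y j + ρ k j * s)).comp s h1
  simp only [Nat.add_sub_cancel, Nat.cast_add, Nat.cast_one] at this
  exact this

theorem StdGP.allLp_FF (hX : StdGP X ρ μ) (p n : ℕ) (a : ℕ → ℝ) :
    AllLp (fun ω => FF p n a (fun j => X j ω)) μ := by
  unfold FF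
  exact AllLp.sum _ fun j _ => ((hX.allLp j).he _).const_mul _

theorem StdGP.allLp_FD (hX : StdGP X ρ μ) (p n k : ℕ) (a : ℕ → ℝ) :
    AllLp (fun ω => FD ρ p n a k (fun j => X j ω)) μ := by
  unfold FD
  refine AllLp.sum _ fun j _ => AllLp.const_mul ?_ _
  exact (((hX.allLp j).he p).const_mul _).mul (AllLp.const _)

/-- The fluctuating remainder. -/
noncomputable def RR (ρ : ℕ → ℕ → ℝ) (p n : ℕ) (a : ℕ → ℝ) (x : ℕ → ℝ) : ℝ :=
  (p + 1) * ∑ i ∈ Finset.range n, ∑ j ∈ Finset.range n,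
    a i * a j * (ρ i j * (he p (x i) * he p (x j) - p.factorial * ρ i j ^ p))

/-- The variance. -/
noncomputable def VV (ρ : ℕ → ℕ → ℝ) (p n : ℕ) (a : ℕ → ℝ) : ℝ :=
  (p + 1).factorial * ∑ i ∈ Finset.range n, ∑ j ∈ Finset.range n, a i * a j * ρ i j ^ (p + 1)

theorem RR_eq (p n : ℕ) (a : ℕ → ℝ) (x : ℕ → ℝ) :
    RR ρ p n a x = (∑ k ∈ Finset.range n, a k * he p (x k) * FD ρ p n a k x) - VV ρ p n a := by
  unfold RR FD VV
  simp only [Finset.mul_sum, ← Finset.sum_sub_distrib]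
  refine Finset.sum_congr rfl fun i _ => Finset.sum_congr rfl fun j _ => ?_
  rw [Nat.factorial_succ]; push_cast; ring

theorem StdGP.allLp_RR (hX : StdGP X ρ μ) (p n : ℕ) (a : ℕ → ℝ) :
    AllLp (fun ω => RR ρ p n a (fun j => X j ω)) μ := by
  simp only [RR_eq]
  refine AllLp.sub (AllLp.sum _ fun k _ => ?_) (AllLp.const _)
  exact (((hX.allLp k).he p).const_mul _).mul (hX.allLp_FD p n k a)

open Complex in
theorem StdGP.char_ibp (hX : StdGP X ρ μ) (p n : ℕ) (a : ℕ → ℝ) (t : ℝ) :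
    ∫ ω, (FF p n a (fun j => X j ω)) • cexp (t * FF p n a (fun j => X j ω) * I) ∂μ
      = (t * I) * ∫ ω, (RR ρ p n a (fun j => X j ω) + VV ρ p n a)
          • cexp (t * FF p n a (fun j => X j ω) * I) ∂μ := by
  have mX := hX.meas
  have mX' : Measurable (fun ω => (fun j => X j ω)) := measurable_pi_iff.2 mX
  have hg : AllLp (fun ω => cexp (t * FF p n a (fun j => X j ω) * I)) μ := by
    refine AllLp.ofBound ?_ 1 fun ω => ?_
    · exact (by fun_prop : Measurable _).aestronglyMeasurable
    · rw [← ofReal_mul, norm_exp_ofReal_mul_I]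
  have hg' : ∀ k, AllLp (fun ω => (t * FD ρ p n a k (fun j => X j ω)) •
      (I * cexp (t * FF p n a (fun j => X j ω) * I))) μ := by
    intro k
    refine ((hX.allLp_FD p n k a).const_mul _).smul ?_
    refine AllLp.ofBound ?_ 1 fun ω => ?_
    · exact (by fun_prop : Measurable _).aestronglyMeasurable
    · rw [← ofReal_mul, norm_mul, norm_exp_ofReal_mul_I]; simp
  have key : ∀ k, ∫ ω, he (p+1) (X k ω) • cexp (t * FF p n a (fun j => X j ω) * I) ∂μ =
      ∫ ω, he p (X k ω) • ((t * FD ρ p n a k (fun j => X j ω)) •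
      (I * cexp (t * FF p n a (fun j => X j ω) * I))) ∂μ := by
    intro k
    refine hX.hermite_ibp k p (fun x => cexp (t * FF p n a x * I))
      (fun x => (t * FD ρ p n a k x) • (I * cexp (t * FF p n a x * I)))
      (by fun_prop) (by fun_prop) (fun y s => ?_) hg (hg' k)
    have := (((hasDerivAt_FF (ρ := ρ) p n k a y s).ofReal_comp.const_mul (t:ℂ)).mul_const I).cexp
    refine this.congr_deriv ?_
    simp only [real_smul]; push_cast; ring
  have hh := fun k n => (hX.allLp k).he n
  calc _ = ∫ ω, ∑ k ∈ Finset.range n, a k •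
        (he (p+1) (X k ω) • cexp (t * FF p n a (fun j => X j ω) * I)) ∂μ := by
        congr 1; ext ω
        conv_lhs => enter [1]; unfold FF
        rw [Finset.sum_smul]
        simp only [smul_smul]
    _ = ∑ k ∈ Finset.range n, a k •
        ∫ ω, (he (p+1) (X k ω) • cexp (t * FF p n a (fun j => X j ω) * I)) ∂μ := by
        rw [integral_finsetSum]
        · simp only [integral_smul]
        · intro k _
          exact ((hh k _).smul hg).integrable.smul (a k)
    _ = ∫ ω, ∑ k ∈ Finset.range n, a k • (he p (X k ω) • ((t * FD ρ p n a k (fun j => X j ω)) •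
      (I * cexp (t * FF p n a (fun j => X j ω) * I)))) ∂μ := by
        rw [integral_finsetSum]
        · simp only [integral_smul, key]
        · intro k _
          exact ((hh k _).smul (hg' k)).integrable.smul (a k)
    _ = _ := by
        rw [← integral_const_mul]
        congr 1; ext ω
        rw [RR_eq, sub_add_cancel, Finset.sum_smul, Finset.mul_sum]
        refine Finset.sum_congr rfl fun k _ => ?_
        simp only [real_smul]; push_cast; ring

open Complex in
theorem StdGP.char_bound (hX : StdGP X ρ μ) (p n : ℕ) (a : ℕ → ℝ) (t : ℝ) (hv : 0 ≤ VV ρ p n a) :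
    ‖∫ ω, cexp (t * FF p n a (fun j => X j ω) * I) ∂μ - cexp (-(VV ρ p n a * t ^ 2 / 2 : ℝ))‖ ≤
      t ^ 2 * ∫ ω, |RR ρ p n a (fun j => X j ω)| ∂μ := by
  set v := VV ρ p n a with hvdef
  set F : Ω → ℝ := fun ω => FF p n a (fun j => X j ω) with hF
  set R : Ω → ℝ := fun ω => RR ρ p n a (fun j => X j ω) with hR
  have mX := hX.meas
  have mX' : Measurable (fun ω => (fun j => X j ω)) := measurable_pi_iff.2 mX
  have mF : Measurable F := (measurable_FF p n a).comp mX'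
  have iF : Integrable F μ := (hX.allLp_FF p n a).integrable
  have iR : Integrable R μ := (hX.allLp_RR p n a).integrable
  have hg : ∀ s : ℝ, AllLp (fun ω => cexp (s * F ω * I)) μ := by
    intro s
    refine AllLp.ofBound ?_ 1 fun ω => ?_
    · exact (by fun_prop : Measurable _).aestronglyMeasurable
    · rw [← ofReal_mul, norm_exp_ofReal_mul_I]
  have hn : ∀ (s : ℝ) ω, ‖cexp (s * F ω * I)‖ = 1 := by
    intro s ω; rw [← ofReal_mul, norm_exp_ofReal_mul_I]
  set φ : ℝ → ℂ := fun s => ∫ ω, cexp (s * F ω * I) ∂μ with hφ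
  have d1 : ∀ s : ℝ, HasDerivAt φ (∫ ω, (F ω * I) * cexp (s * F ω * I) ∂μ) s := by
    intro s
    refine (hasDerivAt_integral_of_dominated_loc_of_deriv_le (F := fun (s : ℝ) ω => cexp (s * F ω * I))
      (F' := fun (s : ℝ) ω => (F ω * I) * cexp (s * F ω * I)) (x₀ := s) (s := Set.univ)
      (bound := fun ω => |F ω|) univ_mem ?_ (hg s).integrable ?_ ?_ iF.abs ?_).2
    · exact Eventually.of_forall fun s : ℝ => (hg s).integrable.aestronglyMeasurable
    · exact (by fun_prop : Measurable _).aestronglyMeasurable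
    · refine ae_of_all _ fun ω s _ => ?_
      rw [norm_mul, hn]; simp
    · refine ae_of_all _ fun ω s _ => ?_
      have := (((hasDerivAt_id s).ofReal_comp.mul_const (F ω : ℂ)).mul_const I).cexp
      refine this.congr_deriv ?_
      simp; ring
  have iRg : ∀ s : ℝ, Integrable (fun ω => R ω • cexp (s * F ω * I)) μ :=
    fun s => ((hX.allLp_RR p n a).smul (hg s)).integrable
  have d2 : ∀ s : ℝ, ∫ ω, (F ω * I) * cexp (s * F ω * I) ∂μ
      = - s * (∫ ω, R ω • cexp (s * F ω * I) ∂μ) - v * s * φ s := by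
    intro s
    have h := hX.char_ibp p n a s
    have e : ∫ ω, (F ω * I) * cexp (s * F ω * I) ∂μ = I * ∫ ω, F ω • cexp (s * F ω * I) ∂μ := by
      rw [← integral_const_mul]; congr 1; ext ω; simp only [real_smul]; ring
    rw [e, h]
    have e2 : ∫ ω, (R ω + v) • cexp (s * F ω * I) ∂μ =
        (∫ ω, R ω • cexp (s * F ω * I) ∂μ) + v * φ s := by
      simp only [add_smul]
      rw [integral_add (iRg s) (show Integrable (fun ω => v • cexp (s * F ω * I)) μ from
        (hg s).integrable.smul v), integral_smul, real_smul]
    rw [e2]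
    linear_combination (s * ((∫ ω, R ω • cexp (s * F ω * I) ∂μ) + v * φ s)) * I_mul_I
  set ψ : ℝ → ℂ := fun s => cexp ((v * s ^ 2 / 2 : ℝ)) * φ s with hψ
  have d3 : ∀ s : ℝ, HasDerivAt ψ (cexp ((v * s ^ 2 / 2 : ℝ)) *
      (- s * (∫ ω, R ω • cexp (s * F ω * I) ∂μ))) s := by
    intro s
    have h1 : HasDerivAt (fun s : ℝ => v * s ^ 2 / 2) (v * s) s := by
      have := (((hasDerivAt_id s).pow 2).const_mul v).div_const 2
      refine this.congr_deriv ?_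
      simp; ring
    have := h1.ofReal_comp.cexp.mul (d1 s)
    refine this.congr_deriv ?_
    rw [d2]; push_cast; ring
  set ε := ∫ ω, |R ω| ∂μ with hε
  have hε0 : 0 ≤ ε := integral_nonneg fun _ => abs_nonneg _
  have b1 : ∀ s : ℝ, ‖∫ ω, R ω • cexp (s * F ω * I) ∂μ‖ ≤ ε := by
    intro s
    refine (norm_integral_le_integral_norm _).trans (le_of_eq ?_)
    congr 1; ext ω; rw [norm_smul, hn]; simp
  have b2 : ∀ s ∈ Set.uIcc 0 t, ‖cexp ((v * s ^ 2 / 2 : ℝ)) *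
      (- s * (∫ ω, R ω • cexp (s * F ω * I) ∂μ))‖ ≤ Real.exp (v * t ^ 2 / 2) * (|t| * ε) := by
    intro s hs
    have hst : |s| ≤ |t| := by
      have := Set.abs_sub_left_of_mem_uIcc hs
      simpa using this
    rw [norm_mul, norm_exp_ofReal, norm_mul, norm_neg, norm_real, Real.norm_eq_abs]
    have h2 : s ^ 2 ≤ t ^ 2 := sq_le_sq.2 hst
    have := b1 s
    gcongr
  have b3 := (convex_uIcc 0 t).norm_image_sub_le_of_norm_hasDerivWithin_le
    (fun s _ => (d3 s).hasDerivWithinAt) b2 Set.left_mem_uIcc Set.right_mem_uIcc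
  have ψ0 : ψ 0 = 1 := by simp [hψ, hφ]
  rw [ψ0, sub_zero, Real.norm_eq_abs] at b3
  have fin : φ t - cexp (-(v * t ^ 2 / 2 : ℝ)) = cexp (-(v * t ^ 2 / 2 : ℝ)) * (ψ t - 1) := by
    simp only [hψ]
    rw [mul_sub, ← mul_assoc, ← Complex.exp_add]; simp
  change ‖φ t - cexp (-(v * t ^ 2 / 2 : ℝ))‖ ≤ _
  rw [fin, norm_mul, ← ofReal_neg, norm_exp_ofReal]
  calc Real.exp (-(v * t ^ 2 / 2)) * ‖ψ t - 1‖
      ≤ Real.exp (-(v * t ^ 2 / 2)) * (Real.exp (v * t ^ 2 / 2) * (|t| * ε) * |t|) := by gcongr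
    _ = (Real.exp (-(v * t ^ 2 / 2)) * Real.exp (v * t ^ 2 / 2)) * (|t| ^ 2 * ε) := by ring
    _ = t ^ 2 * ε := by rw [← Real.exp_add]; simp
end
end ASCLT

namespace ASCLT

theorem comb_bound (w : ℕ → ℕ → ℝ) (hw : ∀ i j, 0 ≤ w i j) (hs : ∀ i j, w i j = w j i)
    (m l s t : ℕ) (A P Q : ℝ) (hA : ∀ i, ∑ j ∈ Finset.range m, w i j ^ (s + t) ≤ A)
    (hP : ∀ i, ∑ j ∈ Finset.range l, w i j ^ s ≤ P)
    (hQ : ∀ i, ∑ j ∈ Finset.range l, w i j ^ t ≤ Q) :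
    ∑ i ∈ Finset.range m, ∑ j ∈ Finset.range l, ∑ k ∈ Finset.range m, ∑ h ∈ Finset.range l,
      (w i j ^ s * w k h ^ s * (w i k ^ t * w j h ^ t)
        + w i j ^ s * w k h ^ s * (w i h ^ t * w j k ^ t)) ≤ 4 * A * m * (P * Q) := by
  have hA0 : 0 ≤ A := le_trans (Finset.sum_nonneg fun j _ => pow_nonneg (hw 0 j) _) (hA 0)
  have hP0 : 0 ≤ P := le_trans (Finset.sum_nonneg fun j _ => pow_nonneg (hw 0 j) _) (hP 0)
  have hQ0 : 0 ≤ Q := le_trans (Finset.sum_nonneg fun j _ => pow_nonneg (hw 0 j) _) (hQ 0)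
  have hY : ∀ j k, ∑ i ∈ Finset.range m, w i j ^ s * w i k ^ t ≤ 2 * A := by
    intro j k
    calc _ ≤ ∑ i ∈ Finset.range m, (w j i ^ (s + t) + w k i ^ (s + t)) := by
          refine Finset.sum_le_sum fun i _ => ?_
          rw [hs i j, hs i k]
          exact young s t _ _ (hw _ _) (hw _ _)
      _ ≤ 2 * A := by rw [Finset.sum_add_distrib]; linarith [hA j, hA k]
  have e : ∑ i ∈ Finset.range m, ∑ j ∈ Finset.range l, ∑ k ∈ Finset.range m, ∑ h ∈ Finset.range l,
      (w i j ^ s * w k h ^ s * (w i k ^ t * w j h ^ t)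
        + w i j ^ s * w k h ^ s * (w i h ^ t * w j k ^ t))
      = ∑ k ∈ Finset.range m, ∑ h ∈ Finset.range l, ∑ j ∈ Finset.range l,
        ((w k h ^ s * w h j ^ t) * ∑ i ∈ Finset.range m, w i j ^ s * w i k ^ t
        + (w k h ^ s * w k j ^ t) * ∑ i ∈ Finset.range m, w i j ^ s * w i h ^ t) := by
    simp only [Finset.mul_sum, ← Finset.sum_add_distrib]
    rw [Finset.sum_congr rfl fun i _ => Finset.sum_comm]
    rw [Finset.sum_comm]
    refine Finset.sum_congr rfl fun k _ => ?_
    rw [Finset.sum_congr rfl fun i _ => Finset.sum_comm]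
    rw [Finset.sum_comm]
    refine Finset.sum_congr rfl fun h _ => ?_
    rw [Finset.sum_comm]
    refine Finset.sum_congr rfl fun j _ => Finset.sum_congr rfl fun i _ => ?_
    rw [hs h j, hs k j]; ring
  rw [e]
  calc _ ≤ ∑ k ∈ Finset.range m, ∑ h ∈ Finset.range l, ∑ j ∈ Finset.range l,
        ((w k h ^ s * w h j ^ t) * (2 * A) + (w k h ^ s * w k j ^ t) * (2 * A)) := by
        gcongr with k _ h _ j _
        · exact mul_nonneg (pow_nonneg (hw _ _) _) (pow_nonneg (hw _ _) _)
        · exact hY j k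
        · exact mul_nonneg (pow_nonneg (hw _ _) _) (pow_nonneg (hw _ _) _)
        · exact hY j h
    _ = ∑ k ∈ Finset.range m, ∑ h ∈ Finset.range l, w k h ^ s * (2 * A) *
        ((∑ j ∈ Finset.range l, w h j ^ t) + ∑ j ∈ Finset.range l, w k j ^ t) := by
        refine Finset.sum_congr rfl fun k _ => Finset.sum_congr rfl fun h _ => ?_
        rw [← Finset.sum_add_distrib, Finset.mul_sum]
        refine Finset.sum_congr rfl fun j _ => by ring
    _ ≤ ∑ k ∈ Finset.range m, ∑ h ∈ Finset.range l, w k h ^ s * (2 * A) * (Q + Q) := by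
        gcongr with k _ h _
        · exact mul_nonneg (pow_nonneg (hw _ _) _) (by linarith)
        · exact hQ h
        · exact hQ k
    _ = ∑ k ∈ Finset.range m, (∑ h ∈ Finset.range l, w k h ^ s) * (4 * A * Q) := by
        refine Finset.sum_congr rfl fun k _ => ?_
        rw [Finset.sum_mul]
        refine Finset.sum_congr rfl fun j _ => by ring
    _ ≤ ∑ k ∈ Finset.range m, P * (4 * A * Q) := by
        gcongr with k _
        exact hP k
    _ = _ := by simp; ring

theorem sum5 (a b c d e : Finset ℕ) (f : ℕ → ℕ → ℕ → ℕ → ℕ → ℝ) :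
    ∑ i ∈ a, ∑ j ∈ b, ∑ k ∈ c, ∑ h ∈ d, ∑ s ∈ e, f i j k h s =
    ∑ s ∈ e, ∑ i ∈ a, ∑ j ∈ b, ∑ k ∈ c, ∑ h ∈ d, f i j k h s := by
  symm
  rw [Finset.sum_comm]
  refine Finset.sum_congr rfl fun i _ => ?_
  rw [Finset.sum_comm]
  refine Finset.sum_congr rfl fun j _ => ?_
  rw [Finset.sum_comm]
  refine Finset.sum_congr rfl fun k _ => ?_
  rw [Finset.sum_comm]

section
set_option linter.unusedSectionVars false
variable {Ω : Type*} {mΩ : MeasurableSpace Ω} {μ : Measure Ω} [IsProbabilityMeasure μ]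
  {X : ℕ → Ω → ℝ} {ρ : ℕ → ℕ → ℝ}

theorem AllLp.abs_le_sqrt {f : Ω → ℝ} (hf : AllLp f μ) :
    ∫ ω, |f ω| ∂μ ≤ Real.sqrt (∫ ω, f ω ^ 2 ∂μ) := by
  apply Real.le_sqrt_of_sq_le
  set c := ∫ ω, |f ω| ∂μ with hc
  have i1 : Integrable (fun ω => f ω ^ 2) μ := by
    simpa [sq] using (hf.mul hf).integrable
  have i2 : Integrable (fun ω => |f ω|) μ := hf.integrable.abs
  have h : 0 ≤ ∫ ω, (f ω ^ 2 - 2 * c * |f ω|) + c ^ 2 ∂μ := by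
    refine integral_nonneg fun ω => ?_
    have : 0 ≤ (|f ω| - c) ^ 2 := sq_nonneg _
    simp only [Pi.zero_apply]
    nlinarith [sq_abs (f ω)]
  rw [integral_add (show Integrable (fun ω => f ω ^ 2 - 2 * c * |f ω|) μ from
    i1.sub (i2.const_mul _)) (integrable_const _),
    integral_sub i1 (i2.const_mul _), integral_const_mul] at h
  simp at h
  rw [← hc] at h
  nlinarith

/-- off-diagonal remainder blocks -/
noncomputable def TT (ρ : ℕ → ℕ → ℝ) (p m l : ℕ) (x : ℕ → ℝ) : ℝ :=
  ∑ i ∈ Finset.range m, ∑ j ∈ Finset.range l,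
    ρ i j * (he p (x i) * he p (x j) - p.factorial * ρ i j ^ p)

theorem StdGP.allLp_TT (hX : StdGP X ρ μ) (p m l : ℕ) :
    AllLp (fun ω => TT ρ p m l (fun j => X j ω)) μ := by
  unfold TT
  refine AllLp.sum _ fun i _ => AllLp.sum _ fun j _ => AllLp.const_mul ?_ _
  exact (((hX.allLp i).he p).mul ((hX.allLp j).he p)).sub (AllLp.const _)

theorem StdGP.symm (hX : StdGP X ρ μ) (i j : ℕ) : ρ i j = ρ j i := by
  rw [← hX.cov, ← hX.cov]; congr 1; ext ω; ring

theorem cyc_bound {ρ : ℕ → ℕ → ℝ} {C A : ℝ} {p m l : ℕ} {P : ℕ → ℝ} (hC : 0 ≤ C)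
    (hs : ∀ i j, ρ i j = ρ j i)
    (hA : ∀ i, ∑ j ∈ Finset.range m, |ρ i j| ^ (p + 1) ≤ A)
    (hP : ∀ s ∈ Finset.Icc 1 p, ∀ i, ∑ j ∈ Finset.range l, |ρ i j| ^ s ≤ P s) :
    ∑ i ∈ Finset.range m, ∑ j ∈ Finset.range l, ∑ k ∈ Finset.range m,
        ∑ h ∈ Finset.range l, C * cyc p (ρ i j) (ρ k h) (ρ i k) (ρ j h) (ρ i h) (ρ j k)
      ≤ 4 * C * (A * m * ∑ s ∈ Finset.Icc 1 p, P s * P (p + 1 - s)) := by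
  have e : ∑ i ∈ Finset.range m, ∑ j ∈ Finset.range l, ∑ k ∈ Finset.range m,
        ∑ h ∈ Finset.range l, C * cyc p (ρ i j) (ρ k h) (ρ i k) (ρ j h) (ρ i h) (ρ j k)
      = C * ∑ s ∈ Finset.Icc 1 p, ∑ i ∈ Finset.range m, ∑ j ∈ Finset.range l,
        ∑ k ∈ Finset.range m, ∑ h ∈ Finset.range l,
        (|ρ i j| ^ s * |ρ k h| ^ s * (|ρ i k| ^ (p + 1 - s) * |ρ j h| ^ (p + 1 - s))
        + |ρ i j| ^ s * |ρ k h| ^ s * (|ρ i h| ^ (p + 1 - s) * |ρ j k| ^ (p + 1 - s))) := by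
    simp only [← Finset.mul_sum]
    unfold cyc
    rw [sum5]
  rw [e]
  have h2 : ∀ s ∈ Finset.Icc 1 p, ∑ i ∈ Finset.range m, ∑ j ∈ Finset.range l,
        ∑ k ∈ Finset.range m, ∑ h ∈ Finset.range l,
        (|ρ i j| ^ s * |ρ k h| ^ s * (|ρ i k| ^ (p + 1 - s) * |ρ j h| ^ (p + 1 - s))
        + |ρ i j| ^ s * |ρ k h| ^ s * (|ρ i h| ^ (p + 1 - s) * |ρ j k| ^ (p + 1 - s)))
      ≤ 4 * A * m * (P s * P (p + 1 - s)) := by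
    intro s hsm
    have hs' := Finset.mem_Icc.1 hsm
    refine comb_bound (fun i j => |ρ i j|) (fun _ _ => abs_nonneg _)
      (fun i j => by rw [hs i j]) m l s (p + 1 - s) A _ _ ?_ (hP s hsm)
      (hP _ (Finset.mem_Icc.2 (by omega)))
    intro i
    rw [show s + (p + 1 - s) = p + 1 by omega]
    exact hA i
  refine (mul_le_mul_of_nonneg_left (Finset.sum_le_sum h2) hC).trans (le_of_eq ?_)
  rw [← Finset.mul_sum]; ring

theorem TT_bound (p : ℕ) : ∃ C : ℝ, 0 ≤ C ∧ ∀ {Ω : Type*} {mΩ : MeasurableSpace Ω}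
    {μ : Measure Ω} [IsProbabilityMeasure μ] {X : ℕ → Ω → ℝ} {ρ : ℕ → ℕ → ℝ},
    StdGP X ρ μ → ∀ (m l : ℕ) (A : ℝ) (P : ℕ → ℝ),
    (∀ i, ∑ j ∈ Finset.range m, |ρ i j| ^ (p + 1) ≤ A) →
    (∀ s ∈ Finset.Icc 1 p, ∀ i, ∑ j ∈ Finset.range l, |ρ i j| ^ s ≤ P s) →
    ∫ ω, |TT ρ p m l (fun j => X j ω)| ∂μ ≤
      Real.sqrt (C * (A * m * ∑ s ∈ Finset.Icc 1 p, P s * P (p + 1 - s))) := by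
  obtain ⟨C, hC, hb⟩ := cov_bound p
  refine ⟨4 * C, by positivity, fun {Ω mΩ μ _ X ρ} hX m l A P hA hP => ?_⟩
  refine (hX.allLp_TT p m l).abs_le_sqrt.trans (Real.sqrt_le_sqrt ?_)
  set D : ℕ → ℕ → Ω → ℝ := fun i j ω =>
    he p (X i ω) * he p (X j ω) - p.factorial * ρ i j ^ p with hD
  have hDL : ∀ i j, AllLp (D i j) μ := fun i j =>
    (((hX.allLp i).he p).mul ((hX.allLp j).he p)).sub (AllLp.const _)
  have e : ∀ ω, TT ρ p m l (fun j => X j ω) ^ 2 =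
      ∑ i ∈ Finset.range m, ∑ j ∈ Finset.range l, ∑ k ∈ Finset.range m, ∑ h ∈ Finset.range l,
        (ρ i j * ρ k h) * (D i j ω * D k h ω) := by
    intro ω
    rw [sq]; unfold TT
    simp only [Finset.sum_mul, Finset.mul_sum]
    refine Finset.sum_congr rfl fun i _ => Finset.sum_congr rfl fun j _ =>
      Finset.sum_congr rfl fun k _ => Finset.sum_congr rfl fun h _ => ?_
    simp only [hD]; ring
  have iD : ∀ i j k h, AllLp (fun ω => (ρ i j * ρ k h) * (D i j ω * D k h ω)) μ :=
    fun i j k h => ((hDL i j).mul (hDL k h)).const_mul _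
  simp only [e]
  rw [integral_finsetSum _ fun i _ => (AllLp.sum _ fun j _ => AllLp.sum _ fun k _ =>
    AllLp.sum _ fun h _ => iD i j k h).integrable]
  simp_rw [fun i => integral_finsetSum (Finset.range l) (f := fun j ω =>
    ∑ k ∈ Finset.range m, ∑ h ∈ Finset.range l, (ρ i j * ρ k h) * (D i j ω * D k h ω))
    fun j _ => (AllLp.sum _ fun k _ => AllLp.sum _ fun h _ => iD i j k h).integrable]
  simp_rw [fun i j => integral_finsetSum (Finset.range m) (f := fun k ω =>
    ∑ h ∈ Finset.range l, (ρ i j * ρ k h) * (D i j ω * D k h ω))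
    fun k _ => (AllLp.sum _ fun h _ => iD i j k h).integrable]
  simp_rw [fun i j k => integral_finsetSum (Finset.range l) (f := fun h ω =>
    (ρ i j * ρ k h) * (D i j ω * D k h ω)) fun h _ => (iD i j k h).integrable]
  have b : ∀ i j k h, ∫ ω, (ρ i j * ρ k h) * (D i j ω * D k h ω) ∂μ ≤
      C * cyc p (ρ i j) (ρ k h) (ρ i k) (ρ j h) (ρ i h) (ρ j k) := by
    intro i j k h
    rw [integral_const_mul]
    refine (le_abs_self _).trans ?_
    rw [abs_mul, abs_mul]
    exact hb hX i j k h
  refine le_trans (Finset.sum_le_sum fun i _ => Finset.sum_le_sum fun j _ =>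
    Finset.sum_le_sum fun k _ => Finset.sum_le_sum fun h _ => b i j k h) ?_
  exact cyc_bound hC hX.symm hA hP

end
end ASCLT

namespace ASCLT

theorem sum_dist_le (f : ℕ → ℝ) (hf : Antitone f) (h0 : ∀ n, 0 ≤ f n) (n i : ℕ) :
    ∑ j ∈ Finset.range n, f (Nat.dist i j) ≤ 2 * ∑ d ∈ Finset.range n, f d := by
  have main : ∀ i < n, ∑ j ∈ Finset.range n, f (Nat.dist i j) ≤ 2 * ∑ d ∈ Finset.range n, f d := by
    intro i hi
    rw [← Finset.sum_range_add_sum_Ico _ hi.le, two_mul]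
    gcongr ?_ + ?_
    · calc ∑ j ∈ Finset.range i, f (Nat.dist i j)
          ≤ ∑ j ∈ Finset.range i, f (i - 1 - j) := by
            refine Finset.sum_le_sum fun j hj => hf ?_
            simp [Nat.dist]; omega
        _ = ∑ j ∈ Finset.range i, f j := Finset.sum_range_reflect f i
        _ ≤ _ := Finset.sum_le_sum_of_subset_of_nonneg (Finset.range_mono hi.le) fun _ _ _ => h0 _
    · rw [Finset.sum_Ico_eq_sum_range]
      calc ∑ k ∈ Finset.range (n - i), f (Nat.dist i (i + k))
          = ∑ k ∈ Finset.range (n - i), f k := by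
            refine Finset.sum_congr rfl fun j hj => ?_
            congr 1; simp [Nat.dist]
        _ ≤ _ := Finset.sum_le_sum_of_subset_of_nonneg (Finset.range_mono (by omega))
              fun _ _ _ => h0 _
  rcases lt_or_ge i n with h | h
  · exact main i h
  · rcases Nat.eq_zero_or_pos n with rfl | hn
    · simp
    · refine le_trans (Finset.sum_le_sum fun j hj => hf ?_) (main (n - 1) (by omega))
      have := Finset.mem_range.1 hj
      simp [Nat.dist]; omega

theorem sum_rpow_le {γ : ℝ} (h0 : 0 ≤ γ) (h1 : γ < 1) (n : ℕ) :
    ∑ d ∈ Finset.range n, (1 + (d : ℝ)) ^ (-γ) ≤ (1 - γ)⁻¹ * (n : ℝ) ^ (1 - γ) := by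
  have hg : 0 < 1 - γ := by linarith
  induction n with
  | zero => simp [Real.zero_rpow hg.ne']
  | succ n ih =>
    rw [Finset.sum_range_succ]
    refine (add_le_add_left ih _).trans ?_
    push_cast
    set N : ℝ := (n : ℝ) + 1 with hN
    have hNp : 0 < N := by positivity
    have b : (1 + -(1 / N)) ^ (1 - γ) ≤ 1 + (1 - γ) * (-(1 / N)) := by
      apply rpow_one_add_le_one_add_mul_self
      · have : 1 / N ≤ 1 := by rw [div_le_one hNp]; simp [hN]
        linarith
      · exact hg.le
      · linarith
    have e1 : (n : ℝ) = N * (1 + -(1 / N)) := by field_simp; simp [hN]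
    have hnn : 0 ≤ 1 + -(1 / N) := by
      have : 1 / N ≤ 1 := by rw [div_le_one hNp]; simp [hN]
      linarith
    have e2 : (n : ℝ) ^ (1 - γ) = N ^ (1 - γ) * (1 + -(1 / N)) ^ (1 - γ) := by
      rw [← Real.mul_rpow hNp.le hnn, ← e1]
    have e3 : N ^ (1 - γ) = N * N ^ (-γ) := by
      rw [sub_eq_add_neg, Real.rpow_add hNp, Real.rpow_one]
    have e4 : (1 + (n : ℝ)) = N := by rw [hN]; ring
    rw [e4, e2]
    have : N ^ (1 - γ) * (1 + -(1 / N)) ^ (1 - γ) ≤ N ^ (1 - γ) - (1 - γ) * N ^ (-γ) := by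
      calc _ ≤ N ^ (1 - γ) * (1 + (1 - γ) * (-(1 / N))) := by gcongr
        _ = _ := by rw [e3]; field_simp; ring
    calc (1 - γ)⁻¹ * (N ^ (1 - γ) * (1 + -(1 / N)) ^ (1 - γ)) + N ^ (-γ)
        ≤ (1 - γ)⁻¹ * (N ^ (1 - γ) - (1 - γ) * N ^ (-γ)) + N ^ (-γ) := by gcongr
      _ = _ := by field_simp; ring

theorem antitone_rp {γ : ℝ} (h0 : 0 ≤ γ) : Antitone (fun d : ℕ => (1 + (d : ℝ)) ^ (-γ)) := by
  intro a b hab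
  apply Real.rpow_le_rpow_of_nonpos (by positivity) _ (by linarith)
  gcongr

theorem sum_rpow_bdd {γ : ℝ} (h1 : 1 < γ) :
    ∃ A : ℝ, 0 ≤ A ∧ ∀ n : ℕ, ∑ d ∈ Finset.range n, (1 + (d : ℝ)) ^ (-γ) ≤ A := by
  have hs : Summable (fun d : ℕ => (1 + (d : ℝ)) ^ (-γ)) := by
    have := (summable_nat_add_iff 1).2 (Real.summable_nat_rpow.2 (by linarith : -γ < -1))
    simpa [add_comm] using this
  exact ⟨_, tsum_nonneg fun d => by positivity, fun n => hs.sum_le_tsum _ fun _ _ => by positivity⟩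

structure Decay (ρ : ℕ → ℕ → ℝ) (D β : ℝ) : Prop where
  D0 : 0 ≤ D
  β0 : 0 < β
  bd : ∀ i j, |ρ i j| ≤ D * (1 + (Nat.dist i j : ℝ)) ^ (-β)

theorem Decay.pow {ρ : ℕ → ℕ → ℝ} {D β : ℝ} (h : Decay ρ D β) (s i j : ℕ) :
    |ρ i j| ^ s ≤ D ^ s * (1 + (Nat.dist i j : ℝ)) ^ (-(s * β)) := by
  calc |ρ i j| ^ s ≤ (D * (1 + (Nat.dist i j : ℝ)) ^ (-β)) ^ s := by
        gcongr; exact h.bd i j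
    _ = _ := by
        rw [mul_pow, ← Real.rpow_natCast (_ ^ (-β)), ← Real.rpow_mul (by positivity)]
        congr 2; ring

theorem Decay.sum_lt {ρ : ℕ → ℕ → ℝ} {D β : ℝ} (h : Decay ρ D β) (s : ℕ) (hs : s * β < 1)
    (n i : ℕ) : ∑ j ∈ Finset.range n, |ρ i j| ^ s ≤
      D ^ s * (2 * (1 - s * β)⁻¹) * (n : ℝ) ^ (1 - s * β) := by
  have hD := h.D0
  have hb : 0 ≤ s * β := mul_nonneg (by positivity) h.β0.le
  calc _ ≤ ∑ j ∈ Finset.range n, D ^ s * (1 + (Nat.dist i j : ℝ)) ^ (-(s * β)) :=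
        Finset.sum_le_sum fun j _ => h.pow s i j
    _ = D ^ s * ∑ j ∈ Finset.range n, (1 + (Nat.dist i j : ℝ)) ^ (-(s * β)) := by
        rw [Finset.mul_sum]
    _ ≤ D ^ s * (2 * ((1 - s * β)⁻¹ * (n : ℝ) ^ (1 - s * β))) := by
        gcongr
        refine (sum_dist_le _ (antitone_rp hb) (fun _ => by positivity) n i).trans ?_
        gcongr
        exact sum_rpow_le hb hs n
    _ = _ := by ring

theorem Decay.sum_gt {ρ : ℕ → ℕ → ℝ} {D β : ℝ} (h : Decay ρ D β) (s : ℕ) (hs : 1 < s * β) :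
    ∃ A : ℝ, 0 ≤ A ∧ ∀ n i : ℕ, ∑ j ∈ Finset.range n, |ρ i j| ^ s ≤ A := by
  obtain ⟨A, hA, hb'⟩ := sum_rpow_bdd hs
  have hD := h.D0
  have hb : 0 ≤ s * β := mul_nonneg (by positivity) h.β0.le
  refine ⟨D ^ s * (2 * A), by positivity, fun n i => ?_⟩
  calc _ ≤ ∑ j ∈ Finset.range n, D ^ s * (1 + (Nat.dist i j : ℝ)) ^ (-(s * β)) :=
        Finset.sum_le_sum fun j _ => h.pow s i j
    _ = D ^ s * ∑ j ∈ Finset.range n, (1 + (Nat.dist i j : ℝ)) ^ (-(s * β)) := by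
        rw [Finset.mul_sum]
    _ ≤ D ^ s * (2 * A) := by
        gcongr
        refine (sum_dist_le _ (antitone_rp hb) (fun _ => by positivity) n i).trans ?_
        gcongr
        exact hb' n

section
variable {Ω : Type*} {mΩ : MeasurableSpace Ω} {μ : Measure Ω} [IsProbabilityMeasure μ]
  {X : ℕ → Ω → ℝ} {ρ : ℕ → ℕ → ℝ}

theorem StdGP.TT_le (hX : StdGP X ρ μ) {p : ℕ} {D β : ℝ} (h : Decay ρ D β)
    (h1 : p * β < 1) (h2 : 1 < (p + 1 : ℕ) * β) :
    ∃ K : ℝ, 0 ≤ K ∧ ∀ m l : ℕ, 1 ≤ l → ∫ ω, |TT ρ p m l (fun j => X j ω)| ∂μ ≤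
      K * Real.sqrt m * Real.sqrt l * (l : ℝ) ^ (-(((p + 1 : ℕ) * β - 1) / 2)) := by
  obtain ⟨C, hC, hT⟩ := TT_bound p
  obtain ⟨A, hA, hA'⟩ := h.sum_gt (p + 1) h2
  have hD := h.D0
  have hβ := h.β0
  have hsb : ∀ s ∈ Finset.Icc 1 p, (s : ℝ) * β < 1 := by
    intro s hs
    have : (s : ℝ) ≤ p := by exact_mod_cast (Finset.mem_Icc.1 hs).2
    nlinarith
  set κ : ℕ → ℝ := fun s => D ^ s * (2 * (1 - s * β)⁻¹) with hκ
  set S : ℝ := ∑ s ∈ Finset.Icc 1 p, κ s * κ (p + 1 - s) with hS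
  refine ⟨Real.sqrt (C * (A * S)), by positivity, fun m l hl => ?_⟩
  have hl0 : (0 : ℝ) < l := by exact_mod_cast hl
  refine (hT hX m l A (fun s => κ s * (l : ℝ) ^ (1 - s * β)) (hA' m)
    (fun s hs i => h.sum_lt s (hsb s hs) l i)).trans ?_
  have e : ∑ s ∈ Finset.Icc 1 p, (κ s * (l : ℝ) ^ (1 - s * β)) *
      (κ (p + 1 - s) * (l : ℝ) ^ (1 - (p + 1 - s : ℕ) * β)) =
      S * (l * ((l : ℝ) ^ (-(((p + 1 : ℕ) * β - 1) / 2))) ^ 2) := by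
    rw [hS, Finset.sum_mul]
    refine Finset.sum_congr rfl fun s hs => ?_
    have : (l : ℝ) ^ (1 - s * β) * (l : ℝ) ^ (1 - (p + 1 - s : ℕ) * β) =
        l * ((l : ℝ) ^ (-(((p + 1 : ℕ) * β - 1) / 2))) ^ 2 := by
      rw [← Real.rpow_natCast (_ ^ _), ← Real.rpow_mul hl0.le, ← Real.rpow_add hl0,
        ← Real.rpow_one_add' hl0.le]
      · congr 1
        have := (Finset.mem_Icc.1 hs).2
        rw [Nat.cast_sub (by omega)]
        push_cast; ring
      · have : (p : ℝ) * β < 1 := h1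
        push_cast
        have b1 : β < 1 := by
          simpa using hsb 1 (Finset.mem_Icc.2 ⟨le_rfl, by have := Finset.mem_Icc.1 hs; omega⟩)
        intro h0
        linarith
    rw [← this]; ring
  rw [e]
  have e2 : C * (A * m * (S * (l * ((l : ℝ) ^ (-(((p + 1 : ℕ) * β - 1) / 2))) ^ 2))) =
      (C * (A * S)) * m * l * ((l : ℝ) ^ (-(((p + 1 : ℕ) * β - 1) / 2))) ^ 2 := by ring
  rw [e2, Real.sqrt_mul' _ (by positivity), Real.sqrt_mul' _ (by positivity),
    Real.sqrt_mul' _ (by positivity), Real.sqrt_sq (by positivity)]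

end
end ASCLT

namespace ASCLT

/-- two-step weights -/
noncomputable def wt (α γ : ℝ) (m l j : ℕ) : ℝ :=
  α * (if j < m then 1 else 0) + γ * (if j < l then 1 else 0)

theorem lin_split (α γ : ℝ) {m l N : ℕ} (hm : m ≤ N) (hl : l ≤ N) (f : ℕ → ℝ) :
    ∑ j ∈ Finset.range N, wt α γ m l j * f j =
      α * ∑ j ∈ Finset.range m, f j + γ * ∑ j ∈ Finset.range l, f j := by
  have h : ∀ m ≤ N, ∑ j ∈ Finset.range m, f j =
      ∑ j ∈ Finset.range N, (if j < m then 1 else 0) * f j := by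
    intro m hm
    rw [← Finset.sum_subset (Finset.range_mono hm)]
    · refine Finset.sum_congr rfl fun j hj => ?_
      rw [if_pos (Finset.mem_range.1 hj), one_mul]
    · intro j _ hj
      rw [if_neg (by simpa using hj), zero_mul]
  rw [h m hm, h l hl, Finset.mul_sum, Finset.mul_sum, ← Finset.sum_add_distrib]
  refine Finset.sum_congr rfl fun j hj => ?_
  unfold wt; ring

theorem quad_split (α γ : ℝ) {m l N : ℕ} (hm : m ≤ N) (hl : l ≤ N) (b : ℕ → ℕ → ℝ) :
    ∑ i ∈ Finset.range N, ∑ j ∈ Finset.range N, wt α γ m l i * wt α γ m l j * b i j =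
      α ^ 2 * (∑ i ∈ Finset.range m, ∑ j ∈ Finset.range m, b i j)
      + α * γ * (∑ i ∈ Finset.range m, ∑ j ∈ Finset.range l, b i j)
      + α * γ * (∑ i ∈ Finset.range l, ∑ j ∈ Finset.range m, b i j)
      + γ ^ 2 * (∑ i ∈ Finset.range l, ∑ j ∈ Finset.range l, b i j) := by
  simp only [mul_assoc, ← Finset.mul_sum]
  rw [lin_split α γ hm hl]
  simp only [lin_split α γ hm hl, Finset.sum_add_distrib, ← Finset.mul_sum]
  ring

section
variable {Ω : Type*} {mΩ : MeasurableSpace Ω} {μ : Measure Ω} [IsProbabilityMeasure μ]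
  {X : ℕ → Ω → ℝ} {ρ : ℕ → ℕ → ℝ}

theorem StdGP.FF_sq (hX : StdGP X ρ μ) (p n : ℕ) (a : ℕ → ℝ) :
    ∫ ω, FF p n a (fun j => X j ω) ^ 2 ∂μ = VV ρ p n a := by
  have iD : ∀ i j, AllLp (fun ω => (a i * a j) * (he (p+1) (X i ω) * he (p+1) (X j ω))) μ :=
    fun i j => (((hX.allLp i).he _).mul ((hX.allLp j).he _)).const_mul _
  have e : ∀ ω, FF p n a (fun j => X j ω) ^ 2 = ∑ i ∈ Finset.range n, ∑ j ∈ Finset.range n,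
      (a i * a j) * (he (p+1) (X i ω) * he (p+1) (X j ω)) := by
    intro ω
    rw [sq]; unfold FF
    simp only [Finset.sum_mul, Finset.mul_sum]
    rw [Finset.sum_comm]
    refine Finset.sum_congr rfl fun i _ => Finset.sum_congr rfl fun j _ => by ring
  simp only [e]
  rw [integral_finsetSum _ fun i _ => (AllLp.sum _ fun j _ => iD i j).integrable]
  unfold VV
  rw [Finset.mul_sum]
  refine Finset.sum_congr rfl fun i _ => ?_
  rw [integral_finsetSum _ fun j _ => (iD i j).integrable, Finset.mul_sum]
  refine Finset.sum_congr rfl fun j _ => ?_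
  rw [integral_const_mul, hX.mom_two]; ring

theorem StdGP.VV_nonneg (hX : StdGP X ρ μ) (p n : ℕ) (a : ℕ → ℝ) : 0 ≤ VV ρ p n a := by
  rw [← hX.FF_sq]; exact integral_nonneg fun _ => sq_nonneg _

/-- cross covariance -/
noncomputable def CC (ρ : ℕ → ℕ → ℝ) (p m l : ℕ) : ℝ :=
  (p + 1).factorial * ∑ i ∈ Finset.range m, ∑ j ∈ Finset.range l, ρ i j ^ (p + 1)

theorem VV_split (p : ℕ) (α γ : ℝ) {m l N : ℕ} (hm : m ≤ N) (hl : l ≤ N) :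
    VV ρ p N (wt α γ m l) = α ^ 2 * CC ρ p m m + α * γ * CC ρ p m l + α * γ * CC ρ p l m
      + γ ^ 2 * CC ρ p l l := by
  unfold VV CC
  rw [quad_split α γ hm hl]; ring

theorem RR_split (p : ℕ) (α γ : ℝ) {m l N : ℕ} (hm : m ≤ N) (hl : l ≤ N) (x : ℕ → ℝ) :
    RR ρ p N (wt α γ m l) x = (p + 1) * (α ^ 2 * TT ρ p m m x + α * γ * TT ρ p m l x
      + α * γ * TT ρ p l m x + γ ^ 2 * TT ρ p l l x) := by
  unfold RR TT
  rw [quad_split α γ hm hl]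

/-- the unweighted Hermite sum -/
noncomputable def WW (p n : ℕ) (x : ℕ → ℝ) : ℝ := ∑ j ∈ Finset.range n, he (p + 1) (x j)

theorem FF_split (p : ℕ) (α γ : ℝ) {m l N : ℕ} (hm : m ≤ N) (hl : l ≤ N) (x : ℕ → ℝ) :
    FF p N (wt α γ m l) x = α * WW p m x + γ * WW p l x := by
  unfold FF WW
  rw [lin_split α γ hm hl]

theorem StdGP.WW_sq (hX : StdGP X ρ μ) (p n : ℕ) :
    ∫ ω, WW p n (fun j => X j ω) ^ 2 ∂μ = CC ρ p n n := by
  have := hX.FF_sq p n (wt 1 0 n n)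
  rw [VV_split p 1 0 le_rfl le_rfl] at this
  simp only [FF_split p 1 0 le_rfl le_rfl] at this
  simpa using this

theorem StdGP.CC_nonneg (hX : StdGP X ρ μ) (p n : ℕ) : 0 ≤ CC ρ p n n := by
  rw [← hX.WW_sq]; exact integral_nonneg fun _ => sq_nonneg _

theorem StdGP.RR_abs (hX : StdGP X ρ μ) (p : ℕ) (α γ : ℝ) {m l N : ℕ} (hm : m ≤ N) (hl : l ≤ N) :
    ∫ ω, |RR ρ p N (wt α γ m l) (fun j => X j ω)| ∂μ ≤
      (p + 1) * (α ^ 2 * (∫ ω, |TT ρ p m m (fun j => X j ω)| ∂μ)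
        + |α| * |γ| * (∫ ω, |TT ρ p m l (fun j => X j ω)| ∂μ)
        + |α| * |γ| * (∫ ω, |TT ρ p l m (fun j => X j ω)| ∂μ)
        + γ ^ 2 * (∫ ω, |TT ρ p l l (fun j => X j ω)| ∂μ)) := by
  have i := fun m l => (hX.allLp_TT p m l).integrable.abs
  have i1 := (i m m).const_mul (α ^ 2)
  have i2 := (i m l).const_mul (|α| * |γ|)
  have i3 := (i l m).const_mul (|α| * |γ|)
  have i4 := (i l l).const_mul (γ ^ 2)
  have i12 := i1.add i2
  have i123 := i12.add i3
  have i1234 := i123.add i4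
  have e : ((p + 1) * (α ^ 2 * (∫ ω, |TT ρ p m m (fun j => X j ω)| ∂μ)
        + |α| * |γ| * (∫ ω, |TT ρ p m l (fun j => X j ω)| ∂μ)
        + |α| * |γ| * (∫ ω, |TT ρ p l m (fun j => X j ω)| ∂μ)
        + γ ^ 2 * (∫ ω, |TT ρ p l l (fun j => X j ω)| ∂μ)) : ℝ) =
      ∫ ω, (p + 1) * (α ^ 2 * |TT ρ p m m (fun j => X j ω)|
        + |α| * |γ| * |TT ρ p m l (fun j => X j ω)|
        + |α| * |γ| * |TT ρ p l m (fun j => X j ω)|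
        + γ ^ 2 * |TT ρ p l l (fun j => X j ω)|) ∂μ := by
    rw [integral_const_mul]
    congr 1
    have e1 := integral_add i123 i4
    have e2 := integral_add i12 i3
    have e3 := integral_add i1 i2
    simp only [Pi.add_apply, integral_const_mul] at e1 e2 e3 ⊢
    rw [e1, e2, e3]
  rw [e]
  refine integral_mono (hX.allLp_RR p N _).integrable.abs (i1234.const_mul (p + 1 : ℝ)) fun ω => ?_
  simp only [RR_split p α γ hm hl]
  rw [abs_mul, abs_of_nonneg (by positivity : (0 : ℝ) ≤ p + 1)]
  gcongr
  refine (abs_add_le _ _).trans ?_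
  gcongr ?_ + ?_
  · refine (abs_add_le _ _).trans ?_
    gcongr ?_ + ?_
    · refine (abs_add_le _ _).trans ?_
      gcongr ?_ + ?_
      · rw [abs_mul, abs_of_nonneg (sq_nonneg _)]
      · rw [abs_mul, abs_mul]
    · rw [abs_mul, abs_mul]
  · rw [abs_mul, abs_of_nonneg (sq_nonneg _)]

theorem StdGP.CC_abs (hX : StdGP X ρ μ) (p : ℕ) {A : ℝ}
    (hA : ∀ n i : ℕ, ∑ j ∈ Finset.range n, |ρ i j| ^ (p + 1) ≤ A) (m l : ℕ) :
    |CC ρ p m l| ≤ (p + 1).factorial * A * m ∧ |CC ρ p l m| ≤ (p + 1).factorial * A * m := by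
  have sw : CC ρ p l m = CC ρ p m l := by
    unfold CC
    rw [Finset.sum_comm]
    congr 1
    refine Finset.sum_congr rfl fun i _ => Finset.sum_congr rfl fun j _ => ?_
    rw [hX.symm]
  rw [sw, and_self]
  unfold CC
  rw [abs_mul, abs_of_nonneg (by positivity : (0:ℝ) ≤ ((p+1).factorial : ℝ)), mul_assoc]
  gcongr
  refine (Finset.abs_sum_le_sum_abs _ _).trans ?_
  calc _ ≤ ∑ i ∈ Finset.range m, A := by
        refine Finset.sum_le_sum fun i _ => ?_
        refine (Finset.abs_sum_le_sum_abs _ _).trans ?_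
        simp only [abs_pow]
        exact hA l i
    _ = _ := by simp; ring

/-- normalised sums -/
noncomputable def GG (ρ : ℕ → ℕ → ℝ) (p n : ℕ) (x : ℕ → ℝ) : ℝ :=
  WW p n x / Real.sqrt (CC ρ p n n)

set_option maxHeartbeats 2000000 in
open Complex in
theorem StdGP.char_two (hX : StdGP X ρ μ) {p : ℕ} {D β c : ℝ} (h : Decay ρ D β)
    (h1 : p * β < 1) (h2 : 1 < (p + 1 : ℕ) * β) (hc : 0 < c)
    (hlow : ∀ n : ℕ, c * n ≤ CC ρ p n n) :
    ∃ K δ : ℝ, 0 ≤ K ∧ 0 < δ ∧ ∀ (t ε : ℝ), (ε = 0 ∨ ε = -1) → ∀ m l : ℕ, 1 ≤ m → m ≤ l →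
      ‖∫ ω, cexp (t * (GG ρ p m (fun j => X j ω) + ε * GG ρ p l (fun j => X j ω) : ℝ) * I) ∂μ
        - cexp (-((1 + ε ^ 2) * t ^ 2 / 2 : ℝ))‖ ≤
        K * t ^ 2 * ((m : ℝ) ^ (-δ) + Real.sqrt (m / l)) := by
  obtain ⟨K, hK, hT⟩ := hX.TT_le h h1 h2
  obtain ⟨A, hA, hA'⟩ := h.sum_gt (p + 1) h2
  set δ := ((p + 1 : ℕ) * β - 1) / 2 with hδ
  have hδ0 : 0 < δ := by rw [hδ]; linarith
  set Q : ℝ := (p + 1).factorial * A with hQ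
  refine ⟨4 * (p + 1) * K / c + Q / c, δ, by positivity, hδ0, fun t ε hε m l hm hml => ?_⟩
  have hm0 : (0 : ℝ) < m := by exact_mod_cast hm
  have hl1 : 1 ≤ l := hm.trans hml
  have hl0 : (0 : ℝ) < l := by exact_mod_cast hl1
  have pos : ∀ n : ℕ, 1 ≤ n → 0 < CC ρ p n n := fun n hn =>
    lt_of_lt_of_le (by have : (0:ℝ) < n := by exact_mod_cast hn
                       positivity) (hlow n)
  have inv : ∀ n : ℕ, 1 ≤ n → (Real.sqrt (CC ρ p n n))⁻¹ ≤ (Real.sqrt c * Real.sqrt n)⁻¹ := by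
    intro n hn
    have hn0 : (0:ℝ) < n := by exact_mod_cast hn
    rw [← Real.sqrt_mul hc.le]
    exact inv_anti₀ (Real.sqrt_pos.2 (by positivity)) (Real.sqrt_le_sqrt (hlow n))
  set α := (Real.sqrt (CC ρ p m m))⁻¹ with hα
  set b := (Real.sqrt (CC ρ p l l))⁻¹ with hb
  have hα0 : 0 ≤ α := by positivity
  have hb0 : 0 ≤ b := by positivity
  have hα1 : α ^ 2 * CC ρ p m m = 1 := by
    rw [hα, inv_pow, Real.sq_sqrt (pos m hm).le, inv_mul_cancel₀ (pos m hm).ne']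
  have hb1 : b ^ 2 * CC ρ p l l = 1 := by
    rw [hb, inv_pow, Real.sq_sqrt (pos l hl1).le, inv_mul_cancel₀ (pos l hl1).ne']
  have hα2 := inv m hm
  have hb2 := inv l hl1
  rw [← hα] at hα2
  rw [← hb] at hb2
  have e1 : ∀ ω, GG ρ p m (fun j => X j ω) + ε * GG ρ p l (fun j => X j ω) =
      FF p l (wt α (ε * b) m l) (fun j => X j ω) := by
    intro ω
    rw [FF_split p _ _ hml le_rfl]
    unfold GG
    rw [hα, hb]; ring
  have hεs : |ε| ≤ 1 := by rcases hε with rfl | rfl <;> simp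
  have main := hX.char_bound p l (wt α (ε * b) m l) t (hX.VV_nonneg _ _ _)
  simp only [e1]
  set v := VV ρ p l (wt α (ε * b) m l) with hv
  have hv0 : 0 ≤ v := hX.VV_nonneg _ _ _
  have sl := Real.sqrt_pos.2 hl0
  have sm := Real.sqrt_pos.2 hm0
  have sc := Real.sqrt_pos.2 hc
  have sq1 : Real.sqrt c * Real.sqrt c = c := Real.mul_self_sqrt hc.le
  have sq2 : Real.sqrt m * Real.sqrt m = m := Real.mul_self_sqrt hm0.le
  have sq3 : Real.sqrt l * Real.sqrt l = l := Real.mul_self_sqrt hl0.le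
  have hmlr : (m : ℝ) ≤ l := by exact_mod_cast hml
  have hpw : (l : ℝ) ^ (-δ) ≤ (m : ℝ) ^ (-δ) :=
    Real.rpow_le_rpow_of_nonpos hm0 hmlr (by linarith)
  have vb : |v - (1 + ε ^ 2)| ≤ 2 * (Q / c * Real.sqrt (m / l)) := by
    have ev : v - (1 + ε ^ 2) = α * (ε * b) * CC ρ p m l + α * (ε * b) * CC ρ p l m := by
      rw [hv, VV_split p _ _ hml le_rfl]
      linear_combination hα1 + ε ^ 2 * hb1
    obtain ⟨c1, c2⟩ := hX.CC_abs p hA' m l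
    have c3 : |α * (ε * b)| ≤ (Real.sqrt c * Real.sqrt m)⁻¹ * (Real.sqrt c * Real.sqrt l)⁻¹ := by
      rw [abs_mul, abs_mul, abs_of_nonneg hα0, abs_of_nonneg hb0]
      have : |ε| * b ≤ b := by nlinarith
      gcongr
      exact this.trans hb2
    have c4 : (Real.sqrt c * Real.sqrt m)⁻¹ * (Real.sqrt c * Real.sqrt l)⁻¹ * (Q * m) =
        Q / c * Real.sqrt (m / l) := by
      rw [Real.sqrt_div hm0.le]
      field_simp
      rw [Real.sq_sqrt hc.le, Real.sq_sqrt hm0.le]; ring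
    rw [ev]
    refine (abs_add_le _ _).trans ?_
    rw [abs_mul, abs_mul _ (CC ρ p l m)]
    have d1 := mul_le_mul c3 c1 (abs_nonneg _) (by positivity)
    have d2 := mul_le_mul c3 c2 (abs_nonneg _) (by positivity)
    rw [← hQ, c4] at d1 d2
    linarith
  have rb : ∫ ω, |RR ρ p l (wt α (ε * b) m l) (fun j => X j ω)| ∂μ ≤
      4 * (p + 1) * K / c * (m : ℝ) ^ (-δ) := by
    refine (hX.RR_abs p α (ε * b) hml le_rfl).trans ?_
    have hεb : |ε * b| ≤ (Real.sqrt c * Real.sqrt l)⁻¹ := by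
      rw [abs_mul, abs_of_nonneg hb0]
      have : |ε| * b ≤ b := by nlinarith
      exact this.trans hb2
    have haa : |α| ≤ (Real.sqrt c * Real.sqrt m)⁻¹ := by rwa [abs_of_nonneg hα0]
    have t1 : α ^ 2 * (∫ ω, |TT ρ p m m (fun j => X j ω)| ∂μ) ≤ K / c * (m : ℝ) ^ (-δ) := by
      calc _ ≤ ((Real.sqrt c * Real.sqrt m)⁻¹) ^ 2 *
            (K * Real.sqrt m * Real.sqrt m * (m : ℝ) ^ (-δ)) := by
            gcongr
            exact hT m m hm
        _ = _ := by field_simp; rw [Real.sq_sqrt hc.le]; ring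
    have t2 : |α| * |ε * b| * (∫ ω, |TT ρ p m l (fun j => X j ω)| ∂μ) ≤ K / c * (m : ℝ) ^ (-δ) := by
      calc _ ≤ (Real.sqrt c * Real.sqrt m)⁻¹ * (Real.sqrt c * Real.sqrt l)⁻¹ *
            (K * Real.sqrt m * Real.sqrt l * (m : ℝ) ^ (-δ)) := by
            gcongr
            refine (hT m l hl1).trans ?_
            gcongr
        _ = _ := by field_simp; rw [Real.sq_sqrt hc.le]; ring
    have t3 : |α| * |ε * b| * (∫ ω, |TT ρ p l m (fun j => X j ω)| ∂μ) ≤ K / c * (m : ℝ) ^ (-δ) := by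
      calc _ ≤ (Real.sqrt c * Real.sqrt m)⁻¹ * (Real.sqrt c * Real.sqrt l)⁻¹ *
            (K * Real.sqrt l * Real.sqrt m * (m : ℝ) ^ (-δ)) := by
            gcongr
            exact hT l m hm
        _ = _ := by field_simp; rw [Real.sq_sqrt hc.le]; ring
    have t4 : (ε * b) ^ 2 * (∫ ω, |TT ρ p l l (fun j => X j ω)| ∂μ) ≤ K / c * (m : ℝ) ^ (-δ) := by
      rw [← sq_abs]
      calc _ ≤ ((Real.sqrt c * Real.sqrt l)⁻¹) ^ 2 *
            (K * Real.sqrt l * Real.sqrt l * (m : ℝ) ^ (-δ)) := by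
            gcongr
            refine (hT l l hl1).trans ?_
            gcongr
        _ = _ := by field_simp; rw [Real.sq_sqrt hc.le]; ring
    calc _ ≤ (p + 1) * (K / c * (m : ℝ) ^ (-δ) + K / c * (m : ℝ) ^ (-δ) + K / c * (m : ℝ) ^ (-δ)
          + K / c * (m : ℝ) ^ (-δ)) := by gcongr
      _ = _ := by ring
  have ex : ‖cexp (-(v * t ^ 2 / 2 : ℝ)) - cexp (-((1 + ε ^ 2) * t ^ 2 / 2 : ℝ))‖ ≤
      t ^ 2 / 2 * |v - (1 + ε ^ 2)| := by
    rw [← ofReal_neg, ← ofReal_neg, ← ofReal_exp, ← ofReal_exp, ← ofReal_sub, norm_real,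
      Real.norm_eq_abs]
    have lip : ∀ x y : ℝ, x ≤ 0 → y ≤ x → |Real.exp x - Real.exp y| ≤ |x - y| := by
      intro x y hx hy
      have e0 : Real.exp y = Real.exp x * Real.exp (y - x) := by rw [← Real.exp_add]; ring_nf
      have e1 := Real.add_one_le_exp (y - x)
      have e2 := Real.exp_le_one_iff.2 hx
      have e3 := Real.exp_pos x
      have e4 := Real.exp_le_one_iff.2 (by linarith : y - x ≤ 0)
      rw [abs_of_nonneg (by linarith : 0 ≤ x - y), abs_of_nonneg, e0]
      · nlinarith
      · rw [e0]; nlinarith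
    have key : ∀ x y : ℝ, x ≤ 0 → y ≤ 0 → |Real.exp x - Real.exp y| ≤ |x - y| := by
      intro x y hx hy
      rcases le_total y x with hxy | hxy
      · exact lip x y hx hxy
      · rw [abs_sub_comm, abs_sub_comm x]; exact lip y x hy hxy
    refine (key _ _ ?_ ?_).trans (le_of_eq ?_)
    · have : 0 ≤ v * t ^ 2 / 2 := by positivity
      linarith
    · have : 0 ≤ (1 + ε ^ 2) * t ^ 2 / 2 := by positivity
      linarith
    · rw [show -(v * t ^ 2 / 2) - -((1 + ε ^ 2) * t ^ 2 / 2) = (t ^ 2 / 2) * (-(v - (1 + ε ^ 2)))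
        by ring, abs_mul, abs_neg, abs_of_nonneg (by positivity : 0 ≤ t ^ 2 / 2)]
  have tri := norm_sub_le_norm_sub_add_norm_sub
    (∫ ω, cexp (t * FF p l (wt α (ε * b) m l) (fun j => X j ω) * I) ∂μ)
    (cexp (-(v * t ^ 2 / 2 : ℝ))) (cexp (-((1 + ε ^ 2) * t ^ 2 / 2 : ℝ)))
  refine tri.trans ?_
  have f1 := main.trans (mul_le_mul_of_nonneg_left rb (sq_nonneg t))
  have f2 := ex.trans (mul_le_mul_of_nonneg_left vb (by positivity : 0 ≤ t ^ 2 / 2))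
  refine (add_le_add f1 f2).trans ?_
  have g1 : 0 ≤ 4 * (p + 1) * K / c * t ^ 2 * Real.sqrt (m / l) := by positivity
  have g2 : 0 ≤ Q / c * t ^ 2 * (m : ℝ) ^ (-δ) := by positivity
  linarith

end
end ASCLT

namespace ASCLT

section
variable {Ω : Type*} {mΩ : MeasurableSpace Ω} {μ : Measure Ω} [IsProbabilityMeasure μ]

/-- log-weighted sums -/
noncomputable def SS (a : ℕ → ℂ) (n : ℕ) : ℂ := ∑ k ∈ Finset.Icc 1 n, (k : ℝ)⁻¹ • a k

theorem SS_succ (a : ℕ → ℂ) (n : ℕ) : SS a (n + 1) = SS a n + ((n + 1 : ℕ) : ℝ)⁻¹ • a (n + 1) := by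
  unfold SS; rw [Finset.sum_Icc_succ_top (by omega)]

/-- harmonic numbers -/
noncomputable def HH (n : ℕ) : ℝ := ∑ k ∈ Finset.Icc 1 n, (k : ℝ)⁻¹

theorem HH_succ (n : ℕ) : HH (n + 1) = HH n + ((n + 1 : ℕ) : ℝ)⁻¹ := by
  unfold HH; rw [Finset.sum_Icc_succ_top (by omega)]

theorem inv_le_log (n : ℕ) (hn : 1 ≤ n) : ((n + 1 : ℕ) : ℝ)⁻¹ ≤ Real.log (n + 1 : ℕ) - Real.log n := by
  have hn0 : (0 : ℝ) < n := by exact_mod_cast hn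
  have := Real.one_sub_inv_le_log_of_pos (x := ((n + 1 : ℕ) : ℝ) / n) (by positivity)
  rw [Real.log_div (by positivity) hn0.ne'] at this
  refine le_trans (le_of_eq ?_) this
  push_cast
  field_simp; ring

theorem HH_le (n : ℕ) (hn : 1 ≤ n) : HH n ≤ 1 + Real.log n := by
  induction n, hn using Nat.le_induction with
  | base => simp [HH]
  | succ n hn ih =>
    rw [HH_succ]; have := inv_le_log n hn; linarith

theorem log_le_HH (n : ℕ) : Real.log (n + 1 : ℕ) ≤ HH n := by
  induction n with
  | zero => simp [HH]
  | succ n ih =>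
    rw [HH_succ]
    have h0 : (0 : ℝ) < (n + 1 : ℕ) := by positivity
    have := Real.log_le_sub_one_of_pos (x := ((n + 1 + 1 : ℕ) : ℝ) / (n + 1 : ℕ)) (by positivity)
    rw [Real.log_div (by positivity) h0.ne'] at this
    have e : ((n + 1 + 1 : ℕ) : ℝ) / (n + 1 : ℕ) - 1 = ((n + 1 : ℕ) : ℝ)⁻¹ := by
      push_cast; field_simp; ring
    linarith

theorem SS_gap (a : ℕ → ℂ) (C : ℝ) (ha : ∀ k, ‖a k‖ ≤ C) (m n : ℕ) (hm : 1 ≤ m) (hmn : m ≤ n) :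
    ‖SS a n‖ ≤ ‖SS a m‖ + C * (Real.log n - Real.log m) := by
  have hC : 0 ≤ C := (norm_nonneg _).trans (ha 0)
  induction n, hmn using Nat.le_induction with
  | base => simp
  | succ n hn ih =>
    rw [SS_succ]
    refine (norm_add_le _ _).trans ?_
    rw [norm_smul, Real.norm_of_nonneg (by positivity)]
    have h1 := inv_le_log n (hm.trans hn)
    have h2 : ((n + 1 : ℕ) : ℝ)⁻¹ * ‖a (n + 1)‖ ≤ (Real.log (n + 1 : ℕ) - Real.log n) * C := by
      have := ha (n + 1)
      gcongr
      exact le_trans (by positivity) h1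
    linarith

theorem tendsto_J : Tendsto (fun n => Nat.sqrt (Nat.log 2 n)) atTop atTop := by
  refine tendsto_atTop.2 fun b => ?_
  filter_upwards [eventually_ge_atTop (2 ^ (b ^ 2))] with n hn
  exact Nat.le_sqrt'.2 (Nat.le_log_of_pow_le (by norm_num) hn)

/-- subsequence filling -/
theorem SS_fill (a : ℕ → ℂ) (C : ℝ) (ha : ∀ k, ‖a k‖ ≤ C)
    (h : Tendsto (fun j : ℕ => (Real.log (2 ^ (j ^ 2) : ℕ))⁻¹ * ‖SS a (2 ^ (j ^ 2))‖) atTop (𝓝 0)) :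
    Tendsto (fun n : ℕ => (Real.log n)⁻¹ • SS a n) atTop (𝓝 0) := by
  have hC : 0 ≤ C := (norm_nonneg _).trans (ha 0)
  rw [tendsto_zero_iff_norm_tendsto_zero]
  have h3 : Tendsto (fun j : ℕ => C * (3 * (j : ℝ)⁻¹)) atTop (𝓝 0) := by
    have := (tendsto_inv_atTop_nhds_zero_nat (𝕜 := ℝ)).const_mul (C * 3)
    simpa [mul_assoc] using this
  have h2 := (h.add h3).comp tendsto_J
  rw [add_zero] at h2
  refine squeeze_zero' (Eventually.of_forall fun _ => norm_nonneg _) ?_ h2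
  filter_upwards [tendsto_J.eventually_ge_atTop 1, eventually_ge_atTop 1] with n hJ hn
  simp only [Function.comp]
  set J := Nat.sqrt (Nat.log 2 n) with hJd
  have a1 : 2 ^ (J ^ 2) ≤ n := by
    refine (Nat.pow_le_pow_right (by norm_num) ?_).trans (Nat.pow_log_le_self 2 (by omega))
    exact Nat.sqrt_le' _
  have a2 : n < 2 ^ ((J + 1) ^ 2) := by
    refine (Nat.lt_pow_succ_log_self (b := 2) (by norm_num) n).trans_le ?_
    exact Nat.pow_le_pow_right (by norm_num) (Nat.lt_succ_sqrt' _)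
  have l2 : 0 < Real.log 2 := Real.log_pos (by norm_num)
  have hJ0 : (1 : ℝ) ≤ J := by exact_mod_cast hJ
  have b1 : Real.log (2 ^ (J ^ 2) : ℕ) = J ^ 2 * Real.log 2 := by
    push_cast; rw [Real.log_pow]; push_cast; ring
  have b2 : Real.log n ≤ (J + 1) ^ 2 * Real.log 2 := by
    have : Real.log n ≤ Real.log (2 ^ ((J + 1) ^ 2) : ℕ) :=
      Real.log_le_log (by exact_mod_cast hn) (by exact_mod_cast a2.le)
    refine this.trans (le_of_eq ?_)
    push_cast; rw [Real.log_pow]; push_cast; ring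
  have b3 : Real.log (2 ^ (J ^ 2) : ℕ) ≤ Real.log n :=
    Real.log_le_log (by positivity) (by exact_mod_cast a1)
  have b4 : 0 < Real.log (2 ^ (J ^ 2) : ℕ) := by rw [b1]; positivity
  have g := SS_gap a C ha _ n Nat.one_le_two_pow a1
  rw [norm_smul, norm_inv, Real.norm_of_nonneg (b4.le.trans b3)]
  calc (Real.log n)⁻¹ * ‖SS a n‖ ≤ (Real.log (2 ^ (J ^ 2) : ℕ))⁻¹ *
        (‖SS a (2 ^ (J ^ 2))‖ + C * (Real.log n - Real.log (2 ^ (J ^ 2) : ℕ))) := by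
        gcongr
    _ = (Real.log (2 ^ (J ^ 2) : ℕ))⁻¹ * ‖SS a (2 ^ (J ^ 2))‖ +
        C * ((Real.log (2 ^ (J ^ 2) : ℕ))⁻¹ * (Real.log n - Real.log (2 ^ (J ^ 2) : ℕ))) := by ring
    _ ≤ _ := by
        refine add_le_add_right (mul_le_mul_of_nonneg_left ?_ hC) _
        rw [b1, inv_mul_le_iff₀ (by positivity)]
        have : Real.log n - J ^ 2 * Real.log 2 ≤ (2 * J + 1) * Real.log 2 := by linarith
        refine this.trans ?_
        have : (J : ℝ) ^ 2 * Real.log 2 * (3 * (J : ℝ)⁻¹) = 3 * J * Real.log 2 := by field_simp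
        rw [this]
        gcongr
        linarith

theorem SS_L2 (Y : ℕ → Ω → ℂ) (hm : ∀ k, Measurable (Y k)) (hb : ∀ k ω, ‖Y k ω‖ ≤ 2)
    (K δ : ℝ) (hK : 0 ≤ K) (hδ : 0 < δ)
    (hcov : ∀ k l : ℕ, 1 ≤ k → k ≤ l →
      ∫ ω, inner ℝ (Y k ω) (Y l ω) ∂μ ≤ K * ((k : ℝ) ^ (-δ) + Real.sqrt (k / l))) :
    ∃ C : ℝ, 0 ≤ C ∧ ∀ n : ℕ, ∫ ω, ‖SS (fun k => Y k ω) n‖ ^ 2 ∂μ ≤ C * HH n := by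
  obtain ⟨A, hA, hA'⟩ := sum_rpow_bdd (γ := 1 + δ) (by linarith)
  have hY : ∀ k, AllLp (Y k) μ := fun k =>
    AllLp.ofBound (hm k).aestronglyMeasurable 2 (hb k)
  have hS : ∀ n, AllLp (fun ω => SS (fun k => Y k ω) n) μ := by
    intro n
    unfold SS
    exact AllLp.sum _ fun k _ => (AllLp.const _).smul (hY k)
  have mS : ∀ n, Measurable (fun ω => SS (fun k => Y k ω) n) := by
    intro n; unfold SS; fun_prop
  have shift : ∀ (f : ℕ → ℝ) n, ∑ k ∈ Finset.Icc 1 n, f k = ∑ d ∈ Finset.range n, f (1 + d) := by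
    intro f n
    have := Finset.sum_Ico_eq_sum_range f 1 (n + 1)
    rw [Nat.add_sub_cancel] at this
    rw [← this]
    rfl
  refine ⟨2 * (K * (A + 2)) + 4, by positivity, fun n => ?_⟩
  induction n with
  | zero => simp [SS, HH]
  | succ n ih =>
    have iY : ∀ k l, Integrable (fun ω => inner ℝ (Y k ω) (Y l ω)) μ := fun k l =>
      (by
      refine (AllLp.ofBound (C := 4) ((hm k).inner (hm l)).aestronglyMeasurable fun ω => ?_).integrable
      refine (norm_inner_le_norm _ _).trans ?_
      have := hb k ω
      have := hb l ω
      nlinarith [norm_nonneg (Y k ω), norm_nonneg (Y l ω)])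
    set N : ℝ := ((n + 1 : ℕ) : ℝ) with hN
    have hN0 : 0 < N := by positivity
    have e : ∀ ω, ‖SS (fun k => Y k ω) (n + 1)‖ ^ 2 = ‖SS (fun k => Y k ω) n‖ ^ 2 +
        (2 * N⁻¹ * ∑ k ∈ Finset.Icc 1 n, (k : ℝ)⁻¹ * inner ℝ (Y k ω) (Y (n + 1) ω)
          + (N⁻¹) ^ 2 * ‖Y (n + 1) ω‖ ^ 2) := by
      intro ω
      rw [SS_succ, norm_add_sq_real, real_inner_smul_right, norm_smul,
        Real.norm_of_nonneg (by positivity)]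
      conv_lhs => enter [1, 2, 2, 2]; unfold SS
      rw [sum_inner]
      simp only [real_inner_smul_left]
      ring
    have i1 : Integrable (fun ω => ‖SS (fun k => Y k ω) n‖ ^ 2) μ :=
      (hS n).memLp_two.integrable_norm_pow (by norm_num)
    have i2 : Integrable (fun ω => ∑ k ∈ Finset.Icc 1 n,
        (k : ℝ)⁻¹ * inner ℝ (Y k ω) (Y (n + 1) ω)) μ :=
      integrable_finsetSum _ fun k _ => (iY k (n + 1)).const_mul _
    have i3 : Integrable (fun ω => ‖Y (n + 1) ω‖ ^ 2) μ :=
      (hY _).memLp_two.integrable_norm_pow (by norm_num)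
    have i2' := i2.const_mul (2 * N⁻¹)
    have i3' := i3.const_mul ((N⁻¹) ^ 2)
    simp only [e]
    rw [integral_add i1 (show Integrable (fun ω => 2 * N⁻¹ * ∑ k ∈ Finset.Icc 1 n,
        (k : ℝ)⁻¹ * inner ℝ (Y k ω) (Y (n + 1) ω) + (N⁻¹) ^ 2 * ‖Y (n + 1) ω‖ ^ 2) μ
        from i2'.add i3'), integral_add i2' i3', integral_const_mul,
      integral_const_mul, integral_finsetSum _ fun k _ => (iY k (n + 1)).const_mul _, HH_succ]
    simp only [integral_const_mul]
    have b3 : ∫ ω, ‖Y (n + 1) ω‖ ^ 2 ∂μ ≤ 4 := by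
      calc _ ≤ ∫ ω, (4 : ℝ) ∂μ := by
            refine integral_mono i3 (integrable_const _) fun ω => ?_
            have := hb (n + 1) ω
            have := norm_nonneg (Y (n + 1) ω)
            simp only
            nlinarith
        _ = 4 := by simp
    have b2 : ∑ k ∈ Finset.Icc 1 n, (k : ℝ)⁻¹ * ∫ ω, inner ℝ (Y k ω) (Y (n + 1) ω) ∂μ ≤
        K * (A + 2) := by
      calc _ ≤ ∑ k ∈ Finset.Icc 1 n, K * ((k : ℝ) ^ (-(1 + δ)) +
            (Real.sqrt N)⁻¹ * (k : ℝ) ^ (-(1 / 2) : ℝ)) := by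
            refine Finset.sum_le_sum fun k hk => ?_
            have hk' := Finset.mem_Icc.1 hk
            have hk0 : (0 : ℝ) < k := by exact_mod_cast hk'.1
            calc _ ≤ (k : ℝ)⁻¹ * (K * ((k : ℝ) ^ (-δ) + Real.sqrt (k / N))) := by
                  gcongr
                  exact hcov k (n + 1) hk'.1 (by omega)
              _ = _ := by
                  rw [neg_add, Real.rpow_add hk0, Real.rpow_neg_one, Real.sqrt_div hk0.le,
                    Real.rpow_neg hk0.le (1 / 2), ← Real.sqrt_eq_rpow]
                  have := Real.mul_self_sqrt hk0.le
                  have sk := Real.sqrt_pos.2 hk0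
                  have : (k : ℝ)⁻¹ * Real.sqrt k = (Real.sqrt k)⁻¹ := by
                    field_simp; rw [Real.sq_sqrt hk0.le]
                  rw [div_eq_mul_inv (Real.sqrt k)]
                  linear_combination K * (Real.sqrt N)⁻¹ * this
        _ = K * ((∑ k ∈ Finset.Icc 1 n, (k : ℝ) ^ (-(1 + δ))) +
            (Real.sqrt N)⁻¹ * ∑ k ∈ Finset.Icc 1 n, (k : ℝ) ^ (-(1 / 2) : ℝ)) := by
            rw [← Finset.mul_sum, Finset.sum_add_distrib, ← Finset.mul_sum]
        _ ≤ K * (A + (Real.sqrt N)⁻¹ * (2 * Real.sqrt N)) := by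
            gcongr
            · rw [shift (fun k => (k : ℝ) ^ (-(1 + δ)))]
              push_cast
              exact hA' n
            · rw [shift (fun k => (k : ℝ) ^ (-(1 / 2) : ℝ))]
              push_cast
              refine (sum_rpow_le (by norm_num) (by norm_num) n).trans ?_
              rw [Real.sqrt_eq_rpow]
              norm_num
              apply Real.rpow_le_rpow <;> simp [hN]
        _ = K * (A + 2) := by
            have := Real.sqrt_pos.2 hN0
            field_simp
    have n1 : N⁻¹ ≤ 1 := by
      apply inv_le_one_of_one_le₀; simp [hN]
    have n0 : 0 < N⁻¹ := by positivity
    have c1 : 2 * N⁻¹ * (∑ k ∈ Finset.Icc 1 n, (k : ℝ)⁻¹ * ∫ ω, inner ℝ (Y k ω) (Y (n + 1) ω) ∂μ)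
      ≤ 2 * N⁻¹ * (K * (A + 2)) := by gcongr
    have c2 : (N⁻¹) ^ 2 * ∫ ω, ‖Y (n + 1) ω‖ ^ 2 ∂μ ≤ N⁻¹ * 4 := by
      gcongr
      · nlinarith
    linarith

theorem SS_ae (Y : ℕ → Ω → ℂ) (hm : ∀ k, Measurable (Y k)) (hb : ∀ k ω, ‖Y k ω‖ ≤ 2)
    (K δ : ℝ) (hK : 0 ≤ K) (hδ : 0 < δ)
    (hcov : ∀ k l : ℕ, 1 ≤ k → k ≤ l →
      ∫ ω, inner ℝ (Y k ω) (Y l ω) ∂μ ≤ K * ((k : ℝ) ^ (-δ) + Real.sqrt (k / l))) :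
    ∀ᵐ ω ∂μ, Tendsto (fun n : ℕ => (Real.log n)⁻¹ • SS (fun k => Y k ω) n) atTop (𝓝 0) := by
  obtain ⟨C, hC, h2⟩ := SS_L2 Y hm hb K δ hK hδ hcov
  have hS : ∀ n, AllLp (fun ω => SS (fun k => Y k ω) n) μ := by
    intro n
    unfold SS
    exact AllLp.sum _ fun k _ => (AllLp.const _).smul
      (AllLp.ofBound (hm k).aestronglyMeasurable 2 (hb k))
  have mS : ∀ n, Measurable (fun ω => SS (fun k => Y k ω) n) := by
    intro n; unfold SS; fun_prop
  set Z : ℕ → Ω → ℝ := fun j ω =>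
    ((Real.log (2 ^ (j ^ 2) : ℕ))⁻¹ * ‖SS (fun k => Y k ω) (2 ^ (j ^ 2))‖) ^ 2 with hZ
  have l2 : 0 < Real.log 2 := Real.log_pos (by norm_num)
  have hb1 : ∀ j : ℕ, Real.log (2 ^ (j ^ 2) : ℕ) = j ^ 2 * Real.log 2 := by
    intro j; push_cast; rw [Real.log_pow]; push_cast; ring
  have iZ : ∀ j, Integrable (Z j) μ := by
    intro j
    have : Integrable (fun ω => ‖SS (fun k => Y k ω) (2 ^ (j ^ 2))‖ ^ 2) μ :=
      (hS _).memLp_two.integrable_norm_pow (by norm_num)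
    simp only [hZ, mul_pow]
    exact this.const_mul _
  set M : ℝ := C * (1 + Real.log 2) / (Real.log 2) ^ 2 with hM
  have hM0 : 0 ≤ M := by positivity
  have eZ : ∀ j, ∫ ω, Z j ω ∂μ ≤ M * (1 / (j : ℝ) ^ 2) := by
    intro j
    rcases Nat.eq_zero_or_pos j with rfl | hj
    · simp [hZ]
    simp only [hZ, mul_pow]
    rw [integral_const_mul, hb1]
    have hj1 : (1 : ℝ) ≤ j := by exact_mod_cast hj
    have hh := HH_le (2 ^ (j ^ 2)) Nat.one_le_two_pow
    rw [hb1] at hh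
    calc _ ≤ (((j : ℝ) ^ 2 * Real.log 2)⁻¹) ^ 2 * (C * ((j : ℝ) ^ 2 * (1 + Real.log 2))) := by
          gcongr
          refine (h2 _).trans ?_
          gcongr
          nlinarith
      _ = _ := by rw [hM]; field_simp
  have sZ : Summable (fun j => ∫ ω, Z j ω ∂μ) := by
    refine Summable.of_nonneg_of_le (fun j => integral_nonneg fun ω => sq_nonneg _) eZ ?_
    exact (Real.summable_one_div_nat_pow.2 (by norm_num)).mul_left _
  have Z0 : ∀ j ω, 0 ≤ Z j ω := fun j ω => sq_nonneg _
  have fin : ∑' j, ∫⁻ ω, ENNReal.ofReal (Z j ω) ∂μ ≠ ⊤ := by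
    simp_rw [← ofReal_integral_eq_lintegral_ofReal (iZ _) (ae_of_all _ (Z0 _))]
    exact sZ.tsum_ofReal_ne_top
  have mZ : ∀ j, Measurable (fun ω => ENNReal.ofReal (Z j ω)) := by
    intro j
    have := mS (2 ^ (j ^ 2))
    simp only [hZ]; fun_prop
  rw [← lintegral_tsum fun j => (mZ j).aemeasurable] at fin
  filter_upwards [ae_lt_top (Measurable.tsum mZ) fin] with ω hω
  refine SS_fill _ 2 (fun k => hb k ω) ?_
  have t0 := ENNReal.tendsto_atTop_zero_of_tsum_ne_top hω.ne
  have t1 := (ENNReal.tendsto_toReal ENNReal.zero_ne_top).comp t0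
  simp only [Function.comp_def, ENNReal.toReal_ofReal (Z0 _ _), ENNReal.toReal_zero] at t1
  have t2 := t1.sqrt
  simp only [hZ, Real.sqrt_zero] at t2
  refine t2.congr fun j => ?_
  rw [Real.sqrt_sq]
  have : 0 ≤ Real.log (2 ^ (j ^ 2) : ℕ) := by rw [hb1]; positivity
  positivity

end
end ASCLT

namespace ASCLT

section
variable {Ω : Type*} {mΩ : MeasurableSpace Ω} {μ : Measure Ω} [IsProbabilityMeasure μ]
  {X : ℕ → Ω → ℝ} {ρ : ℕ → ℕ → ℝ}

@[fun_prop]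
theorem measurable_GG (p n : ℕ) : Measurable (GG ρ p n) := by
  unfold GG WW; fun_prop

open Complex ComplexConjugate in
theorem StdGP.cov_exp (hX : StdGP X ρ μ) {p : ℕ} {D β c : ℝ} (h : Decay ρ D β)
    (h1 : p * β < 1) (h2 : 1 < (p + 1 : ℕ) * β) (hc : 0 < c)
    (hlow : ∀ n : ℕ, c * n ≤ CC ρ p n n) (t : ℝ) :
    ∀ᵐ ω ∂μ, Tendsto (fun n : ℕ => (Real.log n)⁻¹ • SS (fun k =>
      cexp (t * GG ρ p k (fun j => X j ω) * I) - cexp (-(t ^ 2 / 2 : ℝ))) n) atTop (𝓝 0) := by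
  obtain ⟨K, δ, hK, hδ, hch⟩ := hX.char_two h h1 h2 hc hlow
  have mX := hX.meas
  have mX' : Measurable (fun ω => (fun j => X j ω)) := measurable_pi_iff.2 mX
  set G : ℕ → Ω → ℝ := fun k ω => GG ρ p k (fun j => X j ω) with hG
  have mG : ∀ k, Measurable (G k) := fun k => (measurable_GG p k).comp mX'
  have nc : ‖cexp (-(t ^ 2 / 2 : ℝ))‖ ≤ 1 := by
    rw [← ofReal_neg, norm_exp_ofReal, Real.exp_le_one_iff]
    have := sq_nonneg t
    linarith
  have ne : ∀ (s x : ℝ), ‖cexp (s * x * I)‖ = 1 := by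
    intro s x; rw [← ofReal_mul, norm_exp_ofReal_mul_I]
  refine SS_ae (fun k ω => cexp (t * G k ω * I) - cexp (-(t ^ 2 / 2 : ℝ)))
    (fun k => by fun_prop) (fun k ω => ?_) (3 * (K * t ^ 2)) δ (by positivity) hδ ?_
  · refine (norm_sub_le _ _).trans ?_
    rw [ne]; linarith
  intro k l hk hkl
  have hk0 : (0 : ℝ) < k := by exact_mod_cast hk
  have hl1 : 1 ≤ l := hk.trans hkl
  have hl0 : (0 : ℝ) < l := by exact_mod_cast hl1
  have hkl' : (k : ℝ) ≤ l := by exact_mod_cast hkl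
  set d : ℂ := cexp (-(t ^ 2 / 2 : ℝ)) with hd
  have d2 : d * d = cexp (-((1 + (-1) ^ 2) * t ^ 2 / 2 : ℝ)) := by
    rw [hd, ← Complex.exp_add]; congr 1; push_cast; ring
  have cd : conj d = d := by
    rw [hd, ← ofReal_neg, ← ofReal_exp, conj_ofReal]
  set R : ℝ := (k : ℝ) ^ (-δ) + Real.sqrt (k / l) with hR
  have b1 := hch t (-1) (Or.inr rfl) k l hk hkl
  have b2 := hch t 0 (Or.inl rfl) k l hk hkl
  have b3 := hch (-t) 0 (Or.inl rfl) l (l * l) hl1 (Nat.le_mul_self l)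
  rw [← hR] at b1 b2
  have b3' : K * (-t) ^ 2 * ((l : ℝ) ^ (-δ) + Real.sqrt (l / (l * l : ℕ))) ≤ K * t ^ 2 * R := by
    rw [neg_sq]
    gcongr K * t ^ 2 * ?_
    rw [hR]
    gcongr ?_ + ?_
    · exact Real.rpow_le_rpow_of_nonpos hk0 hkl' (by linarith)
    · apply Real.sqrt_le_sqrt
      push_cast
      have : (l : ℝ) / (l * l) = 1 / l := by field_simp
      rw [this]
      gcongr
      exact_mod_cast hk
  replace b3 := b3.trans b3'
  simp only [zero_mul, add_zero, ne_eq, OfNat.ofNat_ne_zero, not_false_eq_true, zero_pow,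
    one_mul, neg_sq, ← hd] at b2 b3
  rw [← d2] at b1
  have int1 : ∀ f : Ω → ℂ, Measurable f → (∀ ω, ‖f ω‖ ≤ 1) → Integrable f μ := fun f hf hb =>
    (AllLp.ofBound hf.aestronglyMeasurable 1 hb).integrable
  have i1 : Integrable (fun ω => cexp (t * (G k ω + -1 * G l ω : ℝ) * I)) μ :=
    int1 _ (by fun_prop) fun ω => (ne _ _).le
  have i2 : Integrable (fun ω => cexp (t * G k ω * I)) μ :=
    int1 _ (by fun_prop) fun ω => (ne _ _).le
  have i3 : Integrable (fun ω => cexp ((-t : ℝ) * G l ω * I)) μ :=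
    int1 _ (by fun_prop) fun ω => (ne _ _).le
  have e : ∀ ω, (inner ℝ (cexp (t * G k ω * I) - d) (cexp (t * G l ω * I) - d) : ℝ) =
      Complex.re ((cexp (t * (G k ω + -1 * G l ω : ℝ) * I) - d * cexp (t * G k ω * I))
        - (d * cexp ((-t : ℝ) * G l ω * I) - d * d)) := by
    intro ω
    rw [real_inner_comm, Complex.inner]
    congr 1
    rw [map_sub, cd, ← Complex.exp_conj]
    have e1 : cexp (t * (G k ω + -1 * G l ω : ℝ) * I) =
        cexp (t * G k ω * I) * cexp ((-t : ℝ) * G l ω * I) := by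
      rw [← Complex.exp_add]; congr 1; push_cast; ring
    have e2 : conj (t * G l ω * I : ℂ) = (-t : ℝ) * G l ω * I := by
      simp
    rw [e1, e2]; ring
  have i12 : Integrable (fun ω => cexp (t * (G k ω + -1 * G l ω : ℝ) * I) -
      d * cexp (t * G k ω * I)) μ := i1.sub (i2.const_mul d)
  have i34 : Integrable (fun ω => d * cexp ((-t : ℝ) * G l ω * I) - d * d) μ :=
    (i3.const_mul d).sub (integrable_const _)
  simp only [e]
  have ir : ∀ f : Ω → ℂ, Integrable f μ → ∫ ω, (f ω).re ∂μ ≤ ‖∫ ω, f ω ∂μ‖ := by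
    intro f hf
    have := integral_re (𝕜 := ℂ) hf
    simp only [RCLike.re_eq_complex_re] at this
    rw [this]
    exact Complex.re_le_norm _
  refine (ir _ (i12.sub i34)).trans ?_
  rw [integral_sub' i12 i34, integral_sub i1 (i2.const_mul d),
    integral_sub (i3.const_mul d) (integrable_const _), integral_const_mul, integral_const_mul]
  simp only [integral_const, probReal_univ, one_smul]
  set x := ∫ ω, cexp (t * (G k ω + -1 * G l ω : ℝ) * I) ∂μ
  set y := ∫ ω, cexp (t * G k ω * I) ∂μ
  set z := ∫ ω, cexp ((-t : ℝ) * G l ω * I) ∂μ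
  have fe : x - d * y - (d * z - d * d) = (x - d * d) - d * (y - d) - d * (z - d) := by ring
  rw [fe]
  refine (norm_sub_le _ _).trans ?_
  have n1 : ‖d * (y - d)‖ ≤ K * t ^ 2 * R := by
    rw [norm_mul]
    exact (mul_le_of_le_one_left (norm_nonneg _) nc).trans b2
  have n2 : ‖d * (z - d)‖ ≤ K * t ^ 2 * R := by
    rw [norm_mul]
    exact (mul_le_of_le_one_left (norm_nonneg _) nc).trans b3
  have n3 := norm_sub_le (x - d * d) (d * (y - d))
  have n4 : ‖x - d * d‖ ≤ K * t ^ 2 * R := b1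
  linarith

end
end ASCLT

namespace ASCLT

open Complex in
theorem krein (ν : Measure ℝ) [IsProbabilityMeasure ν] (t s : ℝ) :
    ‖charFun ν t - charFun ν s‖ ≤ Real.sqrt (2 * (1 - (charFun ν (t - s)).re)) := by
  have int1 : ∀ r : ℝ, Integrable (fun x : ℝ => cexp (r * x * I)) ν := fun r =>
    (AllLp.ofBound (by fun_prop) 1 (fun x => by
      rw [← ofReal_mul, norm_exp_ofReal_mul_I])).integrable
  rw [charFun_apply_real, charFun_apply_real, charFun_apply_real, ← integral_sub (int1 t) (int1 s)]
  refine (norm_integral_le_integral_norm _).trans ?_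
  have a : AllLp (fun x : ℝ => ‖cexp (t * x * I) - cexp (s * x * I)‖) ν :=
    AllLp.ofBound (by fun_prop) 2 (fun x => by
      rw [norm_norm]
      refine (norm_sub_le _ _).trans ?_
      rw [← ofReal_mul, norm_exp_ofReal_mul_I, ← ofReal_mul, norm_exp_ofReal_mul_I]
      norm_num)
  have b := a.abs_le_sqrt
  simp only [abs_norm] at b
  refine b.trans (Real.sqrt_le_sqrt (le_of_eq ?_))
  have e : ∀ x : ℝ, ‖cexp (t * x * I) - cexp (s * x * I)‖ ^ 2 =
      2 * (1 - (cexp ((t - s : ℝ) * x * I)).re) := by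
    intro x
    rw [← ofReal_mul, ← ofReal_mul, ← ofReal_mul, ← normSq_eq_norm_sq, normSq_apply]
    simp only [sub_re, sub_im, exp_ofReal_mul_I_re, exp_ofReal_mul_I_im]
    rw [sub_mul t s x, Real.cos_sub]
    have h1 := Real.sin_sq_add_cos_sq (t * x)
    have h2 := Real.sin_sq_add_cos_sq (s * x)
    nlinarith
  simp only [e]
  have ir := integral_re (𝕜 := ℂ) (int1 (t - s))
  simp only [RCLike.re_eq_complex_re] at ir
  have ire : Integrable (fun x : ℝ => (cexp ((t - s : ℝ) * x * I)).re) ν := (int1 (t - s)).re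
  rw [integral_const_mul, integral_sub (integrable_const _) ire, ir]
  simp

theorem charFun_all (ν : ℕ → Measure ℝ) [∀ n, IsProbabilityMeasure (ν n)] (ψ : ℝ → ℂ)
    (hψ : Continuous ψ) (h0 : ψ 0 = 1)
    (h : ∀ᵐ t : ℝ, Tendsto (fun n => charFun (ν n) t) atTop (𝓝 (ψ t))) (t : ℝ) :
    Tendsto (fun n => charFun (ν n) t) atTop (𝓝 (ψ t)) := by
  rw [Metric.tendsto_atTop']
  intro ε hε
  have h' : ∀ᵐ s : ℝ, Tendsto (fun n => charFun (ν n) (t - s)) atTop (𝓝 (ψ (t - s))) :=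
    (Measure.measurePreserving_sub_left volume t).quasiMeasurePreserving.ae h
  have c1 : ∀ᶠ s in 𝓝 t, ‖ψ s - ψ t‖ < ε / 3 := by
    have : Tendsto (fun s => ‖ψ s - ψ t‖) (𝓝 t) (𝓝 ‖ψ t - ψ t‖) :=
      (Continuous.tendsto (by fun_prop) t)
    rw [sub_self, norm_zero] at this
    exact this.eventually (gt_mem_nhds (by positivity))
  have c2 : ∀ᶠ s in 𝓝 t, Real.sqrt (2 * (1 - (ψ (t - s)).re)) < ε / 3 := by
    have : Tendsto (fun s => Real.sqrt (2 * (1 - (ψ (t - s)).re))) (𝓝 t)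
        (𝓝 (Real.sqrt (2 * (1 - (ψ (t - t)).re)))) :=
      (Continuous.tendsto (by fun_prop) t)
    rw [sub_self, h0] at this
    simp only [Complex.one_re, sub_self, mul_zero, Real.sqrt_zero] at this
    exact this.eventually (gt_mem_nhds (by positivity))
  obtain ⟨U, hU, hUo, htU⟩ := eventually_nhds_iff.1 (c1.and c2)
  have hne : ∃ s ∈ U, Tendsto (fun n => charFun (ν n) s) atTop (𝓝 (ψ s)) ∧
      Tendsto (fun n => charFun (ν n) (t - s)) atTop (𝓝 (ψ (t - s))) := by
    by_contra hcon
    push Not at hcon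
    have : volume U = 0 := by
      refine measure_mono_null (fun s hs => ?_) (ae_iff.1 (h.and h'))
      exact fun hh => hcon s hs hh.1 hh.2
    exact (hUo.measure_pos volume ⟨t, htU⟩).ne' this
  obtain ⟨s, hs, s1, s2⟩ := hne
  obtain ⟨u1, u2⟩ := hU s hs
  have v1 : ∀ᶠ n in atTop, ‖charFun (ν n) s - ψ s‖ < ε / 3 := by
    have := (tendsto_iff_norm_sub_tendsto_zero.1 s1)
    exact this.eventually (gt_mem_nhds (by positivity))
  have v2 : ∀ᶠ n in atTop, Real.sqrt (2 * (1 - (charFun (ν n) (t - s)).re)) < ε / 3 := by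
    have : Tendsto (fun n => Real.sqrt (2 * (1 - (charFun (ν n) (t - s)).re))) atTop
        (𝓝 (Real.sqrt (2 * (1 - (ψ (t - s)).re)))) :=
      (Continuous.tendsto (f := fun z : ℂ => Real.sqrt (2 * (1 - z.re))) (by fun_prop) _).comp s2
    exact this.eventually (gt_mem_nhds u2)
  obtain ⟨N, hN⟩ := eventually_atTop.1 (v1.and v2)
  refine ⟨N, fun n hn => ?_⟩
  obtain ⟨w1, w2⟩ := hN n hn.le
  have w3 := krein (ν n) t s
  rw [dist_eq_norm]
  have : charFun (ν n) t - ψ t = (charFun (ν n) t - charFun (ν n) s) +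
    (charFun (ν n) s - ψ s) + (ψ s - ψ t) := by ring
  rw [this]
  refine norm_add₃_le.trans_lt ?_
  linarith

noncomputable def NN (x : ℕ → ℝ) (n : ℕ) : Measure ℝ :=
  ∑ k ∈ Finset.Icc 1 n, ENNReal.ofReal ((k : ℝ)⁻¹ / HH n) • Measure.dirac (x k)

theorem HH_nonneg (n : ℕ) : 0 ≤ HH n := Finset.sum_nonneg fun k _ => by positivity

theorem HH_pos (n : ℕ) : 0 < HH (n + 1) := by
  rw [HH_succ]; have := HH_nonneg n; positivity

theorem NN_integral {E : Type*} [NormedAddCommGroup E] [NormedSpace ℝ E] [CompleteSpace E]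
    (x : ℕ → ℝ) (n : ℕ) (f : ℝ → E) :
    ∫ y, f y ∂(NN x n) = (HH n)⁻¹ • ∑ k ∈ Finset.Icc 1 n, (k : ℝ)⁻¹ • f (x k) := by
  unfold NN
  rw [integral_finsetSum_measure, Finset.smul_sum]
  · refine Finset.sum_congr rfl fun k _ => ?_
    rw [integral_smul_measure, integral_dirac, ENNReal.toReal_ofReal, smul_smul]
    · congr 1; rw [div_eq_inv_mul]
    · have := HH_nonneg n
      positivity
  · intro k _
    refine Integrable.smul_measure ?_ (by simp)
    exact integrable_dirac (by simp)

instance (x : ℕ → ℝ) (n : ℕ) : IsProbabilityMeasure (NN x (n + 1)) := by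
  constructor
  unfold NN
  rw [Measure.finsetSum_apply]
  simp only [Measure.smul_apply, measure_univ, smul_eq_mul, mul_one]
  rw [← ENNReal.ofReal_sum_of_nonneg]
  · rw [← Finset.sum_div]
    change ENNReal.ofReal (HH (n + 1) / HH (n + 1)) = 1
    rw [div_self (HH_pos n).ne', ENNReal.ofReal_one]
  · intro k _
    have := HH_nonneg (n + 1)
    positivity

theorem SS_sub_const (a : ℕ → ℂ) (d : ℂ) (n : ℕ) :
    SS (fun k => a k - d) n = SS a n - HH n • d := by
  unfold SS HH
  simp only [smul_sub, Finset.sum_sub_distrib, Finset.sum_smul]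

theorem log_HH : Tendsto (fun n : ℕ => (Real.log n)⁻¹ * HH n) atTop (𝓝 1) := by
  have hl : Tendsto (fun n : ℕ => Real.log n) atTop atTop :=
    Real.tendsto_log_atTop.comp tendsto_natCast_atTop_atTop
  have h2 : Tendsto (fun n : ℕ => 1 + (Real.log n)⁻¹) atTop (𝓝 (1 + 0)) :=
    tendsto_const_nhds.add hl.inv_tendsto_atTop
  rw [add_zero] at h2
  refine tendsto_of_tendsto_of_tendsto_of_le_of_le' tendsto_const_nhds h2 ?_ ?_
  · filter_upwards [hl.eventually_gt_atTop 0, eventually_ge_atTop 1] with n hn h1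
    rw [← div_eq_inv_mul, le_div_iff₀ hn, one_mul]
    refine le_trans ?_ (log_le_HH n)
    apply Real.log_le_log (by exact_mod_cast h1)
    push_cast; linarith
  · filter_upwards [hl.eventually_gt_atTop 0, eventually_ge_atTop 1] with n hn h1
    rw [← div_eq_inv_mul, div_le_iff₀ hn, add_mul, inv_mul_cancel₀ hn.ne', one_mul]
    linarith [HH_le n h1]

open Complex in
theorem determ (x : ℕ → ℝ)
    (h : ∀ᵐ t : ℝ, Tendsto (fun n : ℕ => (Real.log n)⁻¹ • SS (fun k =>
      cexp (t * x k * I) - cexp (-(t ^ 2 / 2 : ℝ))) n) atTop (𝓝 0))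
    (φ : BoundedContinuousFunction ℝ ℝ) :
    Tendsto (fun n : ℕ => (Real.log n)⁻¹ * ∑ k ∈ Finset.Icc 1 n, (k : ℝ)⁻¹ * φ (x k))
        atTop (𝓝 (∫ x, φ x ∂(gaussianReal 0 1))) := by
  have key : ∀ᵐ t : ℝ, Tendsto (fun n => charFun (NN x (n + 1)) t) atTop
      (𝓝 (cexp (-(t ^ 2 / 2 : ℝ)))) := by
    filter_upwards [h] with t ht
    have l1 := log_HH.inv₀ one_ne_zero
    have l2 := (l1.smul ht).comp (tendsto_add_atTop_nat 1)
    have l3 := l2.add_const (cexp (-(t ^ 2 / 2 : ℝ)))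
    simp only [smul_zero, zero_add] at l3
    refine l3.congr' ?_
    filter_upwards [eventually_ge_atTop 1] with n hn
    have hlog : Real.log (n + 1 : ℕ) ≠ 0 := by
      apply (Real.log_pos _).ne'
      push_cast
      have : (1 : ℝ) ≤ n := by exact_mod_cast hn
      linarith
    have hH := (HH_pos n).ne'
    rw [charFun_apply_real, NN_integral]
    simp only [Function.comp]
    rw [SS_sub_const, smul_smul]
    have : ((Real.log (n + 1 : ℕ))⁻¹ * HH (n + 1))⁻¹ * (Real.log (n + 1 : ℕ))⁻¹ =
      (HH (n + 1))⁻¹ := by field_simp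
    rw [this, smul_sub, smul_smul, inv_mul_cancel₀ hH, one_smul]
    simp [SS]
  have all := charFun_all (fun n => NN x (n + 1)) (fun t => cexp (-(t ^ 2 / 2 : ℝ)))
    (by fun_prop) (by simp) key
  let P0 : ProbabilityMeasure ℝ := ⟨gaussianReal 0 1, inferInstance⟩
  let P : ℕ → ProbabilityMeasure ℝ := fun n => ⟨NN x (n + 1), inferInstance⟩
  have conv : Tendsto P atTop (𝓝 P0) := by
    refine ProbabilityMeasure.tendsto_of_tendsto_charFun fun t => ?_
    have : charFun (gaussianReal 0 1) t = cexp (-(t ^ 2 / 2 : ℝ)) := by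
      rw [charFun_gaussianReal]; congr 1; push_cast; simp
    change Tendsto (fun n => charFun (NN x (n + 1)) t) atTop (𝓝 (charFun (gaussianReal 0 1) t))
    rw [this]
    exact all t
  have c2 := (ProbabilityMeasure.tendsto_iff_forall_integral_tendsto.1 conv) φ
  change Tendsto (fun n => ∫ y, φ y ∂(NN x (n + 1))) atTop
    (𝓝 (∫ x, φ x ∂(gaussianReal 0 1))) at c2
  rw [← tendsto_add_atTop_iff_nat 1]
  have c3 := (log_HH.comp (tendsto_add_atTop_nat 1)).mul c2
  rw [one_mul] at c3
  refine c3.congr fun n => ?_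
  rw [NN_integral]
  simp only [Function.comp, smul_eq_mul]
  rw [← mul_assoc, mul_assoc (Real.log _)⁻¹, mul_inv_cancel₀ (HH_pos n).ne', mul_one]

end ASCLT

namespace ASCLT

open Complex in
theorem StdGP.asclt {Ω : Type*} {mΩ : MeasurableSpace Ω} {μ : Measure Ω} [IsProbabilityMeasure μ]
    {X : ℕ → Ω → ℝ} {ρ : ℕ → ℕ → ℝ} (hX : StdGP X ρ μ) {p : ℕ} {D β c : ℝ} (h : Decay ρ D β)
    (h1 : p * β < 1) (h2 : 1 < (p + 1 : ℕ) * β) (hc : 0 < c)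
    (hlow : ∀ n : ℕ, c * n ≤ CC ρ p n n) :
    ∀ᵐ ω ∂μ, ∀ φ : BoundedContinuousFunction ℝ ℝ,
      Tendsto (fun n : ℕ => (Real.log n)⁻¹ * ∑ k ∈ Finset.Icc 1 n, (k : ℝ)⁻¹ *
        φ (GG ρ p k (fun j => X j ω)))
        atTop (𝓝 (∫ x, φ x ∂(gaussianReal 0 1))) := by
  have mX := hX.meas
  have mX' : Measurable (fun ω => (fun j => X j ω)) := measurable_pi_iff.2 mX
  have mG : ∀ k, Measurable (fun ω => GG ρ p k (fun j => X j ω)) :=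
    fun k => (measurable_GG p k).comp mX'
  have A : ∀ᵐ ω ∂μ, ∀ᵐ t : ℝ, Tendsto (fun n : ℕ => (Real.log n)⁻¹ • SS (fun k =>
      cexp (t * GG ρ p k (fun j => X j ω) * I) - cexp (-(t ^ 2 / 2 : ℝ))) n) atTop (𝓝 0) := by
    rw [Measure.ae_ae_comm]
    · exact Eventually.of_forall fun t => hX.cov_exp h h1 h2 hc hlow t
    · refine measurableSet_tendsto (𝓝 (0 : ℂ)) (f := fun (n : ℕ) (z : Ω × ℝ) =>
        (Real.log n)⁻¹ • SS (fun k =>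
          cexp (z.2 * GG ρ p k (fun j => X j z.1) * I) - cexp (-(z.2 ^ 2 / 2 : ℝ))) n) fun n => ?_
      have mG' : ∀ k, Measurable (fun z : Ω × ℝ => GG ρ p k (fun j => X j z.1)) :=
        fun k => (mG k).comp measurable_fst
      unfold SS
      fun_prop
  filter_upwards [A] with ω hω φ
  exact determ _ hω φ

end ASCLT

namespace ASCLT

noncomputable def rr (a : ℝ) (m : ℕ) : ℝ :=
  (1 / 2) * (((m : ℝ) + 1) ^ a + |(m : ℝ) - 1| ^ a - 2 * (m : ℝ) ^ a)

noncomputable def dd (a : ℝ) (m : ℕ) : ℝ := ((m + 1 : ℕ) : ℝ) ^ a - (m : ℝ) ^ a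

theorem rr_zero {a : ℝ} (ha : 0 < a) : rr a 0 = 1 := by
  unfold rr
  simp [Real.zero_rpow ha.ne']; norm_num

theorem rr_succ (a : ℝ) (m : ℕ) : rr a (m + 1) = (1 / 2) * (dd a (m + 1) - dd a m) := by
  unfold rr dd
  have : |((m + 1 : ℕ) : ℝ) - 1| = m := by push_cast; simp
  rw [this]; push_cast; ring

theorem rr_one {a : ℝ} (ha : 0 < a) : rr a 1 = (1 / 2) * ((2 : ℝ) ^ a - 2) := by
  unfold rr
  have : (1 : ℝ) + 1 = 2 := by norm_num
  simp [Real.zero_rpow ha.ne', this]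

theorem mvt1 {f f' : ℝ → ℝ} {x y : ℝ} (hxy : x < y) (hx : 0 < x)
    (hf : ∀ z, 0 < z → HasDerivAt f (f' z) z) : ∃ c ∈ Set.Ioo x y, f y - f x = f' c * (y - x) := by
  obtain ⟨c, hc, h⟩ := exists_hasDerivAt_eq_slope f f' hxy
    (fun z hz => (hf z (hx.trans_le hz.1)).continuousAt.continuousWithinAt)
    (fun z hz => hf z (hx.trans hz.1))
  refine ⟨c, hc, ?_⟩
  rw [h]
  have : y - x ≠ 0 := by linarith
  field_simp

theorem rr_mvt {a : ℝ} (m : ℕ) : ∃ η : ℝ, (m : ℝ) + 1 < η ∧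
    rr a (m + 2) = (1 / 2) * (a * (a - 1) * η ^ (a - 2)) := by
  have m0 : (0 : ℝ) < (m : ℝ) + 1 := by positivity
  have hd : ∀ b z : ℝ, 0 < z → HasDerivAt (fun z => z ^ b) (b * z ^ (b - 1)) z := fun b z hz =>
    Real.hasDerivAt_rpow_const (Or.inl hz.ne')
  obtain ⟨ξ, hξ, e1⟩ := mvt1 (f := fun z => (z + 1) ^ a - z ^ a)
    (f' := fun z => a * (z + 1) ^ (a - 1) - a * z ^ (a - 1))
    (show (m : ℝ) + 1 < (m : ℝ) + 2 by linarith) m0 (fun z hz =>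
      (((hd a (z + 1) (by linarith)).comp_add_const z 1).sub (hd a z hz)))
  have ξ0 : 0 < ξ := m0.trans hξ.1
  obtain ⟨η, hη, e2⟩ := mvt1 (f := fun z => a * z ^ (a - 1))
    (f' := fun z => a * ((a - 1) * z ^ (a - 1 - 1)))
    (show ξ < ξ + 1 by linarith) ξ0 (fun z hz => (hd (a - 1) z hz).const_mul a)
  refine ⟨η, hξ.1.trans hη.1, ?_⟩
  rw [rr_succ]
  unfold dd
  rw [e2] at e1
  have q1 : a - 1 - 1 = a - 2 := by ring
  rw [q1] at e1
  push_cast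
  have q2 : (m : ℝ) + 1 + 1 = m + 2 := by ring
  rw [q2] at e1 ⊢
  rw [e1]; ring

theorem rr_nonneg {a : ℝ} (ha : 1 ≤ a) (m : ℕ) : 0 ≤ rr a m := by
  have a0 : 0 < a := by linarith
  match m with
  | 0 => rw [rr_zero a0]; norm_num
  | 1 =>
    rw [rr_one a0]
    have := Real.rpow_le_rpow_of_exponent_le (x := 2) (by norm_num) ha
    rw [Real.rpow_one] at this
    linarith
  | m + 2 =>
    obtain ⟨η, h, e⟩ := rr_mvt (a := a) m
    have : 0 < η := lt_trans (by positivity) h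
    rw [e]
    have : 0 ≤ a - 1 := by linarith
    positivity

theorem rr_nonpos {a : ℝ} (a0 : 0 < a) (ha : a ≤ 1) (m : ℕ) : rr a (m + 1) ≤ 0 := by
  match m with
  | 0 =>
    rw [zero_add, rr_one a0]
    have := Real.rpow_le_rpow_of_exponent_le (x := 2) (by norm_num) ha
    rw [Real.rpow_one] at this
    linarith
  | m + 1 =>
    obtain ⟨η, h, e⟩ := rr_mvt (a := a) m
    have : 0 < η := lt_trans (by positivity) h
    change rr a (m + 2) ≤ 0
    rw [e]
    have h1 : 0 ≤ 1 - a := by linarith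
    have : 0 ≤ a * (1 - a) * η ^ (a - 2) := by positivity
    linarith

theorem rr_le {a : ℝ} (a0 : 0 < a) (ha : a < 2) (m : ℕ) :
    |rr a m| ≤ 18 * (1 + (m : ℝ)) ^ (a - 2) := by
  match m with
  | 0 => rw [rr_zero a0]; norm_num
  | 1 =>
    rw [rr_one a0]
    have h2 : (1 + ((1 : ℕ) : ℝ)) = 2 := by norm_num
    rw [h2]
    have p1 := Real.rpow_le_rpow_of_exponent_le (x := 2) (y := a) (z := (2 : ℕ)) (by norm_num)
      (by push_cast; linarith)
    have p2 := Real.rpow_le_rpow_of_exponent_le (x := 2) (y := -(2 : ℕ)) (z := a - 2) (by norm_num)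
      (by push_cast; linarith)
    rw [Real.rpow_natCast] at p1
    rw [Real.rpow_neg (by norm_num), Real.rpow_natCast] at p2
    have p3 : (0 : ℝ) < 2 ^ a := by positivity
    rw [abs_le]
    norm_num at p1 p2
    constructor <;> linarith
  | m + 2 =>
    obtain ⟨η, h, e⟩ := rr_mvt (a := a) m
    have m0 : (0 : ℝ) < (m : ℝ) + 1 := by positivity
    have η0 : 0 < η := lt_trans (by positivity) h
    have b1 : η ^ (a - 2) ≤ ((m : ℝ) + 1) ^ (a - 2) :=
      Real.rpow_le_rpow_of_nonpos m0 h.le (by linarith)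
    have b2 : ((m : ℝ) + 1) ^ (a - 2) ≤ ((1 + ((m + 2 : ℕ) : ℝ)) / 3) ^ (a - 2) :=
      Real.rpow_le_rpow_of_nonpos (by positivity) (by push_cast; linarith) (by linarith)
    rw [Real.div_rpow (by positivity) (by norm_num), div_eq_mul_inv,
      ← Real.rpow_neg (by norm_num)] at b2
    have b3 : (3 : ℝ) ^ (-(a - 2)) ≤ 9 := by
      have := Real.rpow_le_rpow_of_exponent_le (x := 3) (y := -(a - 2)) (z := (2 : ℕ)) (by norm_num)
        (by push_cast; linarith)
      rw [Real.rpow_natCast] at this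
      norm_num at this ⊢
      exact this
    have b4 : |a * (a - 1)| ≤ 2 := by
      rw [abs_le]; constructor <;> nlinarith
    rw [e, abs_mul, abs_mul, abs_of_pos (Real.rpow_pos_of_pos η0 _), abs_of_pos (by norm_num)]
    set w := (1 + ((m + 2 : ℕ) : ℝ)) ^ (a - 2) with hw
    have w0 : 0 ≤ w := by positivity
    have b5 : w * 3 ^ (-(a - 2)) ≤ w * 9 := by gcongr
    have b6 : η ^ (a - 2) ≤ w * 9 := b1.trans (b2.trans b5)
    have b7 : |a * (a - 1)| * η ^ (a - 2) ≤ 2 * (w * 9) := by gcongr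
    linarith

theorem sum_rr {a : ℝ} (a0 : 0 < a) (M : ℕ) : ∑ m ∈ Finset.range M, (- rr a (m + 1)) ≤ 1 / 2 := by
  have e : ∀ m, - rr a (m + 1) = (1 / 2) * dd a m - (1 / 2) * dd a (m + 1) := by
    intro m; rw [rr_succ]; ring
  simp only [e]
  rw [Finset.sum_range_sub']
  have h0 : dd a 0 = 1 := by unfold dd; simp [Real.zero_rpow a0.ne']
  have h1 : 0 ≤ dd a M := by
    unfold dd
    have : (M : ℝ) ^ a ≤ ((M + 1 : ℕ) : ℝ) ^ a := by
      apply Real.rpow_le_rpow (by positivity) (by push_cast; linarith) a0.le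
    linarith
  rw [h0]; linarith

theorem sum_rr_pow {a : ℝ} (a0 : 0 < a) (ha : a ≤ 1) (q : ℕ) (hq : 2 ≤ q) (M : ℕ) :
    ∑ m ∈ Finset.range M, |rr a (m + 1)| ^ q ≤ 1 / 4 := by
  have hh : ∀ m, |rr a (m + 1)| ≤ 1 / 2 := by
    intro m
    have := sum_rr a0 (m + 1)
    rw [Finset.sum_range_succ] at this
    have h2 : 0 ≤ ∑ m ∈ Finset.range m, (- rr a (m + 1)) :=
      Finset.sum_nonneg fun i _ => neg_nonneg.2 (rr_nonpos a0 ha i)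
    rw [abs_of_nonpos (rr_nonpos a0 ha m)]
    linarith
  have : ∀ m, |rr a (m + 1)| ^ q ≤ (1 / 2) * (- rr a (m + 1)) := by
    intro m
    rw [← abs_of_nonpos (rr_nonpos a0 ha m)]
    obtain ⟨k, rfl⟩ := Nat.exists_eq_add_of_le hq
    have h1 := abs_nonneg (rr a (m + 1))
    have h3 : |rr a (m + 1)| ^ k ≤ 1 := pow_le_one₀ h1 ((hh m).trans (by norm_num))
    have h2 := hh m
    rw [pow_add]
    nlinarith [mul_nonneg h1 h1]
  refine (Finset.sum_le_sum fun m _ => this m).trans ?_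
  rw [← Finset.mul_sum]
  linarith [sum_rr a0 M]

theorem row_bound {a : ℝ} (a0 : 0 < a) (q : ℕ) (hq : 2 ≤ q) {n i : ℕ} (hi : i < n) :
    1 / 2 ≤ ∑ j ∈ Finset.range n, rr a (Nat.dist i j) ^ q := by
  rcases le_total 1 a with ha | ha
  · have := Finset.single_le_sum (f := fun j => rr a (Nat.dist i j) ^ q)
      (fun j _ => pow_nonneg (rr_nonneg ha _) q) (Finset.mem_range.2 hi)
    simp only [Nat.dist_self, rr_zero a0, one_pow] at this
    linarith
  · obtain ⟨l, rfl⟩ := Nat.exists_eq_add_of_lt hi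
    rw [Finset.range_eq_Ico, ← Finset.sum_Ico_consecutive _ (Nat.zero_le i) hi.le,
      ← Finset.range_eq_Ico, Finset.sum_eq_sum_Ico_succ_bot hi]
    simp only [Nat.dist_self, rr_zero a0, one_pow]
    have A : ∑ j ∈ Finset.range i, |rr a (Nat.dist i j)| ^ q ≤ 1 / 4 := by
      rw [← Finset.sum_range_reflect]
      refine le_trans (le_of_eq ?_) (sum_rr_pow a0 ha q hq i)
      refine Finset.sum_congr rfl fun j hj => ?_
      rw [Finset.mem_range] at hj
      have : Nat.dist i (i - 1 - j) = j + 1 := by unfold Nat.dist; omega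
      rw [this]
    have B : ∑ j ∈ Finset.Ico (i + 1) (i + l + 1), |rr a (Nat.dist i j)| ^ q ≤ 1 / 4 := by
      rw [Finset.sum_Ico_eq_sum_range]
      refine le_trans (le_of_eq ?_) (sum_rr_pow a0 ha q hq (i + l + 1 - (i + 1)))
      refine Finset.sum_congr rfl fun j hj => ?_
      have : Nat.dist i (i + 1 + j) = j + 1 := by unfold Nat.dist; omega
      rw [this]
    have C : ∀ s : Finset ℕ, - ∑ j ∈ s, |rr a (Nat.dist i j)| ^ q ≤
        ∑ j ∈ s, rr a (Nat.dist i j) ^ q := by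
      intro s
      rw [← Finset.sum_neg_distrib]
      refine Finset.sum_le_sum fun j _ => ?_
      rw [← abs_pow]; exact neg_abs_le _
    have C1 := C (Finset.range i)
    have C2 := C (Finset.Ico (i + 1) (i + l + 1))
    linarith

theorem CC_low {a : ℝ} (a0 : 0 < a) (p : ℕ) (hp : 1 ≤ p) (n : ℕ) :
    (1 / 2) * (n : ℝ) ≤ CC (fun i j => rr a (Nat.dist i j)) p n n := by
  unfold CC
  have h1 : (n : ℝ) * (1 / 2) ≤ ∑ i ∈ Finset.range n, ∑ j ∈ Finset.range n,
      rr a (Nat.dist i j) ^ (p + 1) := by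
    have := Finset.card_nsmul_le_sum (Finset.range n) (fun i => ∑ j ∈ Finset.range n,
      rr a (Nat.dist i j) ^ (p + 1)) (1 / 2)
      (fun i hi => row_bound a0 (p + 1) (by omega) (Finset.mem_range.1 hi))
    simpa using this
  have h2 : (1 : ℝ) ≤ (p + 1).factorial := by
    exact_mod_cast Nat.succ_le_of_lt (Nat.factorial_pos _)
  have h3 : (0 : ℝ) ≤ n := by positivity
  nlinarith

theorem decay_rr {a β : ℝ} (a0 : 0 < a) (ha : a < 2) (hβ0 : 0 < β) (hβ : β ≤ 2 - a) :
    Decay (fun i j => rr a (Nat.dist i j)) 18 β := by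
  refine ⟨by norm_num, hβ0, fun i j => (rr_le a0 ha _).trans ?_⟩
  have : (1 : ℝ) ≤ 1 + (Nat.dist i j : ℝ) := by
    have : (0 : ℝ) ≤ (Nat.dist i j : ℝ) := by positivity
    linarith
  gcongr
  · linarith

end ASCLT

namespace ASCLT

theorem gp_of_lin {Ω : Type*} {mΩ : MeasurableSpace Ω} (μ : Measure Ω) [IsProbabilityMeasure μ]
    (B : ℕ → Ω → ℝ) (hBmeas : ∀ k, Measurable (B k))
    (hGauss : ∀ (s : Finset ℕ) (a : ℕ → ℝ), ∃ v : NNReal,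
      Measure.map (fun ω => ∑ i ∈ s, a i * B i ω) μ = gaussianReal 0 v) :
    IsGaussianProcess B μ := by
  constructor
  intro I
  constructor
  refine isGaussian_of_map_eq_gaussianReal fun L => ?_
  classical
  obtain ⟨v, hv⟩ := hGauss I (fun i => if h : i ∈ I then L (Pi.single ⟨i, h⟩ 1) else 0)
  refine ⟨0, v, ?_⟩
  have hm : Measurable (fun ω => I.restrict fun x => B x ω) :=
    measurable_pi_iff.2 fun i => hBmeas i
  rw [← hv, Measure.map_map (by fun_prop) hm]
  congr 1
  ext ω
  simp only [Function.comp]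
  have e : (I.restrict fun i => B i ω) = ∑ i : I, B i ω • (Pi.single i 1 : I → ℝ) := by
    ext j
    simp [Finset.sum_apply, Pi.single_apply]
  rw [e, map_sum, ← Finset.sum_coe_sort I]
  refine Finset.sum_congr rfl fun i _ => ?_
  simp [mul_comm]

theorem cov_id (H : ℝ) (i j : ℕ) :
    (1 / 2 : ℝ) * (((i + 1 : ℕ) : ℝ) ^ (2 * H) + ((j + 1 : ℕ) : ℝ) ^ (2 * H) -
      |((i + 1 : ℕ) : ℝ) - ((j + 1 : ℕ) : ℝ)| ^ (2 * H)) -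
    (1 / 2 : ℝ) * (((i + 1 : ℕ) : ℝ) ^ (2 * H) + (j : ℝ) ^ (2 * H) -
      |((i + 1 : ℕ) : ℝ) - (j : ℝ)| ^ (2 * H)) -
    (1 / 2 : ℝ) * ((i : ℝ) ^ (2 * H) + ((j + 1 : ℕ) : ℝ) ^ (2 * H) -
      |(i : ℝ) - ((j + 1 : ℕ) : ℝ)| ^ (2 * H)) +
    (1 / 2 : ℝ) * ((i : ℝ) ^ (2 * H) + (j : ℝ) ^ (2 * H) - |(i : ℝ) - (j : ℝ)| ^ (2 * H)) =
    rr (2 * H) (Nat.dist i j) := by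
  unfold rr
  have a1 : |((i + 1 : ℕ) : ℝ) - ((j + 1 : ℕ) : ℝ)| = |(i : ℝ) - j| := by
    push_cast; congr 1; ring
  rw [a1]
  rcases le_total i j with h | h
  · obtain ⟨d, rfl⟩ := Nat.exists_eq_add_of_le h
    have e1 : Nat.dist i (i + d) = d := by unfold Nat.dist; omega
    have e2 : |(i : ℝ) - ((i + d : ℕ) : ℝ)| = d := by push_cast; simp
    have e3 : |((i + 1 : ℕ) : ℝ) - ((i + d : ℕ) : ℝ)| = |(d : ℝ) - 1| := by
      rw [abs_sub_comm]; push_cast; congr 1; ring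
    have e4 : |(i : ℝ) - ((i + d + 1 : ℕ) : ℝ)| = (d : ℝ) + 1 := by
      rw [abs_sub_comm]; push_cast
      rw [abs_of_nonneg] <;> ring_nf; positivity
    rw [e1, e2, e3, e4]; ring
  · obtain ⟨d, rfl⟩ := Nat.exists_eq_add_of_le h
    have e1 : Nat.dist (j + d) j = d := by unfold Nat.dist; omega
    have e2 : |((j + d : ℕ) : ℝ) - (j : ℝ)| = d := by push_cast; simp
    have e3 : |((j + d : ℕ) : ℝ) - ((j + 1 : ℕ) : ℝ)| = |(d : ℝ) - 1| := by
      push_cast; congr 1; ring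
    have e4 : |((j + d + 1 : ℕ) : ℝ) - (j : ℝ)| = (d : ℝ) + 1 := by
      push_cast
      rw [abs_of_nonneg] <;> ring_nf; positivity
    rw [e1, e2, e3, e4]; ring

theorem stdGP_fbm {Ω : Type*} {mΩ : MeasurableSpace Ω} (μ : Measure Ω) [IsProbabilityMeasure μ]
    (H : ℝ) (hH0 : 0 < H)
    (B : ℕ → Ω → ℝ) (hBmeas : ∀ k, Measurable (B k))
    (hGauss : ∀ (s : Finset ℕ) (a : ℕ → ℝ), ∃ v : NNReal,
      Measure.map (fun ω => ∑ i ∈ s, a i * B i ω) μ = gaussianReal 0 v)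
    (hcov : ∀ k l : ℕ, ∫ ω, B k ω * B l ω ∂μ =
      (1 / 2 : ℝ) * ((k : ℝ) ^ (2 * H) + (l : ℝ) ^ (2 * H) - |(k : ℝ) - (l : ℝ)| ^ (2 * H))) :
    StdGP (fun k ω => B (k + 1) ω - B k ω) (fun i j => rr (2 * H) (Nat.dist i j)) μ := by
  have hB := gp_of_lin μ B hBmeas hGauss
  have hL2 : ∀ k, MemLp (B k) 2 μ := fun k =>
    (hB.hasGaussianLaw_eval k).memLp_two
  have hBint : ∀ k, Integrable (B k) μ := fun k => (hL2 k).integrable (by norm_num)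
  have hmean : ∀ k, ∫ ω, B k ω ∂μ = 0 := by
    intro k
    obtain ⟨v, hv⟩ := hGauss {k} (fun _ => 1)
    simp only [Finset.sum_singleton, one_mul] at hv
    have : ∫ x, x ∂(Measure.map (B k) μ) = ∫ ω, B k ω ∂μ :=
      integral_map (hBmeas k).aemeasurable (by fun_prop)
    rw [← this]
    change ∫ x, x ∂(Measure.map (fun ω => B k ω) μ) = 0
    rw [hv, integral_id_gaussianReal]
  have hmul : ∀ k l, Integrable (fun ω => B k ω * B l ω) μ := fun k l => (hL2 k).integrable_mul (hL2 l)
  refine ⟨fun k => by fun_prop, ?_, ?_, ?_, ?_⟩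
  · classical
    exact hB.of_isGaussianProcess fun t ↦ ⟨{t + 1, t},
      { toFun x := x ⟨t + 1, by simp⟩ - x ⟨t, by simp⟩
        map_add' x y := by simp; abel
        map_smul' c x := by simp; ring },
      by simp⟩
  · intro k
    rw [integral_sub (hBint _) (hBint _), hmean, hmean, sub_zero]
  · intro i j
    have e : ∀ ω, (B (i + 1) ω - B i ω) * (B (j + 1) ω - B j ω) =
      B (i + 1) ω * B (j + 1) ω - B (i + 1) ω * B j ω - B i ω * B (j + 1) ω + B i ω * B j ω := by
      intro ω; ring
    simp only [e]
    have i1 : Integrable (fun ω => B (i + 1) ω * B (j + 1) ω - B (i + 1) ω * B j ω) μ :=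
      (hmul _ _).sub (hmul _ _)
    have i2 : Integrable (fun ω => B (i + 1) ω * B (j + 1) ω - B (i + 1) ω * B j ω
      - B i ω * B (j + 1) ω) μ := i1.sub (hmul _ _)
    rw [integral_add i2 (hmul _ _), integral_sub i1 (hmul _ _), integral_sub (hmul _ _) (hmul _ _),
      hcov, hcov, hcov, hcov]
    exact cov_id H i j
  · intro i
    rw [Nat.dist_self, rr_zero (by linarith)]

end ASCLT

open ASCLT

theorem stmt13
    {Ω : Type*} {mΩ : MeasurableSpace Ω} (μ : Measure Ω) [IsProbabilityMeasure μ]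
    (q : ℕ) (hq : 2 ≤ q)
    (H : ℝ) (hH0 : 0 < H) (hH1 : H < 1 - 1 / (2 * (q : ℝ)))
    (B : ℕ → Ω → ℝ) (hBmeas : ∀ k, Measurable (B k))
    -- every finite real-linear combination of the `B_k` is centered Gaussian
    (hGauss : ∀ (s : Finset ℕ) (a : ℕ → ℝ), ∃ v : NNReal,
      Measure.map (fun ω => ∑ i ∈ s, a i * B i ω) μ = gaussianReal 0 v)
    -- fBm covariance structure
    (hcov : ∀ k l : ℕ, ∫ ω, B k ω * B l ω ∂μ =
      (1 / 2 : ℝ) * ((k : ℝ) ^ (2 * H) + (l : ℝ) ^ (2 * H) - |(k : ℝ) - (l : ℝ)| ^ (2 * H)))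
    -- Hermite power variation
    (V : ℕ → Ω → ℝ)
    (hV : ∀ n ω, V n ω =
      ∑ k ∈ Finset.range n, (Polynomial.aeval (B (k + 1) ω - B k ω) (Polynomial.hermite q) : ℝ))
    (hpos : ∀ n : ℕ, 1 ≤ n → 0 < ∫ ω, (V n ω) ^ 2 ∂μ)
    -- normalizing constants `σ_n` with `σ_n² = E[V_n²]/n`
    (σ : ℕ → ℝ) (hσ : ∀ n : ℕ, σ n = Real.sqrt ((∫ ω, (V n ω) ^ 2 ∂μ) / (n : ℝ)))
    -- the normalized sequence `G_n = V_n/(σ_n √n)`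
    (G : ℕ → Ω → ℝ) (hG : ∀ n ω, G n ω = V n ω / (σ n * Real.sqrt n)) :
    -- ASCLT
    ∀ᵐ ω ∂μ, ∀ φ : BoundedContinuousFunction ℝ ℝ,
      Tendsto (fun n : ℕ => (Real.log n)⁻¹ * ∑ k ∈ Finset.Icc 1 n, (k : ℝ)⁻¹ * φ (G k ω))
        atTop (𝓝 (∫ x, φ x ∂(gaussianReal 0 1))) := by
  have hX := stdGP_fbm μ H hH0 B hBmeas hGauss hcov
  obtain ⟨p, rfl⟩ : ∃ p, q = p + 1 := ⟨q - 1, by omega⟩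
  have hp : 1 ≤ p := by omega
  have p0 : (0 : ℝ) < p := by exact_mod_cast hp
  have q0 : (0 : ℝ) < ((p + 1 : ℕ) : ℝ) := by positivity
  have qp : ((p + 1 : ℕ) : ℝ) = p + 1 := by push_cast; ring
  set a := 2 * H with ha
  have a0 : 0 < a := by positivity
  have a2 : 1 / ((p + 1 : ℕ) : ℝ) < 2 - a := by
    have : 1 / (2 * ((p + 1 : ℕ) : ℝ)) = (1 / ((p + 1 : ℕ) : ℝ)) / 2 := by field_simp
    rw [this] at hH1
    linarith
  have iq : 0 < 1 / ((p + 1 : ℕ) : ℝ) := by positivity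
  have lt : 1 / ((p + 1 : ℕ) : ℝ) < 1 / (p : ℝ) := by
    apply one_div_lt_one_div_of_lt p0; rw [qp]; linarith
  obtain ⟨β, b1, b2⟩ := exists_between (lt_min a2 lt)
  have b3 : β < 2 - a := b2.trans_le (min_le_left _ _)
  have b4 : β < 1 / (p : ℝ) := b2.trans_le (min_le_right _ _)
  have hD := decay_rr (β := β) a0 (by linarith) (by linarith) b3.le
  have main := hX.asclt (p := p) hD (by rwa [mul_comm, ← lt_div_iff₀ p0])
    (by rwa [mul_comm, ← div_lt_iff₀ q0]) (c := 1 / 2) (by norm_num) (CC_low a0 p hp)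
  have hVW : ∀ n ω, V n ω = WW p n (fun j => B (j + 1) ω - B j ω) := hV
  filter_upwards [main] with ω hω φ
  refine (hω φ).congr fun n => ?_
  congr 1
  refine Finset.sum_congr rfl fun k hk => ?_
  have hk1 : 1 ≤ k := (Finset.mem_Icc.1 hk).1
  have hk0 : (0 : ℝ) < k := by exact_mod_cast hk1
  congr 2
  rw [hG, hσ, GG, ← hX.WW_sq, hVW]
  simp only [hVW]
  rw [← Real.sqrt_mul' _ hk0.le, div_mul_cancel₀ _ hk0.ne']
end
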